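/- arXiv:math/0612308 — 8 statements merged into one kernel-verified Lean document; each statement's English description precedes it below -/
import Mathlib

section
/- Consider ẋ(t) = f(t,x(t),d(t)) with d as input, where D ⊂ ℝˡ is compact, f: [0,∞)×ℝⁿ×D → ℝⁿ is continuous, f(t,0,d) = 0 for all t,d, and f is locally Lipschitz in x uniformly in d ∈ D. The system is Robustly Forward Complete if and only if there exist functions μ of class K⁺ and a of class K∞ such that for every measurable d: [0,∞)→D and every (t₀,x₀) ∈ [0,∞)×ℝⁿ, the unique solution x(t) of the system corresponding to d and initiated from x₀ at time t₀ exists for all t ≥ t₀ and satisfies |x(t)| ≤ μ(t)·a(|x₀|) for all t ≥ t₀. -/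
open Set Filter MeasureTheory

noncomputable section

abbrev Euc (n : ℕ) := EuclideanSpace ℝ (Fin n)

/-- Admissible disturbances: measurable functions with values in `D`. -/
def Adm {ld : ℕ} (D : Set (Euc ld)) (d : ℝ → Euc ld) : Prop :=
  Measurable d ∧ ∀ t, d t ∈ D

/-- A solution of `ẋ = f(t,x,d(t))` on the compact interval `[t₀,t₁]`, encoded via
the equivalent integral equation (locally absolutely continuous, ODE a.e.). -/
def IsSolOn {n ld : ℕ} (f : ℝ → Euc n → Euc ld → Euc n) (d : ℝ → Euc ld)
    (t₀ t₁ : ℝ) (x₀ : Euc n) (x : ℝ → Euc n) : Prop :=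
  ContinuousOn x (Set.Icc t₀ t₁) ∧
    ∀ t ∈ Set.Icc t₀ t₁, x t = x₀ + ∫ s in t₀..t, f s (x s) (d s)

/-- A global forward solution of `ẋ = f(t,x,d(t))` on `[t₀,∞)`. -/
def IsSolIci {n ld : ℕ} (f : ℝ → Euc n → Euc ld → Euc n) (d : ℝ → Euc ld)
    (t₀ : ℝ) (x₀ : Euc n) (x : ℝ → Euc n) : Prop :=
  ContinuousOn x (Set.Ici t₀) ∧
    ∀ t ∈ Set.Ici t₀, x t = x₀ + ∫ s in t₀..t, f s (x s) (d s)

/-- Robust forward completeness: for every `T ≥ 0`, `r ≥ 0` the values of all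
solutions with `|x₀| ≤ r`, `t₀ ∈ [0,T]`, at times `t₀+s`, `s ∈ [0,T]`, are uniformly
bounded. -/
def RFC {n ld : ℕ} (D : Set (Euc ld)) (f : ℝ → Euc n → Euc ld → Euc n) : Prop :=
  ∀ T ≥ (0:ℝ), ∀ r ≥ (0:ℝ), ∃ C : ℝ, ∀ t₀ ∈ Set.Icc (0:ℝ) T, ∀ x₀ : Euc n, ‖x₀‖ ≤ r →
    ∀ d, Adm D d → ∀ t₁ ≥ t₀, ∀ x : ℝ → Euc n, IsSolOn f d t₀ t₁ x₀ x →
      ∀ s ∈ Set.Icc (0:ℝ) T, t₀ + s ≤ t₁ → ‖x (t₀ + s)‖ ≤ C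

/-- A function of class `K⁺`: continuous and positive on `[0,∞)`. -/
def IsKPlus (φ : ℝ → ℝ) : Prop :=
  ContinuousOn φ (Set.Ici 0) ∧ ∀ t ∈ Set.Ici (0:ℝ), 0 < φ t

/-- A function of class `K∞`. -/
def IsKInfty (a : ℝ → ℝ) : Prop :=
  ContinuousOn a (Set.Ici 0) ∧ StrictMonoOn a (Set.Ici 0) ∧ a 0 = 0 ∧
    Filter.Tendsto a Filter.atTop Filter.atTop

structure SysHyp {n ld : ℕ} (D : Set (Euc ld)) (f : ℝ → Euc n → Euc ld → Euc n) : Prop where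
  closed : IsClosed D
  cont : ContinuousOn (fun q : ℝ × Euc n × Euc ld => f q.1 q.2.1 q.2.2)
      (Set.Ici 0 ×ˢ ((Set.univ : Set (Euc n)) ×ˢ D))
  lip : ∀ T ≥ (0:ℝ), ∀ r ≥ (0:ℝ), ∃ L : ℝ, 0 ≤ L ∧ (∀ t ∈ Set.Icc (0:ℝ) T,
      ∀ x : Euc n, ‖x‖ ≤ r → ∀ x' : Euc n, ‖x'‖ ≤ r →
      ∀ d ∈ D, ‖f t x d - f t x' d‖ ≤ L * ‖x - x'‖) ∧ (∀ t ∈ Set.Icc (0:ℝ) T,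
      ∀ x : Euc n, ‖x‖ ≤ r → ∀ d ∈ D, ‖f t x d‖ ≤ L * ‖x‖)

theorem integrable_rhs {n ld : ℕ} {D : Set (Euc ld)} {f : ℝ → Euc n → Euc ld → Euc n}
    (H : SysHyp D f) {d : ℝ → Euc ld} (hd : Adm D d) {a b : ℝ} (ha : 0 ≤ a) (hab : a ≤ b)
    {x : ℝ → Euc n} (hx : ContinuousOn x (Icc a b)) :
    IntervalIntegrable (fun s => f s (x s) (d s)) volume a b := by
  classical
  rw [intervalIntegrable_iff_integrableOn_Icc_of_le hab]
  obtain ⟨R, hR⟩ := isCompact_Icc.exists_bound_of_continuousOn hx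
  have hR0 : 0 ≤ R := (norm_nonneg _).trans (hR a ⟨le_rfl, hab⟩)
  obtain ⟨L, hL0, -, hL⟩ := H.lip b (ha.trans hab) R hR0
  set S : Set (ℝ × Euc n × Euc ld) := Set.Ici 0 ×ˢ ((Set.univ : Set (Euc n)) ×ˢ D) with hS
  have hSm : MeasurableSet S :=
    measurableSet_Ici.prod (MeasurableSet.univ.prod H.closed.measurableSet)
  have hG := ContinuousOn.measurable_piecewise (g := fun _ => (0 : Euc n)) H.cont
    continuousOn_const hSm
  have hxm : AEMeasurable x (volume.restrict (Icc a b)) := hx.aemeasurable measurableSet_Icc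
  have hq : AEMeasurable (fun s => (s, x s, d s)) (volume.restrict (Icc a b)) :=
    aemeasurable_id.prodMk (hxm.prodMk hd.1.aemeasurable)
  have hm : AEMeasurable (fun s => f s (x s) (d s)) (volume.restrict (Icc a b)) := by
    refine (hG.comp_aemeasurable hq).congr ?_
    filter_upwards [ae_restrict_mem measurableSet_Icc] with s hs
    have : (s, x s, d s) ∈ S := ⟨ha.trans hs.1, mem_univ _, hd.2 s⟩
    simp only [Function.comp]
    rw [Set.piecewise_eq_of_mem _ _ _ this]
  refine ⟨hm.aestronglyMeasurable, .restrict_of_bounded (C := L * R) (by simp) ?_⟩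
  filter_upwards [ae_restrict_mem measurableSet_Icc] with s hs
  exact (hL s ⟨ha.trans hs.1, hs.2⟩ _ (hR s hs) _ (hd.2 s)).trans
    (mul_le_mul_of_nonneg_left (hR s hs) hL0)

theorem IsSolOn.mono {n ld : ℕ} {f : ℝ → Euc n → Euc ld → Euc n} {d : ℝ → Euc ld}
    {a b c : ℝ} {x₀ : Euc n} {x : ℝ → Euc n} (h : IsSolOn f d a c x₀ x) (hbc : b ≤ c) :
    IsSolOn f d a b x₀ x :=
  ⟨h.1.mono (Icc_subset_Icc_right hbc), fun t ht => h.2 t ⟨ht.1, ht.2.trans hbc⟩⟩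

theorem IsSolOn.congr {n ld : ℕ} {f : ℝ → Euc n → Euc ld → Euc n} {d : ℝ → Euc ld}
    {a b : ℝ} {x₀ : Euc n} {x y : ℝ → Euc n} (h : IsSolOn f d a b x₀ x)
    (hxy : ∀ t ∈ Icc a b, y t = x t) :
    IsSolOn f d a b x₀ y := by
  refine ⟨h.1.congr hxy, fun t ht => ?_⟩
  rw [hxy t ht, h.2 t ht]
  congr 1
  refine intervalIntegral.integral_congr fun s hs => ?_
  rw [uIcc_of_le ht.1] at hs
  simp only [hxy s ⟨hs.1, hs.2.trans ht.2⟩]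

theorem isSolIci_of {n ld : ℕ} {f : ℝ → Euc n → Euc ld → Euc n} {d : ℝ → Euc ld}
    {a : ℝ} {x₀ : Euc n} {x : ℝ → Euc n} (h : ∀ k : ℕ, IsSolOn f d a (a + k) x₀ x) :
    IsSolIci f d a x₀ x := by
  have key : ∀ t, ∃ k : ℕ, t < a + k := fun t => by
    obtain ⟨k, hk⟩ := exists_nat_gt (t - a)
    exact ⟨k, by linarith⟩
  constructor
  · intro t ht
    obtain ⟨k, hk⟩ := key t
    refine ((h k).1 t ⟨ht, hk.le⟩).mono_of_mem_nhdsWithin ?_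
    rw [← Ici_inter_Iic]
    exact inter_mem_nhdsWithin _ (Iic_mem_nhds hk)
  · intro t ht
    obtain ⟨k, hk⟩ := key t
    exact (h k).2 t ⟨ht, hk.le⟩

theorem IsSolIci.on {n ld : ℕ} {f : ℝ → Euc n → Euc ld → Euc n} {d : ℝ → Euc ld}
    {a : ℝ} {x₀ : Euc n} {x : ℝ → Euc n} (h : IsSolIci f d a x₀ x) (b : ℝ) :
    IsSolOn f d a b x₀ x :=
  ⟨h.1.mono Icc_subset_Ici_self, fun t ht => h.2 t ht.1⟩

def glue {n : ℕ} (b : ℝ) (x y : ℝ → Euc n) (t : ℝ) : Euc n := if t ≤ b then x t else y t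

theorem glue_sol {n ld : ℕ} {D : Set (Euc ld)} {f : ℝ → Euc n → Euc ld → Euc n}
    (H : SysHyp D f) {d : ℝ → Euc ld} (hd : Adm D d) {a b c : ℝ} (ha : 0 ≤ a) (hab : a ≤ b)
    (hbc : b ≤ c) {x₀ : Euc n} {x y : ℝ → Euc n} (hx : IsSolOn f d a b x₀ x)
    (hy : IsSolOn f d b c (x b) y) : IsSolOn f d a c x₀ (glue b x y) := by
  have hyb : y b = x b := by
    have := hy.2 b ⟨le_rfl, hbc⟩
    simpa using this
  have e1 : ∀ t ∈ Icc a b, glue b x y t = x t := fun t ht => by simp [glue, ht.2]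
  have e2 : ∀ t ∈ Icc b c, glue b x y t = y t := fun t ht => by
    rcases ht.1.eq_or_lt with h | h
    · subst h; simp [glue, hyb]
    · simp [glue, h.not_ge]
  have s1 := hx.congr e1
  have s2 := hy.congr e2
  have hc : ContinuousOn (glue b x y) (Icc a c) := by
    rw [← Icc_union_Icc_eq_Icc hab hbc]
    exact s1.1.union_of_isClosed s2.1 isClosed_Icc isClosed_Icc
  refine ⟨hc, fun t ht => ?_⟩
  rcases le_total t b with h | h
  · exact s1.2 t ⟨ht.1, h⟩
  · rw [s2.2 t ⟨h, ht.2⟩, ← e1 b ⟨hab, le_rfl⟩, s1.2 b ⟨hab, le_rfl⟩, add_assoc,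
      intervalIntegral.integral_add_adjacent_intervals]
    · exact integrable_rhs H hd ha hab s1.1
    · exact integrable_rhs H hd (ha.trans hab) h (s2.1.mono (Icc_subset_Icc_right ht.2))

theorem gron {u : ℝ → ℝ} (hu : Continuous u) (hu0 : ∀ t, 0 ≤ u t) {a b c L : ℝ} (hc : 0 ≤ c)
    (hL : 0 ≤ L)
    (h : ∀ t ∈ Icc a b, u t ≤ c + L * ∫ s in a..t, u s) :
    ∀ t ∈ Icc a b, u t ≤ c * Real.exp (L * (t - a)) := by
  intro t ht
  set W : ℝ → ℝ := fun t => c + L * ∫ s in a..t, u s with hW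
  have hder : ∀ t, HasDerivAt W (L * u t) t := fun t =>
    ((hu.integral_hasStrictDerivAt a t).hasDerivAt.const_mul L).const_add c
  have hW0 : ∀ t ∈ Icc a b, 0 ≤ W t := fun t ht => (hu0 t).trans (h t ht)
  have := norm_le_gronwallBound_of_norm_deriv_right_le (f := W) (f' := fun t => L * u t)
    (δ := c) (K := L) (ε := 0) (a := a) (b := b)
    (fun t _ => (hder t).continuousAt.continuousWithinAt)
    (fun t _ => (hder t).hasDerivWithinAt) (by simp [hW, abs_of_nonneg hc]) (fun t ht => by
      have ht' := Ico_subset_Icc_self ht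
      rw [Real.norm_of_nonneg (mul_nonneg hL (hu0 t)), Real.norm_of_nonneg (hW0 t ht'), add_zero]
      exact mul_le_mul_of_nonneg_left (h t ht') hL) t ht
  rw [gronwallBound_ε0, Real.norm_of_nonneg (hW0 t ht)] at this
  exact (h t ht).trans this

theorem sol_bound {n ld : ℕ} {D : Set (Euc ld)} {f : ℝ → Euc n → Euc ld → Euc n}
    {d : ℝ → Euc ld} (hd : Adm D d) {a b : ℝ} (ha : 0 ≤ a) (hab : a ≤ b)
    {L R : ℝ} (hL0 : 0 ≤ L) (hL : ∀ t ∈ Set.Icc (0:ℝ) b,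
      ∀ x : Euc n, ‖x‖ ≤ R → ∀ d ∈ D, ‖f t x d‖ ≤ L * ‖x‖)
    {x₀ : Euc n} {x : ℝ → Euc n} (hx : IsSolOn f d a b x₀ x) (hR : ∀ t ∈ Icc a b, ‖x t‖ ≤ R) :
    ‖x b‖ ≤ ‖x₀‖ * Real.exp (L * (b - a)) := by
  set u : ℝ → ℝ := fun t => ‖IccExtend hab (domRestrict (Icc a b) x) t‖ with hu
  have huc : Continuous u := (hx.1.domRestrict.Icc_extend').norm
  have hue : ∀ t ∈ Icc a b, u t = ‖x t‖ := fun t ht => by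
    simp only [hu, IccExtend_of_mem hab _ ht]
    rfl
  have := gron huc (fun t => norm_nonneg _) (norm_nonneg x₀) hL0 (a := a) (b := b) (fun t ht => by
    rw [hue t ht, hx.2 t ht]
    refine (norm_add_le _ _).trans ?_
    gcongr
    rw [← intervalIntegral.integral_const_mul]
    refine intervalIntegral.norm_integral_le_of_norm_le ht.1 ?_
      ((huc.const_mul L).intervalIntegrable _ _)
    refine Eventually.of_forall fun s hs => ?_
    have hs' : s ∈ Icc a b := ⟨hs.1.le, hs.2.trans ht.2⟩
    rw [hue s hs']
    exact hL s ⟨ha.trans hs'.1, hs'.2⟩ _ (hR s hs') _ (hd.2 s)) b ⟨hab, le_rfl⟩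
  rwa [hue b ⟨hab, le_rfl⟩] at this

theorem local_exists {n ld : ℕ} {D : Set (Euc ld)} {f : ℝ → Euc n → Euc ld → Euc n}
    (H : SysHyp D f) {d : ℝ → Euc ld} (hd : Adm D d) {a b T C L : ℝ} (ha : 0 ≤ a) (hab : a ≤ b)
    (hbT : b ≤ T) (hL0 : 0 ≤ L) (hC0 : 0 ≤ C)
    (hLip : ∀ t ∈ Set.Icc (0:ℝ) T,
      ∀ x : Euc n, ‖x‖ ≤ C + 1 → ∀ x' : Euc n, ‖x'‖ ≤ C + 1 →
      ∀ d ∈ D, ‖f t x d - f t x' d‖ ≤ L * ‖x - x'‖)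
    (hbd : ∀ t ∈ Set.Icc (0:ℝ) T,
      ∀ x : Euc n, ‖x‖ ≤ C + 1 → ∀ d ∈ D, ‖f t x d‖ ≤ L * ‖x‖)
    (h1 : L * (C + 1) * (b - a) ≤ 1) (h2 : L * (b - a) ≤ 1 / 2)
    {x₀ : Euc n} (hx₀ : ‖x₀‖ ≤ C) : ∃ x, IsSolOn f d a b x₀ x := by
  have hba : 0 ≤ b - a := sub_nonneg.2 hab
  have hint : ∀ x : C(Icc a b, Euc n), ∀ t ∈ Icc a b,
      IntervalIntegrable (fun s => f s (IccExtend hab x s) (d s)) volume a t := fun x t ht =>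
    integrable_rhs H hd ha ht.1 (x.continuous.Icc_extend').continuousOn
  let Φ : C(Icc a b, Euc n) → C(Icc a b, Euc n) := fun x =>
    ⟨fun t => x₀ + ∫ s in a..(t:ℝ), f s (IccExtend hab x s) (d s), by
      have := intervalIntegral.continuousOn_primitive_interval' (hint x b ⟨hab, le_rfl⟩)
        left_mem_uIcc
      rw [uIcc_of_le hab] at this
      exact continuous_const.add this.domRestrict⟩
  have hΦ : ∀ x t, Φ x t = x₀ + ∫ s in a..(t:ℝ), f s (IccExtend hab x s) (d s) :=
    fun _ _ => rfl
  let S : Set C(Icc a b, Euc n) := {x | ∀ t, ‖x t‖ ≤ C + 1}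
  have hSc : IsClosed S := by
    have : S = ⋂ t, {x | ‖x t‖ ≤ C + 1} := by ext; simp [S]
    rw [this]
    exact isClosed_iInter fun t =>
      isClosed_le (continuous_norm.comp (continuous_eval_const t)) continuous_const
  have hE : ∀ x ∈ S, ∀ s, ‖IccExtend hab x s‖ ≤ C + 1 := fun x hx s => hx _
  have hmaps : MapsTo Φ S S := by
    intro x hx t
    rw [hΦ]
    have hi : ‖∫ s in a..(t:ℝ), f s (IccExtend hab x s) (d s)‖ ≤ L * (C + 1) * |t - a| := by
      refine intervalIntegral.norm_integral_le_of_norm_le_const fun s hs => ?_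
      rw [uIoc_of_le t.2.1] at hs
      refine (hbd s ⟨ha.trans hs.1.le, hs.2.trans (t.2.2.trans hbT)⟩ _ (hE x hx s) _ (hd.2 s)).trans ?_
      exact mul_le_mul_of_nonneg_left (hE x hx s) hL0
    have : L * (C + 1) * |t - a| ≤ 1 := by
      refine le_trans ?_ h1
      rw [abs_of_nonneg (sub_nonneg.2 t.2.1)]
      have := t.2.2
      gcongr
    refine (norm_add_le _ _).trans ?_
    linarith
  have hcontr : ContractingWith (1/2) (hmaps.restrict Φ S S) := by
    refine ⟨by rw [← NNReal.coe_lt_coe]; norm_num, LipschitzWith.of_dist_le_mul ?_⟩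
    rintro ⟨x, hx⟩ ⟨y, hy⟩
    change dist (Φ x) (Φ y) ≤ _ * dist x y
    rw [ContinuousMap.dist_le (by positivity)]
    intro t
    rw [hΦ, hΦ, dist_add_left, dist_eq_norm, ← intervalIntegral.integral_sub (hint x t t.2)
      (hint y t t.2)]
    have hi : ‖∫ s in a..(t:ℝ), (f s (IccExtend hab x s) (d s) - f s (IccExtend hab y s) (d s))‖
        ≤ L * dist x y * |t - a| := by
      refine intervalIntegral.norm_integral_le_of_norm_le_const fun s hs => ?_
      rw [uIoc_of_le t.2.1] at hs
      refine (hLip s ⟨ha.trans hs.1.le, hs.2.trans (t.2.2.trans hbT)⟩ _ (hE x hx s) _ (hE y hy s)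
        _ (hd.2 s)).trans ?_
      refine mul_le_mul_of_nonneg_left ?_ hL0
      rw [← dist_eq_norm]
      exact ContinuousMap.dist_apply_le_dist _
    refine hi.trans ?_
    rw [abs_of_nonneg (sub_nonneg.2 t.2.1)]
    calc L * dist x y * (t - a) ≤ L * dist x y * (b - a) := by
          have := t.2.2
          gcongr
      _ = L * (b - a) * dist x y := by ring
      _ ≤ 1 / 2 * dist x y := by gcongr
      _ = _ := by norm_num
  obtain ⟨x, hxS, hfix, -⟩ := hcontr.exists_fixedPoint' hSc.isComplete hmaps
    (x := ContinuousMap.const _ 0) (fun t => by simp; linarith) (edist_ne_top _ _)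
  refine ⟨IccExtend hab x, (x.continuous.Icc_extend').continuousOn, fun t ht => ?_⟩
  rw [IccExtend_of_mem hab _ ht, ← hΦ x ⟨t, ht⟩, hfix]

theorem unit_exists {n ld : ℕ} {D : Set (Euc ld)} {f : ℝ → Euc n → Euc ld → Euc n}
    (H : SysHyp D f) (hRFC : RFC D f) {d : ℝ → Euc ld} (hd : Adm D d) {a : ℝ} (ha : 0 ≤ a)
    (x₀ : Euc n) : ∃ x, IsSolOn f d a (a + 1) x₀ x := by
  obtain ⟨C', hC'⟩ := hRFC (a + 1) (by linarith) ‖x₀‖ (norm_nonneg _)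
  set C := max C' ‖x₀‖ with hCdef
  have hC0 : 0 ≤ C := (norm_nonneg x₀).trans (le_max_right _ _)
  obtain ⟨L, hL0, hLip, hbd⟩ := H.lip (a + 1) (by linarith) (C + 1) (by linarith)
  obtain ⟨N, hN⟩ := exists_nat_gt (max (L * (C + 1)) (2 * L))
  have hN1 := (le_max_left _ _).trans hN.le
  have hN2 := (le_max_right _ _).trans hN.le
  have hNpos : (0:ℝ) < N := lt_of_le_of_lt (by positivity) ((le_max_right _ _).trans_lt hN)
  have key : ∀ j : ℕ, j ≤ N → ∃ x, IsSolOn f d a (a + j / N) x₀ x := by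
    intro j
    induction j with
    | zero =>
      intro _
      refine ⟨fun _ => x₀, continuousOn_const, fun t ht => ?_⟩
      have : t = a := by
        simp at ht
        exact ht
      subst this
      simp
    | succ j ih =>
      intro hj
      obtain ⟨x, hx⟩ := ih (by omega)
      have hj1 : ((j:ℝ) + 1) / N ≤ 1 := by
        rw [div_le_one hNpos]
        exact_mod_cast hj
      have hj0 : (0:ℝ) ≤ j / N := by positivity
      have hstep : ((j:ℝ) + 1) / N = j / N + 1 / N := by ring
      have hNi : (0:ℝ) < 1 / N := by positivity
      have hend : ‖x (a + j / N)‖ ≤ C :=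
        (hC' a ⟨ha, by linarith⟩ x₀ le_rfl d hd _ (by linarith) x hx (j / N)
          ⟨hj0, by linarith⟩ le_rfl).trans (le_max_left _ _)
      obtain ⟨y, hy⟩ := local_exists H hd (a := a + j / N) (b := a + (j + 1) / N) (T := a + 1)
        (by linarith) (by linarith) (by linarith) hL0 hC0 hLip hbd
        (by
          rw [show a + ((j:ℝ) + 1) / N - (a + j / N) = 1 / N by rw [hstep]; ring,
            mul_one_div, div_le_one hNpos]
          exact hN1)
        (by
          rw [show a + ((j:ℝ) + 1) / N - (a + j / N) = 1 / N by rw [hstep]; ring,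
            mul_one_div, div_le_iff₀ hNpos]
          linarith) hend
      refine ⟨glue (a + j / N) x y, ?_⟩
      push_cast
      exact glue_sol H hd ha (by linarith) (by linarith) hx hy
  obtain ⟨x, hx⟩ := key N le_rfl
  rw [div_self hNpos.ne'] at hx
  exact ⟨x, hx⟩

theorem global_exists {n ld : ℕ} {D : Set (Euc ld)} {f : ℝ → Euc n → Euc ld → Euc n}
    (H : SysHyp D f) (hRFC : RFC D f) {d : ℝ → Euc ld} (hd : Adm D d) {a : ℝ} (ha : 0 ≤ a)
    (x₀ : Euc n) : ∃ x, IsSolIci f d a x₀ x := by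
  have hex : ∀ (k : ℕ) (y : Euc n), ∃ x, IsSolOn f d (a + k) (a + k + 1) y x := fun k y =>
    unit_exists H hRFC hd (by positivity) y
  choose S hS using hex
  let X : ℕ → ℝ → Euc n := fun k =>
    Nat.rec (fun _ => x₀) (fun k Xk => glue (a + k) Xk (S k (Xk (a + k)))) k
  have hX : ∀ k : ℕ, IsSolOn f d a (a + k) x₀ (X k) := by
    intro k
    induction k with
    | zero =>
      refine ⟨continuousOn_const, fun t ht => ?_⟩
      have : t = a := by
        simp at ht
        exact ht
      subst this
      simp [X]
    | succ k ih =>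
      have := glue_sol H hd ha (by simp) (by linarith) ih (hS k (X k (a + k)))
      push_cast
      rw [← add_assoc]
      exact this
  have hstep : ∀ (k : ℕ) (t : ℝ), t ≤ a + k → X (k + 1) t = X k t := fun k t ht => by
    change glue (a + k) (X k) (S k (X k (a + k))) t = X k t
    simp [glue, ht]
  have hcons : ∀ (k m : ℕ) (t : ℝ), t ≤ a + k → X (k + m) t = X k t := by
    intro k m t ht
    induction m with
    | zero => rfl
    | succ m ih =>
      rw [← add_assoc, hstep _ _ (by push_cast; linarith [(Nat.cast_nonneg m : (0:ℝ) ≤ m)]), ih]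
  refine ⟨fun t => X ⌈t - a⌉₊ t, isSolIci_of fun k => (hX k).congr fun t ht => ?_⟩
  have h1 : ⌈t - a⌉₊ ≤ k := by
    rw [Nat.ceil_le]; linarith [ht.2]
  obtain ⟨m, rfl⟩ := Nat.exists_eq_add_of_le h1
  rw [hcons]
  linarith [Nat.le_ceil (t - a)]

theorem exists_majorant (c : ℕ → ℝ) : ∃ G : ℝ → ℝ, Continuous G ∧ Monotone G ∧ (∀ t, 1 ≤ G t) ∧
    ∀ t, ∀ k : ℕ, (k : ℝ) ≤ t + 1 → c k ≤ G t := by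
  let h : ℝ → ℝ := fun t => 1 + ∑ i ∈ Finset.range (⌈t⌉₊ + 2), |c i|
  have hmono : Monotone h := fun s t hst => by
    have := Nat.ceil_mono hst
    simp only [h]
    gcongr
  have h1 : ∀ t, 1 ≤ h t := fun t => by
    simp only [h, le_add_iff_nonneg_right]
    positivity
  have hk : ∀ t, ∀ k : ℕ, (k : ℝ) ≤ t + 1 → c k ≤ h t := fun t k hkt => by
    have : k < ⌈t⌉₊ + 2 := by
      have : (k:ℝ) < ⌈t⌉₊ + 2 := by linarith [Nat.le_ceil t]
      exact_mod_cast this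
    calc c k ≤ |c k| := le_abs_self _
      _ ≤ ∑ i ∈ Finset.range (⌈t⌉₊ + 2), |c i| :=
        Finset.single_le_sum (f := fun i => |c i|) (fun i _ => abs_nonneg _)
          (Finset.mem_range.2 this)
      _ ≤ h t := by simp [h]
  have hint : ∀ a b, IntervalIntegrable h volume a b := fun a b => hmono.intervalIntegrable
  have hle : ∀ t, h t ≤ ∫ s in t..(t + 1), h s := fun t => by
    have := intervalIntegral.integral_mono_on (f := fun _ => h t) (g := h) (μ := volume)
      (by linarith : t ≤ t + 1) (by simp) (hint _ _) (fun s hs => hmono hs.1)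
    simpa using this
  refine ⟨fun t => ∫ s in t..(t + 1), h s, ?_, ?_, fun t => (h1 t).trans (hle t),
    fun t k hkt => (hk t k hkt).trans (hle t)⟩
  · have hP := intervalIntegral.continuous_primitive hint 0
    have : (fun t => ∫ s in t..(t + 1), h s) =
        fun t => (∫ s in (0:ℝ)..(t + 1), h s) - ∫ s in (0:ℝ)..t, h s := by
      funext t
      rw [intervalIntegral.integral_interval_sub_left (hint _ _) (hint _ _)]
    rw [this]
    exact (hP.comp (continuous_id.add continuous_const)).sub hP
  · have : (fun t => ∫ s in t..(t + 1), h s) = fun t => ∫ s in (0:ℝ)..1, h (s + t) := by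
      funext t
      rw [intervalIntegral.integral_comp_add_right (f := h)]
      simp [add_comm]
    rw [this]
    intro s t hst
    refine intervalIntegral.integral_mono_on (by norm_num) ?_ ?_ fun u _ => hmono (by linarith)
    · exact (hmono.comp (fun _ _ h => by linarith : Monotone fun u => u + s)).intervalIntegrable
    · exact (hmono.comp (fun _ _ h => by linarith : Monotone fun u => u + t)).intervalIntegrable

theorem rfc_gain {n ld : ℕ} {D : Set (Euc ld)} {f : ℝ → Euc n → Euc ld → Euc n}
    (H : SysHyp D f) (hRFC : RFC D f) (k : ℕ) : ∃ c : ℝ, ∀ t₀ ≥ (0:ℝ), ∀ t ≥ t₀, t ≤ k →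
      ∀ x₀ : Euc n, ‖x₀‖ ≤ k → ∀ d, Adm D d → ∀ x, IsSolIci f d t₀ x₀ x →
        ‖x t‖ ≤ c * ‖x₀‖ := by
  obtain ⟨C', hC'⟩ := hRFC k (by positivity) k (by positivity)
  obtain ⟨L, hL0, -, hbd⟩ := H.lip k (by positivity) (max C' 0) (le_max_right _ _)
  refine ⟨Real.exp (L * k), fun t₀ ht₀ t ht htk x₀ hx₀ d hd x hx => ?_⟩
  have h := sol_bound hd ht₀ ht hL0 (fun s hs => hbd s ⟨hs.1, hs.2.trans htk⟩) (hx.on t)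
    (fun s hs => by
      have := hC' t₀ ⟨ht₀, ht.trans htk⟩ x₀ hx₀ d hd t ht x (hx.on t) (s - t₀)
        ⟨sub_nonneg.2 hs.1, by linarith [hs.2]⟩ (by linarith [hs.2])
      rw [add_sub_cancel] at this
      exact this.trans (le_max_left _ _))
  refine h.trans ?_
  rw [mul_comm]
  gcongr
  linarith

/-- Proposition 2.3: the system `ẋ = f(t,x,d)` is robustly forward complete if and
only if there exist `μ ∈ K⁺` and `a ∈ K∞` such that for every admissible `d` and
every `(t₀,x₀)` the unique solution exists on all of `[t₀,∞)` and satisfies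
`|x(t)| ≤ μ(t)·a(|x₀|)` for all `t ≥ t₀`. -/
theorem rfc_iff_bound (n ld : ℕ) (D : Set (Euc ld)) (hD : IsCompact D)
    (hDne : D.Nonempty) (f : ℝ → Euc n → Euc ld → Euc n)
    (hf_cont : ContinuousOn (fun q : ℝ × Euc n × Euc ld => f q.1 q.2.1 q.2.2)
      (Set.Ici 0 ×ˢ ((Set.univ : Set (Euc n)) ×ˢ D)))
    (hf0 : ∀ t ≥ (0:ℝ), ∀ d ∈ D, f t 0 d = 0)
    (hf_lip : ∀ T ≥ (0:ℝ), ∀ r ≥ (0:ℝ), ∃ L : ℝ, ∀ t ∈ Set.Icc (0:ℝ) T,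
      ∀ x ∈ Metric.closedBall (0 : Euc n) r, ∀ x' ∈ Metric.closedBall (0 : Euc n) r,
      ∀ d ∈ D, ‖f t x d - f t x' d‖ ≤ L * ‖x - x'‖) :
    RFC D f ↔
      ∃ μ a : ℝ → ℝ, IsKPlus μ ∧ IsKInfty a ∧
        ∀ t₀ ≥ (0:ℝ), ∀ x₀ : Euc n, ∀ d, Adm D d →
          (∃ x : ℝ → Euc n, IsSolIci f d t₀ x₀ x) ∧
          (∀ x : ℝ → Euc n, IsSolIci f d t₀ x₀ x →
            ∀ t ≥ t₀, ‖x t‖ ≤ μ t * a ‖x₀‖) := by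
  have H : SysHyp D f := by
    refine ⟨hD.isClosed, hf_cont, fun T hT r hr => ?_⟩
    obtain ⟨L, hL⟩ := hf_lip T hT r hr
    have hl : ∀ t ∈ Set.Icc (0:ℝ) T,
      ∀ x : Euc n, ‖x‖ ≤ r → ∀ x' : Euc n, ‖x'‖ ≤ r →
      ∀ d ∈ D, ‖f t x d - f t x' d‖ ≤ |L| * ‖x - x'‖ := fun t ht x hx x' hx' d hd =>
      (hL t ht x (by simpa using hx) x' (by simpa using hx') d hd).trans
        (mul_le_mul_of_nonneg_right (le_abs_self L) (norm_nonneg _))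
    refine ⟨|L|, abs_nonneg _, hl, fun t ht x hx d hd => ?_⟩
    have := hl t ht x hx 0 (by simpa using hr) d hd
    simpa [hf0 t ht.1 d hd] using this
  constructor
  · intro hRFC
    choose c hc using rfc_gain H hRFC
    obtain ⟨G, hGc, hGm, hG1, hG⟩ := exists_majorant c
    have hG0 : ∀ t, 0 < G t := fun t => one_pos.trans_le (hG1 t)
    refine ⟨G, fun s => s * G s, ⟨hGc.continuousOn, fun t _ => hG0 t⟩,
      ⟨(continuous_id.mul hGc).continuousOn, ?_, by simp, ?_⟩, ?_⟩
    · intro s hs t ht hst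
      exact mul_lt_mul hst (hGm hst.le) (hG0 s) ht
    · refine tendsto_atTop_mono' _ ?_ tendsto_id
      filter_upwards [eventually_ge_atTop 0] with s hs
      exact le_mul_of_one_le_right hs (hG1 s)
    · intro t₀ ht₀ x₀ d hd
      refine ⟨global_exists H hRFC hd ht₀ x₀, fun x hx t ht => ?_⟩
      have ht0 : 0 ≤ t := le_trans ht₀ ht
      set m := max t ‖x₀‖ with hm
      have hm0 : 0 ≤ m := ht0.trans (le_max_left _ _)
      have h1 := hc ⌈m⌉₊ t₀ ht₀ t ht ((le_max_left _ _).trans (Nat.le_ceil m)) x₀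
        ((le_max_right _ _).trans (Nat.le_ceil m)) d hd x hx
      have h2 : c ⌈m⌉₊ ≤ G m := hG m _ (Nat.ceil_lt_add_one hm0).le
      have h3 : G m ≤ G t * G ‖x₀‖ := by
        rcases max_choice t ‖x₀‖ with h | h
        · rw [hm, h]; exact le_mul_of_one_le_right (hG0 _).le (hG1 _)
        · rw [hm, h]; exact le_mul_of_one_le_left (hG0 _).le (hG1 _)
      calc ‖x t‖ ≤ c ⌈m⌉₊ * ‖x₀‖ := h1
        _ ≤ (G t * G ‖x₀‖) * ‖x₀‖ := by gcongr; exact h2.trans h3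
        _ = G t * (‖x₀‖ * G ‖x₀‖) := by ring
  · rintro ⟨μ, a, hμ, ha, hsol⟩ T hT r hr
    obtain ⟨B, hB⟩ := (isCompact_Icc (a := (0:ℝ)) (b := T + T)).exists_bound_of_continuousOn
      (hμ.1.mono Icc_subset_Ici_self)
    refine ⟨B * a r, fun t₀ ht₀ x₀ hx₀ d hd t₁ ht₁ x hx s hs hst => ?_⟩
    have ht₁0 : 0 ≤ t₁ := le_trans ht₀.1 ht₁
    obtain ⟨y, hy⟩ := (hsol t₁ ht₁0 (x t₁) d hd).1
    have hz : IsSolIci f d t₀ x₀ (glue t₁ x y) := by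
      refine isSolIci_of fun k => ?_
      refine IsSolOn.mono (c := t₁ + k) ?_ (by linarith)
      exact glue_sol H hd ht₀.1 ht₁ (by simp) hx (hy.on _)
    have h1 := (hsol t₀ ht₀.1 x₀ d hd).2 _ hz (t₀ + s) (by linarith [hs.1])
    have h2 : glue t₁ x y (t₀ + s) = x (t₀ + s) := by simp [glue, hst]
    rw [h2] at h1
    have hmem : t₀ + s ∈ Icc 0 (T + T) := ⟨add_nonneg ht₀.1 hs.1, add_le_add ht₀.2 hs.2⟩
    have h3 : μ (t₀ + s) ≤ B := (le_abs_self _).trans (hB _ hmem)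
    have h4 : a ‖x₀‖ ≤ a r := ha.2.1.monotoneOn (norm_nonneg x₀) hr hx₀
    have h5 : 0 ≤ a ‖x₀‖ := by
      rw [← ha.2.2.1]
      exact ha.2.1.monotoneOn self_mem_Ici (norm_nonneg x₀) (norm_nonneg x₀)
    have h6 := hμ.2 (t₀ + s) hmem.1
    exact h1.trans (mul_le_mul h3 h4 h5 (h6.le.trans h3))
end
end

section
/- Let y: [0,∞) → [0,∞) be an absolutely continuous function that satisfies the differential inequality ẏ(t) ≤ −a(t)·y(t) + b(t) for almost every t ∈ [t₀,t₁], where a: [0,∞) → ℝ and b: [0,∞) → [0,∞) are continuous functions with ∫₀^∞ a(t)dt = +∞, lim_{t→∞} b(t)/a(t) = M for some M ≥ 0, and a(t) > 0 for all t ≥ T for a certain time T ≥ 0. Then there exists a constant K > 0, independent of t₁ (depending only on t₀, y(t₀), a, b and T), such that y(t) ≤ K for all t ∈ [t₀,t₁]. -/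
open Set Filter MeasureTheory

noncomputable section

lemma aux_gronwall (y : ℝ → ℝ) (p r A C : ℝ) (hpr : p ≤ r) (hA : 0 ≤ A)
    (hc : ContinuousOn y (Icc p r)) (hn : ∀ t ∈ Icc p r, 0 ≤ y t)
    (h : ∀ t ∈ Icc p r, y t ≤ C + A * ∫ u in p..t, y u) :
    y r ≤ C + A * gronwallBound 0 A C (r - p) := by
  have hint : IntervalIntegrable y volume p r := by
    apply ContinuousOn.intervalIntegrable
    rwa [uIcc_of_le hpr]
  have hF0 : ∀ t ∈ Icc p r, 0 ≤ ∫ u in p..t, y u := by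
    intro t ht
    apply intervalIntegral.integral_nonneg ht.1
    intro u hu
    exact hn u ⟨hu.1, hu.2.trans ht.2⟩
  have key := norm_le_gronwallBound_of_norm_deriv_right_le (f := fun t => ∫ u in p..t, y u)
    (f' := y) (a := p) (b := r) (δ := 0) (K := A) (ε := C) ?_ ?_ (by simp) ?_ r ⟨hpr, le_rfl⟩
  · have h1 := h r ⟨hpr, le_rfl⟩
    have h2 : (∫ u in p..r, y u) ≤ gronwallBound 0 A C (r - p) := (le_abs_self _).trans key
    have := mul_le_mul_of_nonneg_left h2 hA
    linarith
  · have := intervalIntegral.continuousOn_primitive_interval' hint (left_mem_uIcc)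
    rwa [uIcc_of_le hpr] at this
  · intro x hx
    have hi : IntervalIntegrable y volume p x := hint.mono_set (by
      rw [uIcc_of_le hpr, uIcc_of_le hx.1]; exact Icc_subset_Icc le_rfl hx.2.le)
    have hIoi : Ioo x r ∈ nhdsWithin x (Ioi x) := Ioo_mem_nhdsGT hx.2
    have hcw : ContinuousWithinAt y (Ioi x) x := by
      have h1 := (hc x ⟨hx.1, hx.2.le⟩).mono
        (show Ioo x r ⊆ Icc p r from fun z hz => ⟨hx.1.trans hz.1.le, hz.2.le⟩)
      exact h1.mono_of_mem_nhdsWithin hIoi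
    apply intervalIntegral.integral_hasDerivWithinAt_right hi _ hcw
    refine ⟨Ioo x r, hIoi, ?_⟩
    exact (hc.mono (fun z hz => ⟨hx.1.trans hz.1.le, hz.2.le⟩)).aestronglyMeasurable
      measurableSet_Ioo
  · intro x hx
    have hx' : x ∈ Icc p r := ⟨hx.1, hx.2.le⟩
    rw [Real.norm_of_nonneg (hn x hx'), Real.norm_of_nonneg (hF0 x hx')]
    linarith [h x hx']

/-- Barrier: if `y` starts below `C` and is nonincreasing on stretches above `C`, then `y ≤ C`. -/
lemma aux_barrier (y : ℝ → ℝ) (p r C : ℝ) (hpr : p ≤ r)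
    (hc : ContinuousOn y (Icc p r)) (h0 : y p ≤ C)
    (h : ∀ s ∈ Icc p r, (∀ u ∈ Ioc s r, C < y u) → y r ≤ y s) : y r ≤ C := by
  have hcl : IsCompact (Icc p r ∩ y ⁻¹' Iic C) :=
    isCompact_Icc.of_isClosed_subset (hc.preimage_isClosed_of_isClosed isClosed_Icc isClosed_Iic)
      inter_subset_left
  obtain ⟨s, hs, hmax⟩ := hcl.exists_isGreatest ⟨p, ⟨le_rfl, hpr⟩, h0⟩
  refine (h s hs.1 ?_).trans hs.2
  intro u hu
  by_contra hcon
  have := hmax ⟨⟨hs.1.1.trans hu.1.le, hu.2⟩, not_lt.1 hcon⟩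
  exact absurd this (not_le.2 hu.1)

/-- Lemma 2.11: if `y : [0,∞) → [0,∞)` is absolutely continuous on `[t₀,t₁]`
(encoded by the existence of an integrable a.e.-derivative `y'` satisfying the
fundamental theorem of calculus) and satisfies `ẏ(t) ≤ −a(t)·y(t) + b(t)` a.e. on
`[t₀,t₁]`, where `a, b` are continuous on `[0,∞)`, `b ≥ 0`, `∫₀^∞ a(t) dt = +∞`,
`b(t)/a(t) → M ≥ 0` and `a(t) > 0` for `t ≥ T`, then there is a constant `K > 0`
independent of `t₁` (depending only on `t₀`, `y(t₀)`, `a`, `b`, `T`) with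
`y(t) ≤ K` on `[t₀,t₁]`. -/
theorem bounded_of_diff_ineq (a b : ℝ → ℝ)
    (ha : ContinuousOn a (Set.Ici 0)) (hb : ContinuousOn b (Set.Ici 0))
    (hbnn : ∀ t ≥ (0:ℝ), 0 ≤ b t)
    (hdiv : Filter.Tendsto (fun t => ∫ s in (0:ℝ)..t, a s) Filter.atTop Filter.atTop)
    (M : ℝ) (hM : 0 ≤ M)
    (hlim : Filter.Tendsto (fun t => b t / a t) Filter.atTop (nhds M))
    (T : ℝ) (hT : 0 ≤ T) (hapos : ∀ t ≥ T, 0 < a t)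
    (t₀ y₀ : ℝ) (ht₀ : 0 ≤ t₀) (hy₀ : 0 ≤ y₀) :
    ∃ K > (0:ℝ), ∀ t₁ ≥ t₀, ∀ y y' : ℝ → ℝ,
      (∀ t ∈ Set.Icc t₀ t₁, 0 ≤ y t) → y t₀ = y₀ →
      IntervalIntegrable y' MeasureTheory.volume t₀ t₁ →
      (∀ s ∈ Set.Icc t₀ t₁, ∀ t ∈ Set.Icc t₀ t₁, s ≤ t →
        y t - y s = ∫ u in s..t, y' u) →
      (∀ᵐ u ∂MeasureTheory.volume, u ∈ Set.Icc t₀ t₁ → y' u ≤ -(a u) * y u + b u) →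
      ∀ t ∈ Set.Icc t₀ t₁, y t ≤ K := by
  obtain ⟨S₀, hS₀⟩ := eventually_atTop.1 (hlim.eventually (gt_mem_nhds (lt_add_one M)))
  obtain ⟨S, hSdef⟩ : ∃ S, S = max S₀ (max T t₀) := ⟨_, rfl⟩
  have hSS : S₀ ≤ S := hSdef ▸ le_max_left _ _
  have hST : T ≤ S := hSdef ▸ (le_max_left _ _).trans (le_max_right _ _)
  have hSt : t₀ ≤ S := hSdef ▸ (le_max_right _ _).trans (le_max_right _ _)
  have hsub : Icc t₀ S ⊆ Ici 0 := fun x hx => ht₀.trans hx.1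
  obtain ⟨A, hA⟩ := isCompact_Icc.exists_bound_of_continuousOn (ha.mono hsub)
  obtain ⟨B, hB⟩ := isCompact_Icc.exists_bound_of_continuousOn (hb.mono hsub)
  have hA0 : 0 ≤ A := (norm_nonneg _).trans (hA t₀ ⟨le_rfl, hSt⟩)
  have hB0 : 0 ≤ B := (norm_nonneg _).trans (hB t₀ ⟨le_rfl, hSt⟩)
  obtain ⟨C, hCdef⟩ : ∃ C, C = y₀ + B * (S - t₀) := ⟨_, rfl⟩
  have hC0 : 0 ≤ C := by
    have := mul_nonneg hB0 (sub_nonneg.2 hSt)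
    linarith
  obtain ⟨K₁, hK₁⟩ : ∃ K₁, K₁ = C + A * gronwallBound 0 A C (S - t₀) := ⟨_, rfl⟩
  refine ⟨max K₁ (M + 1), lt_max_of_lt_right (by linarith), ?_⟩
  intro t₁ ht₁ y y' hy hy0 hint hftc hineq
  have hyc : ContinuousOn y (Icc t₀ t₁) := by
    have h1 := intervalIntegral.continuousOn_primitive_interval' hint (left_mem_uIcc)
    rw [uIcc_of_le ht₁] at h1
    refine (h1.const_add (y t₀)).congr ?_
    intro x hx
    have := hftc t₀ ⟨le_rfl, ht₁⟩ x hx hx.1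
    simp only
    linarith
  have hintsub : ∀ s ∈ Icc t₀ t₁, ∀ t ∈ Icc t₀ t₁, s ≤ t → IntervalIntegrable y' volume s t := by
    intro s hs t ht hst
    refine hint.mono_set ?_
    rw [uIcc_of_le hst, uIcc_of_le ht₁]
    exact Icc_subset_Icc hs.1 ht.2
  have early : ∀ r ∈ Icc t₀ t₁, r ≤ S → y r ≤ K₁ := by
    intro r hr hrS
    have hsub2 : Icc t₀ r ⊆ Icc t₀ t₁ := Icc_subset_Icc le_rfl hr.2
    have h1 := aux_gronwall y t₀ r A C hr.1 hA0 (hyc.mono hsub2) (fun t ht => hy t (hsub2 ht)) ?_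
    · have h2 : gronwallBound 0 A C (r - t₀) ≤ gronwallBound 0 A C (S - t₀) :=
        gronwallBound_mono le_rfl hC0 hA0 (by linarith)
      have := mul_le_mul_of_nonneg_left h2 hA0
      linarith
    · intro t ht
      have ht' := hsub2 ht
      have hyi : IntervalIntegrable y volume t₀ t := by
        apply ContinuousOn.intervalIntegrable
        rw [uIcc_of_le ht.1]
        exact hyc.mono (Icc_subset_Icc le_rfl ht'.2)
      have h3 : (∫ u in t₀..t, y' u) ≤ ∫ u in t₀..t, (A * y u + B) := by
        refine intervalIntegral.integral_mono_ae_restrict ht.1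
          (hintsub t₀ ⟨le_rfl, ht₁⟩ t ht' ht.1) ((hyi.const_mul A).add (by simp)) ?_
        refine (ae_restrict_iff' measurableSet_Icc).2 ?_
        filter_upwards [hineq] with u hu hut
        have hu1 : u ∈ Icc t₀ t₁ := ⟨hut.1, hut.2.trans ht'.2⟩
        have hu2 : u ∈ Icc t₀ S := ⟨hut.1, hut.2.trans (ht.2.trans hrS)⟩
        have h4 := hu hu1
        have h5 := neg_le_of_abs_le (hA u hu2)
        have h6 := le_of_abs_le (hB u hu2)
        have h7 := hy u hu1
        nlinarith
      rw [intervalIntegral.integral_add (hyi.const_mul A) (by simp),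
        intervalIntegral.integral_const_mul, intervalIntegral.integral_const, smul_eq_mul] at h3
      have h8 := hftc t₀ ⟨le_rfl, ht₁⟩ t ht' ht.1
      have h9 : (t - t₀) * B ≤ B * (S - t₀) := by
        have := ht.2.trans hrS
        nlinarith
      linarith
  intro t ht
  rcases le_total t S with htS | hSt'
  · exact (early t ht htS).trans (le_max_left _ _)
  · have hSm : S ∈ Icc t₀ t₁ := ⟨hSt, hSt'.trans ht.2⟩
    refine aux_barrier y S t _ hSt' (hyc.mono (Icc_subset_Icc hSt ht.2))
      ((early S hSm le_rfl).trans (le_max_left _ _)) ?_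
    intro s hs habove
    have hs' : s ∈ Icc t₀ t₁ := ⟨hSt.trans hs.1, hs.2.trans ht.2⟩
    have h1 := hftc s hs' t ht hs.2
    have h2 : (∫ u in s..t, y' u) ≤ 0 := by
      rw [intervalIntegral.integral_of_le hs.2]
      refine integral_nonpos_of_ae ?_
      refine (ae_restrict_iff' measurableSet_Ioc).2 ?_
      filter_upwards [hineq] with u hu hut
      have huS : S ≤ u := hs.1.trans hut.1.le
      have h3 := hu ⟨hSt.trans huS, hut.2.trans ht.2⟩
      have hau := hapos u (hST.trans huS)
      have h4 := (div_lt_iff₀ hau).1 (hS₀ u (hSS.trans huS))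
      have h5 : M + 1 < y u := (le_max_right _ _).trans_lt (habove u hut)
      have h6 := mul_lt_mul_of_pos_left h5 hau
      simp only [Pi.zero_apply]
      nlinarith
    linarith
end
end

section
/- Consider the control system ẋᵢ = a(t,θ(t))·x_{i+1} + vᵢ for i = 1,…,n−1 and ẋₙ = vₙ + u, where x = (x₁,…,xₙ) ∈ ℝⁿ is the state, v = (v₁,…,vₙ) ∈ ℝⁿ is the control input, θ(t) ∈ Θ ⊆ ℝᵐ is a vector of time-varying parameters and a: [0,∞)×Θ → ℝ is continuous with inf{a(t,θ) : (t,θ) ∈ [0,∞)×Θ} > 0. Then for every φ of class K⁺ there exist q of class K*, ρ of class K⁺, a vector k ∈ ℝⁿ and constants γ, R, M > 0 such that for every t₀ ≥ 0, every continuous θ: [0,∞)→Θ, every x₀ ∈ ℝⁿ and every locally essentially bounded measurable u: [0,∞)→ℝ, the solution of the closed-loop system with v = a(t,θ(t))·diag(R·q(t), R²·q(t)², …, Rⁿ·q(t)ⁿ)·k·x₁ and initial condition x(t₀)=x₀ exists for all t ≥ t₀ and satisfies φ(t)|x(t)| ≤ ρ(t₀)·exp(−γ(t−t₀))·|x₀|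 + M·sup_{τ∈[t₀,t]}(|u(τ)|/φ(τ)) for all t ≥ t₀. -/
open Set Filter MeasureTheory

noncomputable section

/-- A function of class `K*`: `C^∞` on `[0,∞)`, non-decreasing, `q(0) ≥ 1` and
`q̇(t)/q(t)² → 0` as `t → ∞`. -/
def IsKStar (q : ℝ → ℝ) : Prop :=
  ContDiffOn ℝ (⊤ : ℕ∞) q (Set.Ici 0) ∧ MonotoneOn q (Set.Ici 0) ∧ 1 ≤ q 0 ∧
    Filter.Tendsto (fun t => derivWithin q (Set.Ici 0) t / (q t) ^ 2) Filter.atTop (nhds 0)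

/-- A solution of the closed-loop system (2.13) with the feedback (2.14):
`ẋᵢ = a(t,θ(t))·x_{i+1} + vᵢ` for `i = 1,…,n−1`, `ẋₙ = vₙ + u`, where
`vᵢ = a(t,θ(t))·Rⁱ·q(t)ⁱ·kᵢ·x₁` (here indexed from `0`, so index `i : Fin n`
corresponds to the paper's `i+1`), encoded via the equivalent integral equations. -/
def ClosedLoopSol {n m : ℕ} (hn : 0 < n) (a : ℝ → EuclideanSpace ℝ (Fin m) → ℝ)
    (q : ℝ → ℝ) (R : ℝ) (k : Fin n → ℝ) (θ : ℝ → EuclideanSpace ℝ (Fin m))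
    (u : ℝ → ℝ) (t₀ : ℝ) (x : ℝ → Fin n → ℝ) : Prop :=
  (∀ i : Fin n, ContinuousOn (fun t => x t i) (Set.Ici t₀)) ∧
  ∀ i : Fin n, ∀ t ∈ Set.Ici t₀,
    x t i = x t₀ i + ∫ s in t₀..t,
      (a s (θ s) * R ^ ((i : ℕ) + 1) * q s ^ ((i : ℕ) + 1) * k i * x s ⟨0, hn⟩ +
        (if h : (i : ℕ) + 1 < n then a s (θ s) * x s ⟨(i : ℕ) + 1, h⟩ else u s))

lemma exists_smooth_small (ψ : ℝ → ℝ) (hc : Continuous ψ) (hp : ∀ t, 0 < ψ t) :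
    ∃ f : ℝ → ℝ, ContDiff ℝ (⊤ : ℕ∞) f ∧ (∀ t, 0 < f t) ∧ (∀ t, f t ≤ Real.exp (-t)) ∧
      ∀ s t, 0 ≤ s → s ≤ t → f t ≤ Real.exp (-t) * ψ s := by
  let S : ℝ → Set ℝ := fun y => {z | 0 < z ∧ z ≤ Real.exp (-y) ∧
    ∀ s, 0 ≤ s → s ≤ y → z ≤ Real.exp (-y) * ψ s}
  obtain ⟨g, hg⟩ := exists_contMDiffMap_forall_mem_convex_of_local_const (n := (⊤ : ℕ∞))
    (modelWithCornersSelf ℝ ℝ) (t := S) (by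
      intro x a ha b hb α β hα hβ hαβ
      have key : ∀ B : ℝ, a ≤ B → b ≤ B → α • a + β • b ≤ B := by
        intro B h1 h2
        simp only [smul_eq_mul]
        have : B = α * B + β * B := by rw [← add_mul, hαβ, one_mul]
        nlinarith [mul_le_mul_of_nonneg_left h1 hα, mul_le_mul_of_nonneg_left h2 hβ]
      refine ⟨?_, key _ ha.2.1 hb.2.1, fun s h0 h1 => key _ (ha.2.2 s h0 h1) (hb.2.2 s h0 h1)⟩
      exact (convex_Ioi (0:ℝ)) ha.1 hb.1 hα hβ hαβ) (by
      intro x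
      obtain ⟨s0, hs0, hm⟩ := (isCompact_Icc (a := (0:ℝ)) (b := max 0 (x+1))).exists_isMinOn
        ⟨0, by simp⟩ hc.continuousOn
      refine ⟨Real.exp (-(x+1)) * min 1 (ψ s0), ?_⟩
      filter_upwards [Iio_mem_nhds (show x < x + 1 by linarith)] with y hy
      have hy : y < x + 1 := hy
      have he : Real.exp (-(x+1)) ≤ Real.exp (-y) := Real.exp_le_exp.2 (by linarith)
      have hmin : 0 < min 1 (ψ s0) := lt_min one_pos (hp _)
      refine ⟨by positivity, ?_, ?_⟩
      · calc _ ≤ Real.exp (-(x+1)) * 1 := by gcongr; exact min_le_left _ _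
          _ ≤ _ := by simpa using he
      · intro s h0 h1
        have : ψ s0 ≤ ψ s := hm ⟨h0, by simp; right; linarith⟩
        have := (min_le_right 1 (ψ s0)).trans this
        gcongr)
  refine ⟨g, g.contMDiff.contDiff, fun t => (hg t).1, fun t => (hg t).2.1,
    fun s t h0 h1 => (hg t).2.2 s h0 h1⟩

lemma exists_p (φ : ℝ → ℝ) (hφ : IsKPlus φ) :
    ∃ p f : ℝ → ℝ, ContDiff ℝ (⊤ : ℕ∞) p ∧ (∀ t, 0 ≤ t → 1 ≤ p t) ∧ (∀ t, 0 < p t) ∧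
      (∀ t, 0 ≤ t → φ t ≤ p t) ∧
      (∀ t, HasDerivAt p (f t * p t ^ 2) t) ∧ (∀ t, 0 < f t) ∧ ∀ t, f t ≤ Real.exp (-t) := by
  have hφc : Continuous (fun t : ℝ => φ (max 0 t)) :=
    hφ.1.comp_continuous (by fun_prop) (fun t => by simp)
  have hφ0 : ∀ t, 0 < φ (max 0 t) := fun t => hφ.2 _ (by simp)
  obtain ⟨f, hfs, hf0, hfe, hfψ⟩ := exists_smooth_small (fun t => 1 / (1 + φ (max 0 t)))
    (continuous_const.div (continuous_const.add hφc) (fun t => by have := hφ0 t; positivity))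
    (fun t => by have := hφ0 t; positivity)
  have hfc : Continuous f := hfs.continuous
  have hexp : ∀ t, IntegrableOn (fun s => Real.exp (-s)) (Ioi t) := fun t => integrableOn_exp_neg_Ioi t
  have hint : ∀ t, IntegrableOn f (Ioi t) := fun t =>
    (hexp t).mono' hfc.aestronglyMeasurable (by
      filter_upwards with s
      rw [Real.norm_of_nonneg (hf0 s).le]; exact hfe s)
  let w : ℝ → ℝ := fun t => ∫ s in Ioi t, f s
  have hw : ∀ t, w t = w 0 - ∫ s in (0:ℝ)..t, f s := by
    intro t
    have := intervalIntegral.integral_Ioi_sub_Ioi' (hint 0) (hint t)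
    simp only [w]; linarith
  have hwd : ∀ t, HasDerivAt w (-f t) t := by
    intro t
    have h1 : HasDerivAt (fun t => ∫ s in (0:ℝ)..t, f s) (f t) t :=
      (hfc.integral_hasStrictDerivAt 0 t).hasDerivAt
    have h2 := h1.const_sub (w 0)
    rwa [show (fun t => w 0 - ∫ s in (0:ℝ)..t, f s) = w from funext fun t => (hw t).symm] at h2
  have hws : ContDiff ℝ (⊤ : ℕ∞) w := by
    rw [contDiff_infty_iff_deriv]
    refine ⟨fun t => (hwd t).differentiableAt, ?_⟩
    rw [show deriv w = fun t => - f t from funext fun t => (hwd t).deriv]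
    exact hfs.neg
  have hw0 : ∀ t, 0 < w t := by
    intro t
    have : w t - w (t+1) = ∫ s in t..(t+1), f s :=
      intervalIntegral.integral_Ioi_sub_Ioi' (hint t) (hint (t+1))
    have h1 : 0 < ∫ s in t..(t+1), f s :=
      intervalIntegral.intervalIntegral_pos_of_pos (hfc.intervalIntegrable _ _) hf0 (by linarith)
    have h2 : 0 ≤ w (t+1) := setIntegral_nonneg measurableSet_Ioi fun s _ => (hf0 s).le
    linarith
  have hwle : ∀ t, 0 ≤ t → w t ≤ 1 / (1 + φ t) := by
    intro t ht
    have h0 := hφ0 t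
    rw [max_eq_right ht] at h0
    calc w t ≤ ∫ s in Ioi t, Real.exp (-s) * (1 / (1 + φ t)) := by
          refine setIntegral_mono_on (hint t) ((hexp t).mul_const _) measurableSet_Ioi ?_
          intro s hs
          have := hfψ t s ht (le_of_lt hs)
          simpa [max_eq_right ht] using this
      _ = Real.exp (-t) * (1 / (1 + φ t)) := by
          rw [integral_mul_const, integral_exp_neg_Ioi]
      _ ≤ 1 * (1 / (1 + φ t)) := by
          gcongr
          exact Real.exp_le_one_iff.2 (by linarith)
      _ = _ := one_mul _
  have hple : ∀ t, 0 ≤ t → 1 + φ t ≤ (w t)⁻¹ := by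
    intro t ht
    have h0 := hφ0 t
    rw [max_eq_right ht] at h0
    rw [le_inv_comm₀ (by positivity) (hw0 t), ← one_div]
    exact hwle t ht
  refine ⟨fun t => (w t)⁻¹, f, hws.inv (fun t => (hw0 t).ne'), ?_, fun t => inv_pos.2 (hw0 t),
    ?_, ?_, hf0, hfe⟩
  · intro t ht
    have := hple t ht
    have h0 := hφ.2 t ht
    simp only; linarith
  · intro t ht
    have := hple t ht
    simp only; linarith
  · intro t
    have := (hwd t).inv (hw0 t).ne'
    have e : - -f t / w t ^ 2 = f t * ((w t)⁻¹) ^ 2 := by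
      rw [neg_neg, inv_pow, div_eq_mul_inv]
    rw [e] at this
    exact this

/-- The closed-loop matrix (observer canonical form). -/
def chainF {n : ℕ} (hn : 0 < n) (k : Fin n → ℝ) (z : Fin n → ℝ) (i : Fin n) : ℝ :=
  k i * z ⟨0, hn⟩ + (if h : (i : ℕ) + 1 < n then z ⟨(i : ℕ) + 1, h⟩ else 0)

lemma exists_upper {n : ℕ} (T : (Fin n → ℝ) →ₗ[ℝ] (Fin n → ℝ)) :
    ∃ C : ℝ, 0 < C ∧ ∀ z, T z ⬝ᵥ T z ≤ C * (z ⬝ᵥ z) := by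
  refine ⟨(∑ j, ∑ i, (LinearMap.toMatrix' T j i) ^ 2) + 1, by positivity, fun z => ?_⟩
  have h1 : ∀ j, T z j * T z j ≤ (∑ i, (LinearMap.toMatrix' T j i) ^ 2) * (z ⬝ᵥ z) := by
    intro j
    have : T z j = ∑ i, LinearMap.toMatrix' T j i * z i := by
      rw [← LinearMap.toMatrix'_mulVec]; rfl
    rw [this, ← sq]
    refine (Finset.sum_mul_sq_le_sq_mul_sq _ _ _).trans (le_of_eq ?_)
    simp [dotProduct, sq]
  have h2 : 0 ≤ z ⬝ᵥ z := by simp only [dotProduct]; exact Finset.sum_nonneg fun _ _ => mul_self_nonneg _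
  calc T z ⬝ᵥ T z ≤ ∑ j, (∑ i, (LinearMap.toMatrix' T j i) ^ 2) * (z ⬝ᵥ z) :=
        Finset.sum_le_sum fun j _ => h1 j
    _ ≤ _ := by rw [← Finset.sum_mul]; nlinarith

lemma dot_self_nonneg' {n : ℕ} (z : Fin n → ℝ) : 0 ≤ z ⬝ᵥ z :=
  Finset.sum_nonneg fun _ _ => mul_self_nonneg _

lemma sq_le_dot {n : ℕ} (z : Fin n → ℝ) (i : Fin n) : z i ^ 2 ≤ z ⬝ᵥ z := by
  rw [sq]
  exact Finset.single_le_sum (f := fun i => z i * z i) (fun i _ => mul_self_nonneg _) (Finset.mem_univ i)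

lemma dot_succ {n : ℕ} (z w : Fin (n+1) → ℝ) :
    z ⬝ᵥ w = z 0 * w 0 + (fun i : Fin n => z i.succ) ⬝ᵥ (fun i : Fin n => w i.succ) := by
  simp [dotProduct, Fin.sum_univ_succ]

lemma exists_hurwitz (n : ℕ) : ∃ k : Fin (n+1) → ℝ,
    ∃ T : (Fin (n+1) → ℝ) →ₗ[ℝ] (Fin (n+1) → ℝ), ∃ C δ : ℝ, 0 < C ∧ 0 < δ ∧
      (∀ z, z ⬝ᵥ z ≤ C * (T z ⬝ᵥ T z)) ∧
      ∀ z, T z ⬝ᵥ T (chainF n.succ_pos k z) ≤ -δ * (T z ⬝ᵥ T z) := by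
  induction n with
  | zero =>
    refine ⟨fun _ => -1, LinearMap.id, 1, 1, one_pos, one_pos, fun z => by simp, fun z => ?_⟩
    simp [dotProduct, chainF]
  | succ n ih =>
    obtain ⟨k, T, C, δ, hC, hδ, h1, h2⟩ := ih
    -- the change of variables `η i = z (i+1) + k i * z 0`
    let S : (Fin (n+2) → ℝ) →ₗ[ℝ] (Fin (n+1) → ℝ) :=
      { toFun := fun z i => z i.succ + k i * z 0
        map_add' := fun x y => by ext i; simp; ring
        map_smul' := fun c x => by ext i; simp; ring }
    let K : Fin (n+2) → ℝ := Fin.cons (k 0 - 1)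
      (fun i : Fin (n+1) => (if h : (i : ℕ) + 1 < n + 1 then k ⟨i + 1, h⟩ else 0) + k i)
    have hSF : ∀ z, S (chainF (n+1).succ_pos K z) = chainF n.succ_pos k (S z) := by
      intro z
      ext i
      have hz : (⟨0, (n+1).succ_pos⟩ : Fin (n+2)) = 0 := rfl
      have hz' : (⟨0, n.succ_pos⟩ : Fin (n+1)) = 0 := rfl
      by_cases h : (i : ℕ) + 1 < n + 1
      · have h' : (i : ℕ) + 1 + 1 < n + 2 := by omega
        have e : (⟨(i : ℕ) + 1 + 1, h'⟩ : Fin (n+2)) = Fin.succ ⟨(i:ℕ)+1, h⟩ := rfl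
        have e2 : (⟨1, by omega⟩ : Fin (n+2)) = Fin.succ 0 := rfl
        simp only [S, chainF, K, LinearMap.coe_mk, AddHom.coe_mk, hz, hz', Fin.cons_succ, Fin.cons_zero,
          Fin.val_succ, h, h', dif_pos, e, Fin.val_zero, zero_add, e2,
          show 1 < n + 2 by omega]
        ring
      · have h' : ¬ (i : ℕ) + 1 + 1 < n + 2 := by omega
        have e2 : (⟨1, by omega⟩ : Fin (n+2)) = Fin.succ 0 := rfl
        simp only [S, chainF, K, LinearMap.coe_mk, AddHom.coe_mk, hz, hz', Fin.cons_succ, Fin.cons_zero,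
          Fin.val_succ, h, h', dif_pos, Fin.val_zero, zero_add, e2,
          show 1 < n + 2 by omega, dif_neg, not_false_eq_true]
        ring
    have hF0 : ∀ z, chainF (n+1).succ_pos K z 0 = S z 0 - z 0 := by
      intro z
      have hz : (⟨0, (n+1).succ_pos⟩ : Fin (n+2)) = 0 := rfl
      have e2 : (⟨1, by omega⟩ : Fin (n+2)) = Fin.succ 0 := rfl
      simp only [S, chainF, K, LinearMap.coe_mk, AddHom.coe_mk, hz, Fin.cons_zero,
          dif_pos, Fin.val_zero, zero_add, e2, show 1 < n + 2 by omega]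
      ring
    -- small weight
    obtain ⟨ε, hε, hεC⟩ : ∃ ε : ℝ, 0 < ε ∧ ε ^ 2 * C ≤ δ := by
      refine ⟨Real.sqrt (δ / C), Real.sqrt_pos.2 (by positivity), ?_⟩
      rw [Real.sq_sqrt (by positivity)]
      exact le_of_eq (by field_simp)
    let T' : (Fin (n+2) → ℝ) →ₗ[ℝ] (Fin (n+2) → ℝ) :=
      { toFun := fun z => Fin.cons (ε * z 0) (T (S z))
        map_add' := fun x y => by
          ext i; refine Fin.cases ?_ (fun i => ?_) i
          · simp; ring
          · simp
        map_smul' := fun c x => by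
          ext i; refine Fin.cases ?_ (fun i => ?_) i
          · simp; ring
          · simp }
    have hT' : ∀ z w, T' z ⬝ᵥ T' w = ε^2 * (z 0 * w 0) + T (S z) ⬝ᵥ T (S w) := by
      intro z w
      rw [dot_succ]
      simp only [T', LinearMap.coe_mk, AddHom.coe_mk, Fin.cons_zero, Fin.cons_succ]
      ring
    refine ⟨K, T', 2 * C + (1 + 2 * (k ⬝ᵥ k)) / ε^2, min (δ/2) (1/2), ?_, by positivity, ?_, ?_⟩
    · have := dot_self_nonneg' k
      positivity
    · intro z
      have hk := dot_self_nonneg' k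
      have hV := dot_self_nonneg' (T (S z))
      rw [dot_succ, hT']
      have a1 : (fun i : Fin (n+1) => z i.succ) ⬝ᵥ (fun i : Fin (n+1) => z i.succ)
          ≤ 2 * (S z ⬝ᵥ S z) + 2 * (k ⬝ᵥ k) * z 0 ^ 2 := by
        simp only [dotProduct, Finset.mul_sum, Finset.sum_mul, ← Finset.sum_add_distrib]
        refine Finset.sum_le_sum fun i _ => ?_
        have : z i.succ = S z i - k i * z 0 := by simp [S]
        rw [this]
        nlinarith [sq_nonneg (S z i + k i * z 0)]
      have a2 := h1 (S z)
      have a3 : (2 * C + (1 + 2 * (k ⬝ᵥ k)) / ε^2) * (ε^2 * (z 0 * z 0) + T (S z) ⬝ᵥ T (S z))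
        = (2 * C * ε^2) * (z 0 * z 0) + (1 + 2 * (k ⬝ᵥ k)) * (z 0 * z 0)
          + 2 * C * (T (S z) ⬝ᵥ T (S z)) + (1 + 2 * (k ⬝ᵥ k)) / ε^2 * (T (S z) ⬝ᵥ T (S z)) := by
        field_simp
        ring
      rw [a3]
      have a4 : 0 ≤ (2 * C * ε^2) * (z 0 * z 0) := by
        have := mul_self_nonneg (z 0); positivity
      have a5 : 0 ≤ (1 + 2 * (k ⬝ᵥ k)) / ε^2 * (T (S z) ⬝ᵥ T (S z)) := by positivity
      nlinarith
    · intro z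
      rw [hT', hT', hSF, hF0]
      have b1 := h2 (S z)
      have b2 := (sq_le_dot (S z) 0).trans (h1 (S z))
      have hV := dot_self_nonneg' (T (S z))
      set V := T (S z) ⬝ᵥ T (S z)
      have b3 : ε^2 * S z 0 ^ 2 ≤ δ * V := by
        calc ε^2 * S z 0 ^ 2 ≤ ε^2 * (C * V) := by gcongr
          _ = (ε^2 * C) * V := by ring
          _ ≤ δ * V := by gcongr
      have b4 : ε^2 * (z 0 * (S z 0 - z 0)) ≤ ε^2 * (S z 0 ^2 / 2 - z 0 ^ 2 / 2) := by
        gcongr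
        nlinarith [sq_nonneg (z 0 - S z 0)]
      have m1 := min_le_left (δ/2) (1/2)
      have m2 := min_le_right (δ/2) (1/2)
      have b5 : min (δ/2) (1/2) * V ≤ δ/2 * V := by gcongr
      have b6 : min (δ/2) (1/2) * (ε^2 * (z 0 * z 0)) ≤ 1/2 * (ε^2 * (z 0 * z 0)) := by
        have := mul_self_nonneg (z 0)
        gcongr
      nlinarith

/-- Global solvability of linear Volterra equations with continuous data. -/
lemma exists_linear_sol {E : Type*} [NormedAddCommGroup E] [NormedSpace ℝ E] [CompleteSpace E]
    (M : ℝ → E →L[ℝ] E) (hM : Continuous M) (g : ℝ → E) (hg : Continuous g) (t₀ : ℝ) :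
    ∃ x : ℝ → E, ContinuousOn x (Ici t₀) ∧
      ∀ t, t₀ ≤ t → x t = g t + ∫ s in t₀..t, M s (x s) := by
  let y : ℕ → C(ℝ, E) := fun k => Nat.rec ⟨g, hg⟩
    (fun _ yk => ⟨fun t => ∫ s in t₀..t, M s (yk s),
      intervalIntegral.continuous_primitive
        (fun a b => (hM.clm_apply yk.continuous).intervalIntegrable a b) t₀⟩) k
  have y0 : ∀ t, y 0 t = g t := fun t => rfl
  have yS : ∀ k t, y (k+1) t = ∫ s in t₀..t, M s (y k s) := fun k t => rfl
  have bound : ∀ T, t₀ ≤ T → ∃ L G : ℝ, 0 ≤ L ∧ 0 ≤ G ∧ (∀ s ∈ Icc t₀ T, ‖M s‖ ≤ L) ∧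
      ∀ k, ∀ t ∈ Icc t₀ T, ‖y k t‖ ≤ G * ((L * (t - t₀)) ^ k / k.factorial) := by
    intro T hT
    obtain ⟨L, hL⟩ := (isCompact_Icc (a := t₀) (b := T)).exists_bound_of_continuousOn hM.continuousOn
    obtain ⟨G, hG⟩ := (isCompact_Icc (a := t₀) (b := T)).exists_bound_of_continuousOn hg.continuousOn
    have hL0 : 0 ≤ L := (norm_nonneg _).trans (hL t₀ ⟨le_rfl, hT⟩)
    have hG0 : 0 ≤ G := (norm_nonneg _).trans (hG t₀ ⟨le_rfl, hT⟩)
    refine ⟨L, G, hL0, hG0, hL, fun k => ?_⟩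
    induction k with
    | zero => intro t ht; simpa [y0] using hG t ht
    | succ k ih =>
      intro t ht
      rw [yS]
      have h1 : ‖∫ s in t₀..t, M s (y k s)‖ ≤
          ∫ s in t₀..t, L * (G * ((L * (s - t₀)) ^ k / k.factorial)) := by
        refine intervalIntegral.norm_integral_le_of_norm_le ht.1 ?_ ?_
        · filter_upwards with s hs
          have hs' : s ∈ Icc t₀ T := ⟨hs.1.le, hs.2.trans ht.2⟩
          exact (M s).le_of_opNorm_le_of_le (hL s hs') (ih s hs')
        · exact Continuous.intervalIntegrable (by fun_prop) _ _
      refine h1.trans (le_of_eq ?_)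
      have h2 : ∀ s, L * (G * ((L * (s - t₀)) ^ k / k.factorial))
          = (G * L^(k+1) / k.factorial) * (s - t₀)^k := by
        intro s; rw [mul_pow]; ring
      simp_rw [h2]
      rw [intervalIntegral.integral_const_mul,
        intervalIntegral.integral_comp_sub_right (fun s => s ^ k) t₀, integral_pow]
      simp only [sub_self, Nat.factorial_succ]
      push_cast
      field_simp
      rw [mul_pow]
      simp
      ring
  have summ : ∀ r G : ℝ, Summable (fun k : ℕ => G * (r ^ k / k.factorial)) := fun r G =>
    (Real.summable_pow_div_factorial r).mul_left G
  have bound' : ∀ T, t₀ ≤ T → ∃ L b : ℝ, ∃ B : ℕ → ℝ, 0 ≤ L ∧ Summable B ∧ (∀ k, 0 ≤ B k) ∧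
      (∀ s ∈ Icc t₀ T, ‖M s‖ ≤ L) ∧ ∀ k, ∀ t ∈ Icc t₀ T, ‖y k t‖ ≤ B k := by
    intro T hT
    obtain ⟨L, G, hL, hG, h1, h2⟩ := bound T hT
    have := sub_nonneg.2 hT
    refine ⟨L, 0, fun k => G * ((L * (T - t₀)) ^ k / k.factorial), hL, summ _ _,
      fun k => by positivity, h1, fun k t ht => (h2 k t ht).trans ?_⟩
    have := sub_nonneg.2 ht.1
    have := ht.2
    dsimp only
    gcongr
  refine ⟨fun t => ∑' k, y k t, ?_, ?_⟩
  · intro t ht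
    obtain ⟨L, b, B, hL, hB, hB0, h1, h2⟩ := bound' (t+1) (by have : t₀ ≤ t := ht; linarith)
    have hc : ContinuousOn (fun t => ∑' k, y k t) (Icc t₀ (t+1)) :=
      continuousOn_tsum (fun k => (y k).continuous.continuousOn) hB h2
    refine (hc t ⟨ht, by linarith⟩).mono_of_mem_nhdsWithin ?_
    rw [← Ici_inter_Iic]
    exact inter_mem_nhdsWithin _ (Iic_mem_nhds (by linarith))
  · intro t ht
    obtain ⟨L, b, B, hL, hB, hB0, h1, h2⟩ := bound' t ht
    have hs : ∀ s ∈ Icc t₀ t, Summable (fun k => y k s) := fun s hs =>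
      Summable.of_norm_bounded hB (fun k => h2 k s hs)
    have key := intervalIntegral.hasSum_intervalIntegral_of_summable_norm (a := t₀) (b := t)
      (f := fun k => (⟨fun s => M s (y k s), hM.clm_apply (y k).continuous⟩ : C(ℝ, E))) (by
        refine Summable.of_nonneg_of_le (fun k => norm_nonneg _) (fun k => ?_) (hB.mul_left L)
        rw [ContinuousMap.norm_le _ (mul_nonneg hL (hB0 k))]
        rintro ⟨s, hs⟩
        have hs : s ∈ uIcc t₀ t := hs
        rw [uIcc_of_le ht] at hs
        exact (M s).le_of_opNorm_le_of_le (h1 s hs) (h2 k s hs))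
    have e1 : ∑' k, y k t = y 0 t + ∑' k, y (k+1) t := (hs t ⟨ht, le_rfl⟩).tsum_eq_zero_add
    simp only
    rw [e1, y0]
    congr 1
    rw [show (fun k => y (k+1) t) = fun k => ∫ s in t₀..t, M s (y k s) from funext fun k => yS k t]
    simp only [ContinuousMap.coe_mk] at key
    rw [key.tsum_eq]
    refine intervalIntegral.integral_congr fun s hs' => ?_
    rw [uIcc_of_le ht] at hs'
    exact ((M s).map_tsum (hs s hs')).symm

lemma dot_two_le {n : ℕ} (x y : Fin n → ℝ) (r : ℝ) (hr : 0 < r) :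
    2 * (x ⬝ᵥ y) ≤ r * (x ⬝ᵥ x) + (1 / r) * (y ⬝ᵥ y) := by
  simp only [dotProduct, Finset.mul_sum, ← Finset.sum_add_distrib]
  refine Finset.sum_le_sum fun i _ => ?_
  have h : 0 ≤ (1 / r) * (r * x i - y i) ^ 2 := by positivity
  have e : (1 / r) * (r * x i - y i) ^ 2 =
      r * (x i * x i) + (1 / r) * (y i * y i) - 2 * (x i * y i) := by
    field_simp; ring
  linarith

/-- Pointwise Lyapunov inequality. -/
lemma lyap_pointwise {N : ℕ} (k : Fin (N+1) → ℝ) (T : (Fin (N+1) → ℝ) →ₗ[ℝ] (Fin (N+1) → ℝ))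
    (C δ C2 c R D : ℝ) (hδ : 0 < δ) (hC : 0 < C) (hC2 : 0 < C2)
    (h1 : ∀ z, z ⬝ᵥ z ≤ C * (T z ⬝ᵥ T z))
    (h2 : ∀ z, T z ⬝ᵥ T (chainF N.succ_pos k z) ≤ -δ * (T z ⬝ᵥ T z))
    (h3 : ∀ z, T z ⬝ᵥ T z ≤ C2 * (z ⬝ᵥ z)) (hR : 0 < R)
    (hRbig : 3 + C2 * D ^ 2 * C ≤ 2 * (c * R * δ))
    (A P f v U φ : ℝ) (hA : c ≤ A) (hP : 1 ≤ P) (hf0 : 0 ≤ f) (hf1 : f ≤ 1)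
    (hφ0 : 0 ≤ φ) (hφ : φ ≤ P) (hv : |v| ≤ U * φ)
    (d z dz : Fin (N+1) → ℝ) (hd : ∀ i, |d i| ≤ D) (j : Fin (N+1))
    (hdz : dz = (A * R * P ^ 2) • chainF N.succ_pos k z + (fun i => f * P * d i * z i)
      + Pi.single j (P * v)) :
    2 * (T z ⬝ᵥ T dz) ≤ - P ^ 2 * (T z ⬝ᵥ T z) + P ^ 2 * (C2 * U ^ 2) := by
  have hV := dot_self_nonneg' (T z)
  have hP0 : 0 < P := by linarith
  rw [hdz, map_add, map_add, map_smul, dotProduct_add, dotProduct_add, dotProduct_smul, smul_eq_mul]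
  set V := T z ⬝ᵥ T z with hVdef
  have e1 : A * R * P ^ 2 * (T z ⬝ᵥ T (chainF N.succ_pos k z)) ≤ - (c * R * δ) * P ^ 2 * V := by
    have a1 := h2 z
    by_cases hc : 0 ≤ A
    · calc A * R * P ^ 2 * (T z ⬝ᵥ T (chainF N.succ_pos k z)) ≤ A * R * P ^ 2 * (-δ * V) := by gcongr
        _ = - (A * (R * δ * P ^ 2 * V)) := by ring
        _ ≤ - (c * (R * δ * P ^ 2 * V)) := by gcongr
        _ = _ := by ring
    · exfalso
      have : c < 0 := by linarith
      have h5 : c * R * δ < 0 := mul_neg_of_neg_of_pos (mul_neg_of_neg_of_pos this hR) hδ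
      have : 0 ≤ C2 * D ^ 2 * C := by positivity
      linarith
  have e2 : 2 * (T z ⬝ᵥ T (fun i => f * P * d i * z i)) ≤ P ^ 2 * V + C2 * D ^ 2 * C * P ^ 2 * V := by
    have a1 := dot_two_le (T z) (T (fun i => f * P * d i * z i)) (P ^ 2) (by positivity)
    have a2 := h3 (fun i => f * P * d i * z i)
    have a3 : (fun i => f * P * d i * z i) ⬝ᵥ (fun i => f * P * d i * z i) ≤ P ^ 2 * D ^ 2 * (z ⬝ᵥ z) := by
      simp only [dotProduct, Finset.mul_sum]
      refine Finset.sum_le_sum fun i _ => ?_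
      have b1 : (d i) ^ 2 ≤ D ^ 2 := sq_le_sq.2 ((hd i).trans (le_abs_self D))
      have b2 : f ^ 2 ≤ 1 := by nlinarith
      calc f * P * d i * z i * (f * P * d i * z i) = f ^ 2 * (P ^ 2 * (d i) ^ 2 * z i ^ 2) := by ring
        _ ≤ 1 * (P ^ 2 * D ^ 2 * z i ^ 2) := by gcongr
        _ = _ := by ring
    have a4 := h1 z
    have a5 : T (fun i => f * P * d i * z i) ⬝ᵥ T (fun i => f * P * d i * z i)
        ≤ C2 * (P ^ 2 * D ^ 2 * (C * V)) := by
      refine a2.trans ?_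
      gcongr
      refine a3.trans ?_
      gcongr
    have a6 : (1 / P ^ 2) * (T (fun i => f * P * d i * z i) ⬝ᵥ T (fun i => f * P * d i * z i))
        ≤ C2 * D ^ 2 * C * V := by
      calc _ ≤ (1 / P ^ 2) * (C2 * (P ^ 2 * D ^ 2 * (C * V))) := by gcongr
        _ = _ := by field_simp
    have a7 : C2 * D ^ 2 * C * V ≤ C2 * D ^ 2 * C * P ^ 2 * V := by
      have : (1:ℝ) ≤ P ^ 2 := by nlinarith
      have h0 : 0 ≤ C2 * D ^ 2 * C * V := by positivity
      nlinarith
    linarith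
  have e3 : 2 * (T z ⬝ᵥ T (Pi.single j (P * v))) ≤ P ^ 2 * V + P ^ 2 * (C2 * U ^ 2) := by
    have a1 := dot_two_le (T z) (T (Pi.single j (P * v))) (P ^ 2) (by positivity)
    have a2 := h3 (Pi.single j (P * v))
    have a3 : (Pi.single j (P * v) : Fin (N+1) → ℝ) ⬝ᵥ (Pi.single j (P * v)) = P ^ 2 * v ^ 2 := by
      simp; ring
    rw [a3] at a2
    have a4 : v ^ 2 ≤ P ^ 2 * U ^ 2 := by
      calc v ^ 2 = |v| ^ 2 := (sq_abs v).symm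
        _ ≤ (U * φ) ^ 2 := by gcongr
        _ = φ ^ 2 * U ^ 2 := by ring
        _ ≤ _ := by gcongr
    have a6 : (1 / P ^ 2) * (T (Pi.single j (P * v)) ⬝ᵥ T (Pi.single j (P * v)))
        ≤ P ^ 2 * (C2 * U ^ 2) := by
      calc _ ≤ (1 / P ^ 2) * (C2 * (P ^ 2 * v ^ 2)) := by gcongr
        _ = C2 * v ^ 2 := by field_simp
        _ ≤ C2 * (P ^ 2 * U ^ 2) := by gcongr
        _ = _ := by ring
    linarith
  have e4 : (3 + C2 * D ^ 2 * C) * (P ^ 2 * V) ≤ 2 * (c * R * δ) * (P ^ 2 * V) := by gcongr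
  linarith

lemma ac_le_of_deriv_nonpos {h : ℝ → ℝ} {a b : ℝ} (hab : a ≤ b)
    (hac : AbsolutelyContinuousOnInterval h a b)
    (hd : ∀ᵐ s, s ∈ Icc a b → ∃ d ≤ 0, HasDerivAt h d s) : h b ≤ h a := by
  have h1 := hac.integral_deriv_eq_sub
  have h2 : 0 ≤ ∫ s in a..b, - deriv h s := by
    refine intervalIntegral.integral_nonneg_of_ae_restrict hab ?_
    refine (ae_restrict_iff' measurableSet_Icc).2 ?_
    filter_upwards [hd] with s hs hs'
    obtain ⟨d, hd0, hd⟩ := hs hs'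
    rw [hd.deriv]; simpa using hd0
  rw [intervalIntegral.integral_neg] at h2
  linarith

lemma ac_sum {ι : Type*} (S : Finset ι) (F : ι → ℝ → ℝ) {a b : ℝ}
    (hF : ∀ i ∈ S, AbsolutelyContinuousOnInterval (F i) a b) :
    AbsolutelyContinuousOnInterval (fun s => ∑ i ∈ S, F i s) a b := by
  classical
  induction S using Finset.induction_on with
  | empty =>
    simp only [Finset.sum_empty]
    exact (contDiff_const.contDiffOn).absolutelyContinuousOnInterval
  | insert i S hi ih =>
    simp only [Finset.sum_insert hi]
    exact (hF i (by simp)).fun_add (ih fun j hj => hF j (by simp [hj]))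

lemma u_int {u : ℝ → ℝ} (hu : Measurable u)
    (hb : ∀ T ≥ (0:ℝ), ∃ C : ℝ, ∀ᵐ τ ∂MeasureTheory.volume, τ ∈ Set.Icc 0 T → |u τ| ≤ C) (a b : ℝ) :
    IntervalIntegrable (indicator (Ici 0) u) volume a b := by
  obtain ⟨C, hC⟩ := hb (max 0 (max a b)) (le_max_left _ _)
  refine (intervalIntegrable_const (c := max C 0)).mono_fun'
    ((hu.indicator measurableSet_Ici).aestronglyMeasurable) ?_
  refine (ae_restrict_iff' measurableSet_uIoc).2 ?_
  filter_upwards [hC] with s hs hs'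
  by_cases h : 0 ≤ s
  · rw [indicator_of_mem (by exact h), Real.norm_eq_abs]
    exact (hs ⟨h, hs'.2.trans (le_max_right _ _)⟩).trans (le_max_left _ _)
  · rw [indicator_of_notMem (by exact h)]; simp

lemma u_int' {u : ℝ → ℝ} (hu : Measurable u)
    (hb : ∀ T ≥ (0:ℝ), ∃ C : ℝ, ∀ᵐ τ ∂MeasureTheory.volume, τ ∈ Set.Icc 0 T → |u τ| ≤ C) {a b : ℝ}
    (ha : 0 ≤ a) (hab : a ≤ b) :
    IntervalIntegrable u volume a b := by
  refine (u_int hu hb a b).congr fun s hs => ?_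
  rw [uIoc_of_le hab] at hs
  exact indicator_of_mem (by exact ha.trans hs.1.le) u

lemma exists_closed_loop {n m : ℕ} (hn : 0 < n) (a : ℝ → EuclideanSpace ℝ (Fin m) → ℝ)
    (q : ℝ → ℝ) (hq : Continuous q) (R : ℝ) (k : Fin n → ℝ) (θ : ℝ → EuclideanSpace ℝ (Fin m))
    (hA : ContinuousOn (fun s => a s (θ s)) (Ici 0))
    (u : ℝ → ℝ) (hu : Measurable u)
    (hb : ∀ T ≥ (0:ℝ), ∃ C : ℝ, ∀ᵐ τ ∂MeasureTheory.volume, τ ∈ Set.Icc 0 T → |u τ| ≤ C)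
    (t₀ : ℝ) (ht₀ : 0 ≤ t₀) (x₀ : Fin n → ℝ) :
    ∃ x : ℝ → Fin n → ℝ, x t₀ = x₀ ∧ ClosedLoopSol hn a q R k θ u t₀ x := by
  let A : ℝ → ℝ := fun s => a (max 0 s) (θ (max 0 s))
  have hAc : Continuous A := hA.comp_continuous (f := fun s : ℝ => max 0 s)
    (by fun_prop) (fun s => by simp)
  let B : Fin n → ((Fin n → ℝ) →L[ℝ] (Fin n → ℝ)) := fun i =>
    (ContinuousLinearMap.single ℝ (fun _ : Fin n => ℝ) i).comp
      (ContinuousLinearMap.proj (R := ℝ) (φ := fun _ : Fin n => ℝ) ⟨0, hn⟩)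
  let S : (Fin n → ℝ) →L[ℝ] (Fin n → ℝ) := ContinuousLinearMap.pi (fun i : Fin n =>
    if h : (i : ℕ) + 1 < n then
      ContinuousLinearMap.proj (R := ℝ) (φ := fun _ : Fin n => ℝ) ⟨(i : ℕ) + 1, h⟩ else 0)
  let M : ℝ → ((Fin n → ℝ) →L[ℝ] (Fin n → ℝ)) := fun s =>
    (∑ i : Fin n, (A s * R ^ ((i : ℕ) + 1) * q s ^ ((i : ℕ) + 1) * k i) • B i) + A s • S
  have hM : Continuous M := by
    refine Continuous.add ?_ (hAc.smul continuous_const)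
    refine continuous_finsetSum _ fun i _ => ?_
    have hci : Continuous (fun s => A s * R ^ ((i : ℕ) + 1) * q s ^ ((i : ℕ) + 1) * k i) :=
      ((hAc.mul continuous_const).mul (hq.pow _)).mul continuous_const
    exact hci.smul continuous_const
  have hMi : ∀ s x i, M s x i = A s * R ^ ((i : ℕ) + 1) * q s ^ ((i : ℕ) + 1) * k i * x ⟨0, hn⟩ +
      (if h : (i : ℕ) + 1 < n then A s * x ⟨(i : ℕ) + 1, h⟩ else 0) := by
    intro s x i
    simp only [M, B, S, ContinuousLinearMap.add_apply, ContinuousLinearMap.sum_apply,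
      ContinuousLinearMap.smul_apply, Pi.add_apply, Finset.sum_apply, Pi.smul_apply, smul_eq_mul,
      ContinuousLinearMap.comp_apply, ContinuousLinearMap.proj_apply,
      ContinuousLinearMap.single_apply, ContinuousLinearMap.coe_pi', Pi.single_apply]
    congr 1
    · simp
    · split_ifs <;> simp
  have huI := u_int hu hb
  let g : ℝ → Fin n → ℝ := fun t i => x₀ i + (if (i : ℕ) + 1 < n then 0 else
    ∫ s in t₀..t, indicator (Ici 0) u s)
  have hg : Continuous g := by
    refine continuous_pi fun i => continuous_const.add ?_
    split_ifs
    · exact continuous_const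
    · exact intervalIntegral.continuous_primitive huI t₀
  obtain ⟨x, hxc, hx⟩ := exists_linear_sol M hM g hg t₀
  refine ⟨x, ?_, fun i => (continuous_apply i).comp_continuousOn hxc, ?_⟩
  · rw [hx t₀ le_rfl]; ext i; simp [g]
  have hMx : ContinuousOn (fun s => M s (x s)) (Ici t₀) := hM.continuousOn.clm_apply hxc
  intro i t ht
  have ht : t₀ ≤ t := ht
  have hx0 : x t₀ i = x₀ i := by rw [hx t₀ le_rfl]; simp [g]
  have hsub : uIcc t₀ t ⊆ Ici t₀ := by rw [uIcc_of_le ht]; exact Icc_subset_Ici_self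
  have hint : IntervalIntegrable (fun s => M s (x s)) volume t₀ t := (hMx.mono hsub).intervalIntegrable
  have hinti : IntervalIntegrable (fun s => M s (x s) i) volume t₀ t :=
    ((continuous_apply i).comp_continuousOn (hMx.mono hsub)).intervalIntegrable
  have e1 : (∫ s in t₀..t, M s (x s)) i = ∫ s in t₀..t, M s (x s) i :=
    ((ContinuousLinearMap.proj (R := ℝ) (φ := fun _ : Fin n => ℝ) i).intervalIntegral_comp_comm hint).symm
  rw [hx0, hx t ht, Pi.add_apply, e1]
  simp only [g]
  rw [add_assoc]
  congr 1
  by_cases h : (i : ℕ) + 1 < n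
  · simp only [h, if_true, dif_pos, zero_add]
    refine intervalIntegral.integral_congr fun s hs => ?_
    have hs0 : max 0 s = s := max_eq_right (ht₀.trans (hsub hs))
    simp only [hMi, h, dif_pos, A, hs0]
  · simp only [h, if_false, dif_neg, not_false_eq_true]
    rw [← intervalIntegral.integral_add (huI _ _) hinti]
    refine intervalIntegral.integral_congr fun s hs => ?_
    have hs0' : 0 ≤ s := ht₀.trans (hsub hs)
    have hs0 : max 0 s = s := max_eq_right hs0'
    simp only [hMi, h, dif_neg, A, hs0, not_false_eq_true]
    rw [indicator_of_mem (by exact hs0')]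
    ring

/-- Decay of the Lyapunov function along solutions. -/
lemma lyap_decay {N m : ℕ} (a : ℝ → EuclideanSpace ℝ (Fin m) → ℝ)
    (p f : ℝ → ℝ) (hpC : ContDiff ℝ (⊤ : ℕ∞) p) (hp1 : ∀ t, 0 ≤ t → 1 ≤ p t)
    (hpd : ∀ t, HasDerivAt p (f t * p t ^ 2) t) (hf0 : ∀ t, 0 < f t) (hf1 : ∀ t, 0 ≤ t → f t ≤ 1)
    (φ : ℝ → ℝ) (hφ0 : ∀ t, 0 ≤ t → 0 < φ t) (hφp : ∀ t, 0 ≤ t → φ t ≤ p t)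
    (k : Fin (N+1) → ℝ) (T : (Fin (N+1) → ℝ) →ₗ[ℝ] (Fin (N+1) → ℝ))
    (C δ C2 c R : ℝ) (hδ : 0 < δ) (hC : 0 < C) (hC2 : 0 < C2)
    (h1 : ∀ z, z ⬝ᵥ z ≤ C * (T z ⬝ᵥ T z))
    (h2 : ∀ z, T z ⬝ᵥ T (chainF N.succ_pos k z) ≤ -δ * (T z ⬝ᵥ T z))
    (h3 : ∀ z, T z ⬝ᵥ T z ≤ C2 * (z ⬝ᵥ z)) (hR : 0 < R)
    (hRbig : 3 + C2 * (2 * N + 1 : ℝ) ^ 2 * C ≤ 2 * (c * R * δ))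
    (θ : ℝ → EuclideanSpace ℝ (Fin m))
    (hA : ContinuousOn (fun s => a s (θ s)) (Ici 0)) (hAc : ∀ s, 0 ≤ s → c ≤ a s (θ s))
    (u : ℝ → ℝ) (hu : Measurable u)
    (hb : ∀ T ≥ (0:ℝ), ∃ C : ℝ, ∀ᵐ τ ∂MeasureTheory.volume, τ ∈ Set.Icc 0 T → |u τ| ≤ C)
    (t₀ : ℝ) (ht₀ : 0 ≤ t₀) (x : ℝ → Fin (N+1) → ℝ)
    (hx : ClosedLoopSol N.succ_pos a (fun t => p t ^ 2) R k θ u t₀ x) (t : ℝ) (ht : t₀ ≤ t) (U : ℝ)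
    (hU : ∀ᵐ τ ∂MeasureTheory.volume, τ ∈ Set.Icc t₀ t → |u τ| ≤ U * φ τ)
    (ζ : ℝ → Fin (N+1) → ℝ) (hζ : ∀ s i, ζ s i = R ^ (N - (i:ℕ)) * p s ^ (2 * (N - (i:ℕ)) + 1) * x s i) :
    T (ζ t) ⬝ᵥ T (ζ t) ≤ Real.exp (-(t - t₀)) * (T (ζ t₀) ⬝ᵥ T (ζ t₀)) + C2 * U ^ 2 := by
  obtain ⟨hxc, hxi⟩ := hx
  have hpc : Continuous p := hpC.continuous
  have hIcc : uIcc t₀ t = Icc t₀ t := uIcc_of_le ht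
  have hsub : uIcc t₀ t ⊆ Ici t₀ := by rw [hIcc]; exact Icc_subset_Ici_self
  have hAc' : ContinuousOn (fun s => a s (θ s)) (uIcc t₀ t) :=
    hA.mono (hsub.trans (Ici_subset_Ici.2 ht₀))
  -- the right-hand sides
  let G : Fin (N+1) → ℝ → ℝ := fun i s =>
    (a s (θ s) * R ^ ((i : ℕ) + 1) * (p s ^ 2) ^ ((i : ℕ) + 1) * k i * x s ⟨0, N.succ_pos⟩ +
        (if h : (i : ℕ) + 1 < N + 1 then a s (θ s) * x s ⟨(i : ℕ) + 1, h⟩ else u s))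
  have hG : ∀ i, IntervalIntegrable (G i) volume t₀ t := by
    intro i
    refine IntervalIntegrable.add ?_ ?_
    · refine ContinuousOn.intervalIntegrable ?_
      have := (hxc ⟨0, N.succ_pos⟩).mono hsub
      have hpc' : ContinuousOn p (uIcc t₀ t) := hpc.continuousOn
      exact (((hAc'.mul continuousOn_const).mul ((hpc'.pow 2).pow _)).mul continuousOn_const).mul this
    · by_cases h : (i : ℕ) + 1 < N + 1
      · simp only [h, dif_pos]
        exact (hAc'.mul ((hxc ⟨(i : ℕ) + 1, h⟩).mono hsub)).intervalIntegrable
      · simp only [h, dif_neg, not_false_eq_true]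
        exact u_int' hu hb ht₀ ht
  let X : ℝ → Fin (N+1) → ℝ := fun s i => x t₀ i + ∫ r in t₀..s, G i r
  have hXx : ∀ s ∈ Icc t₀ t, X s = x s := by
    intro s hs; ext i; exact (hxi i s hs.1).symm
  have hXac : ∀ i, AbsolutelyContinuousOnInterval (fun s => X s i) t₀ t := fun i =>
    ((contDiff_const.contDiffOn).absolutelyContinuousOnInterval).fun_add
      ((hG i).absolutelyContinuousOnInterval_intervalIntegral left_mem_uIcc)
  let g : ℕ → ℝ → ℝ := fun j s => R ^ j * p s ^ (2 * j + 1)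
  have hgC : ∀ j, ContDiff ℝ 1 (g j) := fun j =>
    contDiff_const.mul ((hpC.of_le (by exact_mod_cast le_top)).pow _)
  have hgd : ∀ j s, HasDerivAt (g j) (f s * p s * (2 * j + 1) * g j s) s := by
    intro j s
    have := ((hpd s).pow (2 * j + 1)).const_mul (R ^ j)
    convert! this using 1
    simp only [g, Nat.add_sub_cancel]
    push_cast
    ring
  let Z : ℝ → Fin (N+1) → ℝ := fun s i => g (N - (i:ℕ)) s * X s i
  have hZζ : ∀ s ∈ Icc t₀ t, Z s = ζ s := by
    intro s hs; ext i; rw [hζ]; simp only [Z, g, hXx s hs]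
  have hZac : ∀ i, AbsolutelyContinuousOnInterval (fun s => Z s i) t₀ t := fun i =>
    ((hgC _).contDiffOn.absolutelyContinuousOnInterval).fun_mul (hXac i)
  have hTZac : ∀ i, AbsolutelyContinuousOnInterval (fun s => T (Z s) i) t₀ t := by
    intro i
    have : (fun s => T (Z s) i) = fun s => ∑ j, LinearMap.toMatrix' T i j * Z s j := by
      ext s; rw [← LinearMap.toMatrix'_mulVec]; rfl
    rw [this]
    exact ac_sum _ _ fun j _ => (hZac j).const_mul _
  let V : ℝ → ℝ := fun s => T (Z s) ⬝ᵥ T (Z s)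
  have hVac : AbsolutelyContinuousOnInterval V t₀ t :=
    ac_sum _ _ fun j _ => (hTZac j).fun_mul (hTZac j)
  let Q : ℝ → ℝ := fun s => ∫ r in t₀..s, p r ^ 2
  have hQd : ∀ s, HasDerivAt Q (p s ^ 2) s := fun s =>
    ((hpc.pow 2).integral_hasStrictDerivAt t₀ s).hasDerivAt
  have hQC : ContDiff ℝ 1 Q := by
    rw [contDiff_one_iff_deriv]
    refine ⟨fun s => (hQd s).differentiableAt, ?_⟩
    rw [show deriv Q = fun s => p s ^ 2 from funext fun s => (hQd s).deriv]
    exact hpc.pow 2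
  let K : ℝ := C2 * U ^ 2
  let H : ℝ → ℝ := fun s => Real.exp (Q s) * (V s - K)
  have hHac : AbsolutelyContinuousOnInterval H t₀ t :=
    (hQC.exp.contDiffOn.absolutelyContinuousOnInterval).fun_mul
      (hVac.fun_sub (contDiff_const.contDiffOn.absolutelyContinuousOnInterval))
  have hXd : ∀ᵐ s, ∀ i, s ∈ Icc t₀ t → HasDerivAt (fun s => X s i) (G i s) s := by
    rw [ae_all_iff]
    intro i
    filter_upwards [(hG i).ae_hasDerivAt_integral] with s hs hs'
    rw [hIcc] at hs
    exact (hs hs' t₀ (left_mem_Icc.2 ht)).const_add _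
  have hH : H t ≤ H t₀ := by
    refine ac_le_of_deriv_nonpos ht hHac ?_
    filter_upwards [hXd, hU] with s hs hsU hs'
    have hs0 : 0 ≤ s := ht₀.trans hs'.1
    let dZ : Fin (N+1) → ℝ := fun i =>
      f s * p s * (2 * ((N - (i:ℕ) : ℕ) : ℝ) + 1) * g (N - (i:ℕ)) s * X s i + g (N - (i:ℕ)) s * G i s
    have hZd : HasDerivAt Z dZ s := by
      rw [hasDerivAt_pi]
      intro i
      exact (hgd _ s).mul (hs i hs')
    have hTZd : HasDerivAt (fun s => T (Z s)) (T dZ) s :=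
      (LinearMap.toContinuousLinearMap T).hasFDerivAt.comp_hasDerivAt s hZd
    rw [hasDerivAt_pi] at hTZd
    have hVd : HasDerivAt V (2 * (T (Z s) ⬝ᵥ T dZ)) s := by
      have := HasDerivAt.fun_sum (u := Finset.univ) fun i _ => (hTZd i).mul (hTZd i)
      convert! this using 1
      simp only [dotProduct, Finset.mul_sum]
      refine Finset.sum_congr rfl fun i _ => by ring
    have hdZ : dZ = (a s (θ s) * R * p s ^ 2) • chainF N.succ_pos k (Z s) +
        (fun i : Fin (N+1) => f s * p s * (2 * ((N - (i:ℕ) : ℕ) : ℝ) + 1) * Z s i) +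
        (Pi.single (Fin.last N) (p s * u s) : Fin (N+1) → ℝ) := by
      ext i
      have hXs := hXx s hs'
      have hz : (⟨0, N.succ_pos⟩ : Fin (N+1)) = 0 := rfl
      simp only [dZ, G, Pi.add_apply, Pi.smul_apply, smul_eq_mul, chainF, Z, ← hXs, hz, Fin.val_zero,
        Nat.sub_zero]
      have e0 : g (N - (i:ℕ)) s * (R ^ ((i : ℕ) + 1) * (p s ^ 2) ^ ((i : ℕ) + 1))
          = R * p s ^ 2 * g N s := by
        have hi : (i : ℕ) ≤ N := Nat.lt_succ_iff.1 i.2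
        obtain ⟨j, hj⟩ := Nat.exists_eq_add_of_le hi
        simp only [g, hj, Nat.add_sub_cancel_left]
        ring
      by_cases h : (i : ℕ) + 1 < N + 1
      · have hne : i ≠ Fin.last N := by
          intro h'; rw [h'] at h; simp at h
        simp only [h, dif_pos, Pi.single_apply, hne, if_false]
        have e1 : g (N - (i:ℕ)) s = R * p s ^ 2 * g (N - ((i:ℕ) + 1)) s := by
          obtain ⟨j, hj⟩ := Nat.exists_eq_add_of_le (Nat.lt_succ_iff.1 h)
          have e : N - (i:ℕ) = j + 1 := by omega
          have e' : N - ((i:ℕ) + 1) = j := by omega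
          simp only [g, e, e']
          ring
        linear_combination (a s (θ s) * k i * X s 0) * e0 +
          (a s (θ s) * X s ⟨(i : ℕ) + 1, h⟩) * e1
      · have he : i = Fin.last N := by
          apply Fin.ext; have := i.2; simp; omega
        simp only [h, dif_neg, not_false_eq_true]
        have e2 : g (N - (i:ℕ)) s = p s := by
          subst he; simp [g]
        have e3 : (Pi.single (Fin.last N) (p s * u s) : Fin (N+1) → ℝ) i = p s * u s := by
          subst he; simp
        rw [e3]
        linear_combination (a s (θ s) * k i * X s 0) * e0 + (u s) * e2
    have key := lyap_pointwise k T C δ C2 c R (2 * N + 1) hδ hC hC2 h1 h2 h3 hR hRbig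
      (a s (θ s)) (p s) (f s) (u s) U (φ s) (hAc s hs0) (hp1 s hs0) (hf0 s).le (hf1 s hs0)
      (hφ0 s hs0).le (hφp s hs0) (hsU hs') (fun i : Fin (N+1) => (2 * ((N - (i:ℕ) : ℕ) : ℝ) + 1)) (Z s) dZ
      (fun i => by
        have : ((N - (i:ℕ) : ℕ) : ℝ) ≤ N := by exact_mod_cast Nat.sub_le _ _
        rw [abs_of_nonneg (by positivity)]; linarith) (Fin.last N) hdZ
    refine ⟨_, ?_, ((hQd s).exp).mul (hVd.sub_const K)⟩
    have hexp := Real.exp_pos (Q s)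
    have : Real.exp (Q s) * p s ^ 2 * (V s - K) + Real.exp (Q s) * (2 * (T (Z s) ⬝ᵥ T dZ)) =
      Real.exp (Q s) * (p s ^ 2 * (V s - K) + 2 * (T (Z s) ⬝ᵥ T dZ)) := by ring
    rw [this]
    refine mul_nonpos_of_nonneg_of_nonpos hexp.le ?_
    simp only [V, K]
    linarith
  have hQ0 : Q t₀ = 0 := by simp [Q]
  have hQt : t - t₀ ≤ Q t := by
    have h5 : ∫ r in t₀..t, (1:ℝ) = t - t₀ := by simp
    rw [← h5]
    refine intervalIntegral.integral_mono_on ht (by simp) ((hpc.pow 2).intervalIntegrable _ _) ?_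
    intro r hr
    have := hp1 r (ht₀.trans hr.1)
    nlinarith
  have hV0 : 0 ≤ V t₀ := dot_self_nonneg' _
  have hK0 : 0 ≤ K := by positivity
  have e1 : V t = T (ζ t) ⬝ᵥ T (ζ t) := by simp only [V, hZζ t (right_mem_Icc.2 ht)]
  have e2 : V t₀ = T (ζ t₀) ⬝ᵥ T (ζ t₀) := by simp only [V, hZζ t₀ (left_mem_Icc.2 ht)]
  rw [← e1, ← e2]
  change V t ≤ Real.exp (-(t - t₀)) * V t₀ + K
  simp only [H, hQ0, Real.exp_zero, one_mul] at hH
  have h6 : V t - K ≤ Real.exp (-(Q t)) * (V t₀ - K) := by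
    rw [Real.exp_neg, ← div_eq_inv_mul, le_div_iff₀ (Real.exp_pos _)]
    linarith
  have h7 : Real.exp (-(Q t)) * (V t₀ - K) ≤ Real.exp (-(Q t)) * V t₀ := by
    gcongr; linarith
  have h8 : Real.exp (-(Q t)) * V t₀ ≤ Real.exp (-(t - t₀)) * V t₀ := by
    gcongr
  linarith

/-- Lemma 2.12: for every `φ ∈ K⁺` there exist `q ∈ K*`, `ρ ∈ K⁺`, a vector
`k ∈ ℝⁿ` and constants `γ, R, M > 0` such that for every `t₀ ≥ 0`, every continuous
`θ : [0,∞) → Θ`, every initial condition and every locally essentially bounded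
measurable `u`, the closed-loop solution exists globally and satisfies
`φ(t)|x(t)| ≤ ρ(t₀)e^{−γ(t−t₀)}|x₀| + M·sup_{τ∈[t₀,t]}(|u(τ)|/φ(τ))` for `t ≥ t₀`
(the essential supremum is expressed through arbitrary essential bounds `U`). -/
theorem closed_loop_estimate (n m : ℕ) (hn : 0 < n)
    (Θ : Set (EuclideanSpace ℝ (Fin m)))
    (a : ℝ → EuclideanSpace ℝ (Fin m) → ℝ)
    (ha_cont : ContinuousOn (fun p : ℝ × EuclideanSpace ℝ (Fin m) => a p.1 p.2)
      (Set.Ici 0 ×ˢ Θ))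
    (ha_pos : ∃ c > (0:ℝ), ∀ t ≥ (0:ℝ), ∀ ϑ ∈ Θ, c ≤ a t ϑ)
    (φ : ℝ → ℝ) (hφ : IsKPlus φ) :
    ∃ q ρ : ℝ → ℝ, IsKStar q ∧ IsKPlus ρ ∧ ∃ k : Fin n → ℝ, ∃ γ R M : ℝ,
      0 < γ ∧ 0 < R ∧ 0 < M ∧
      ∀ t₀ ≥ (0:ℝ), ∀ θ : ℝ → EuclideanSpace ℝ (Fin m), Continuous θ →
        (∀ t, θ t ∈ Θ) → ∀ u : ℝ → ℝ, Measurable u →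
        (∀ T ≥ (0:ℝ), ∃ C : ℝ, ∀ᵐ τ ∂MeasureTheory.volume,
          τ ∈ Set.Icc 0 T → |u τ| ≤ C) →
        (∀ x₀ : Fin n → ℝ, ∃ x : ℝ → Fin n → ℝ,
          x t₀ = x₀ ∧ ClosedLoopSol hn a q R k θ u t₀ x) ∧
        (∀ x : ℝ → Fin n → ℝ, ClosedLoopSol hn a q R k θ u t₀ x →
          ∀ t ≥ t₀, ∀ U : ℝ, 0 ≤ U →
            (∀ᵐ τ ∂MeasureTheory.volume, τ ∈ Set.Icc t₀ t → |u τ| ≤ U * φ τ) →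
            φ t * Real.sqrt (∑ i, x t i ^ 2) ≤
              ρ t₀ * Real.exp (-γ * (t - t₀)) * Real.sqrt (∑ i, x t₀ i ^ 2) + M * U) := by
  obtain ⟨N, rfl⟩ := Nat.exists_eq_succ_of_ne_zero hn.ne'
  obtain ⟨c, hc, hca⟩ := ha_pos
  obtain ⟨p, f, hpC, hp1, hp0, hφp, hpd, hf0, hfe⟩ := exists_p φ hφ
  obtain ⟨k, T, C, δ, hC, hδ, h1, h2⟩ := exists_hurwitz N
  obtain ⟨C2, hC2, h3⟩ := exists_upper T
  have hpc : Continuous p := hpC.continuous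
  have hf1 : ∀ t, 0 ≤ t → f t ≤ 1 := fun t ht =>
    (hfe t).trans (Real.exp_le_one_iff.2 (by linarith))
  obtain ⟨R, hR1, hRbig⟩ : ∃ R : ℝ, 1 ≤ R ∧ 3 + C2 * (2 * N + 1 : ℝ) ^ 2 * C ≤ 2 * (c * R * δ) := by
    refine ⟨max 1 ((3 + C2 * (2 * N + 1 : ℝ) ^ 2 * C) / (2 * (c * δ))), le_max_left _ _, ?_⟩
    have := le_max_right 1 ((3 + C2 * (2 * N + 1 : ℝ) ^ 2 * C) / (2 * (c * δ)))
    rw [div_le_iff₀ (by positivity)] at this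
    linarith
  have hR : 0 < R := by linarith
  have hqd : ∀ t, HasDerivAt (fun t => p t ^ 2) (2 * p t * (f t * p t ^ 2)) t := by
    intro t
    have := (hpd t).pow 2
    convert! this using 1
    simp
  refine ⟨fun t => p t ^ 2, fun t => Real.sqrt (C * C2) * (R ^ N * p t ^ (2 * N + 1)), ?_, ?_, k,
    1 / 2, R, Real.sqrt (C * C2), by norm_num, hR, by positivity, ?_⟩
  · refine ⟨(hpC.pow 2).contDiffOn, ?_, ?_, ?_⟩
    · refine Monotone.monotoneOn (monotone_of_deriv_nonneg (fun t => (hqd t).differentiableAt) ?_) _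
      intro t
      rw [(hqd t).deriv]
      have := hp0 t
      have := hf0 t
      positivity
    · have := hp1 0 le_rfl
      simp only
      nlinarith
    · have h5 : Tendsto (fun t : ℝ => 2 * Real.exp (-t)) atTop (nhds 0) := by
        simpa using (Real.tendsto_exp_neg_atTop_nhds_zero).const_mul 2
      have e : ∀ t, 0 ≤ t → derivWithin (fun t => p t ^ 2) (Ici 0) t / (p t ^ 2) ^ 2
          = 2 * f t / p t := by
        intro t ht
        rw [(hqd t).hasDerivWithinAt.derivWithin (uniqueDiffOn_Ici 0 t ht)]
        have := (hp0 t).ne'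
        field_simp
      refine tendsto_of_tendsto_of_tendsto_of_le_of_le' tendsto_const_nhds h5 ?_ ?_
      · filter_upwards [eventually_ge_atTop 0] with t ht
        rw [e t ht]
        have := hp0 t
        have := hf0 t
        positivity
      · filter_upwards [eventually_ge_atTop 0] with t ht
        rw [e t ht, div_le_iff₀ (hp0 t)]
        have h6 := hp1 t ht
        have h7 := hfe t
        have h8 := Real.exp_pos (-t)
        nlinarith
  · refine ⟨Continuous.continuousOn (by fun_prop), fun t _ => ?_⟩
    have := hp0 t
    positivity
  intro t₀ ht₀ θ hθ hθΘ u hu hb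
  have hA : ContinuousOn (fun s => a s (θ s)) (Ici 0) := by
    have : ContinuousOn (fun s : ℝ => (s, θ s)) (Ici 0) := by fun_prop
    exact ha_cont.comp this fun s hs => ⟨hs, hθΘ s⟩
  refine ⟨fun x₀ => exists_closed_loop hn a _ (by fun_prop) R k θ hA u hu hb t₀ ht₀ x₀, ?_⟩
  intro x hx t ht U hU0 hU
  let ζ : ℝ → Fin (N+1) → ℝ := fun s i => R ^ (N - (i:ℕ)) * p s ^ (2 * (N - (i:ℕ)) + 1) * x s i
  have hdec := lyap_decay a p f hpC hp1 hpd hf0 hf1 φ (fun t ht => hφ.2 t ht) hφp k T C δ C2 c R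
    hδ hC hC2 h1 h2 h3 hR hRbig θ hA (fun s hs => hca s hs _ (hθΘ s)) u hu hb t₀ ht₀ x hx t ht U hU
    ζ (fun s i => rfl)
  have ht0 : 0 ≤ t := ht₀.trans ht
  set S := ∑ i, x t i ^ 2 with hS
  set S₀ := ∑ i, x t₀ i ^ 2 with hS₀
  have hS_nn : 0 ≤ S := Finset.sum_nonneg fun i _ => sq_nonneg _
  have hS0_nn : 0 ≤ S₀ := Finset.sum_nonneg fun i _ => sq_nonneg _
  have hpt := hp1 t ht0
  have hpt0 := hp1 t₀ ht₀
  have low : p t ^ 2 * S ≤ ζ t ⬝ᵥ ζ t := by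
    rw [hS, Finset.mul_sum]
    refine Finset.sum_le_sum fun i _ => ?_
    have b1 : p t ≤ R ^ (N - (i:ℕ)) * p t ^ (2 * (N - (i:ℕ)) + 1) := by
      have b2 : 1 ≤ R ^ (N - (i:ℕ)) := one_le_pow₀ hR1
      have b3 : p t ≤ p t ^ (2 * (N - (i:ℕ)) + 1) := le_self_pow₀ hpt (by omega)
      nlinarith
    calc p t ^ 2 * x t i ^ 2 ≤ (R ^ (N - (i:ℕ)) * p t ^ (2 * (N - (i:ℕ)) + 1)) ^ 2 * x t i ^ 2 := by
          have := hp0 t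
          gcongr
      _ = ζ t i * ζ t i := by simp only [ζ]; ring
  have up : ζ t₀ ⬝ᵥ ζ t₀ ≤ (R ^ N * p t₀ ^ (2 * N + 1)) ^ 2 * S₀ := by
    rw [hS₀, Finset.mul_sum]
    refine Finset.sum_le_sum fun i _ => ?_
    have b2 : R ^ (N - (i:ℕ)) ≤ R ^ N := pow_le_pow_right₀ hR1 (Nat.sub_le _ _)
    have b3 : p t₀ ^ (2 * (N - (i:ℕ)) + 1) ≤ p t₀ ^ (2 * N + 1) :=
      pow_le_pow_right₀ hpt0 (by omega)
    have := hp0 t₀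
    calc ζ t₀ i * ζ t₀ i = (R ^ (N - (i:ℕ)) * p t₀ ^ (2 * (N - (i:ℕ)) + 1)) ^ 2 * x t₀ i ^ 2 := by
          simp only [ζ]; ring
      _ ≤ _ := by gcongr
  set g := R ^ N * p t₀ ^ (2 * N + 1) with hg
  have hg0 : 0 < g := by have := hp0 t₀; positivity
  have hφt := hφ.2 t ht0
  have main : φ t ^ 2 * S ≤ C * C2 * (g ^ 2 * Real.exp (-(t - t₀)) * S₀ + U ^ 2) := by
    calc φ t ^ 2 * S ≤ p t ^ 2 * S := by gcongr; exact hφp t ht0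
      _ ≤ ζ t ⬝ᵥ ζ t := low
      _ ≤ C * (T (ζ t) ⬝ᵥ T (ζ t)) := h1 _
      _ ≤ C * (Real.exp (-(t - t₀)) * (C2 * (g ^ 2 * S₀)) + C2 * U ^ 2) := by
          gcongr
          refine hdec.trans ?_
          gcongr
          refine (h3 _).trans ?_
          gcongr
      _ = _ := by ring
  have hexp : Real.exp (-(1/2) * (t - t₀)) ^ 2 = Real.exp (-(t - t₀)) := by
    rw [← Real.exp_nat_mul]; congr 1; push_cast; ring
  have hE := Real.exp_pos (-(1/2) * (t - t₀))
  have hrhs : 0 ≤ Real.sqrt (C * C2) * g * Real.exp (-(1/2) * (t - t₀)) * Real.sqrt S₀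
      + Real.sqrt (C * C2) * U := by positivity
  rw [← pow_le_pow_iff_left₀ (by positivity) hrhs two_ne_zero, mul_pow, Real.sq_sqrt hS_nn]
  refine main.trans ?_
  rw [← hexp]
  have q1 := Real.sq_sqrt (show 0 ≤ C * C2 by positivity)
  have q2 := Real.sq_sqrt hS0_nn
  have q3 : 0 ≤ (Real.sqrt (C * C2) * g * Real.exp (-(1/2) * (t - t₀)) * Real.sqrt S₀)
      * (Real.sqrt (C * C2) * U) := by positivity
  calc C * C2 * (g ^ 2 * Real.exp (-(1/2) * (t - t₀)) ^ 2 * S₀ + U ^ 2)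
      = (Real.sqrt (C * C2)) ^ 2 * (g ^ 2 * Real.exp (-(1/2) * (t - t₀)) ^ 2 * (Real.sqrt S₀) ^ 2
        + U ^ 2) := by rw [q1, q2]
    _ ≤ _ := by nlinarith
end
end

section
/- Suppose Ψ: [0,∞)×ℝᵐ → ℝⁿ is continuous. Then there exist functions a₁, a₂ of class K∞ and β of class K⁺ such that for every (t,x,y) ∈ [0,∞)×ℝᵐ×ℝᵐ it holds that |Ψ(t,x) − Ψ(t,y)| ≤ a₁(β(t)·|x−y|) + a₂(|y|)·|x−y|. -/
open Set Filter

noncomputable section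

/-- A monotone function vanishing at zero and right-continuous there is dominated by
a class `K∞` function. -/
lemma exists_kInfty_ge (g : ℝ → ℝ) (hg : Monotone g) (g0 : g 0 = 0)
    (hlim : ∀ ε > 0, ∃ δ > 0, g δ ≤ ε) :
    ∃ a : ℝ → ℝ, IsKInfty a ∧ ∀ r ≥ (0:ℝ), g r ≤ a r ∧ r ≤ a r := by
  have hii : ∀ a b : ℝ, IntervalIntegrable g MeasureTheory.volume a b :=
    fun a b => hg.intervalIntegrable
  have hmono : ∀ r : ℝ, 0 ≤ r → Monotone (fun u => g (r * u)) :=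
    fun r hr u v huv => hg (mul_le_mul_of_nonneg_left huv hr)
  have hlow : ∀ r : ℝ, 0 ≤ r → g r ≤ ∫ u in (1:ℝ)..2, g (r * u) := by
    intro r hr
    have h := intervalIntegral.integral_mono_on (μ := MeasureTheory.volume) (a := 1) (b := 2)
      (f := fun _ => g r) (g := fun u => g (r * u)) (by norm_num) (by simp)
      (hmono r hr).intervalIntegrable
      (fun u hu => hg (by nlinarith [hu.1]))
    rw [intervalIntegral.integral_const] at h
    norm_num at h
    exact h
  have hup : ∀ r : ℝ, 0 ≤ r → (∫ u in (1:ℝ)..2, g (r * u)) ≤ g (2 * r) := by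
    intro r hr
    have h := intervalIntegral.integral_mono_on (μ := MeasureTheory.volume) (a := 1) (b := 2)
      (f := fun u => g (r * u)) (g := fun _ => g (2 * r)) (by norm_num)
      (hmono r hr).intervalIntegrable (by simp)
      (fun u hu => hg (by nlinarith [hu.2]))
    rw [intervalIntegral.integral_const] at h
    norm_num at h
    exact h
  have hpos : ∀ r : ℝ, 0 ≤ r → 0 ≤ g r := fun r hr => g0 ▸ hg hr
  have hle : ∀ r : ℝ, 0 ≤ r → r ≤ (∫ u in (1:ℝ)..2, g (r * u)) + r := by
    intro r hr
    linarith [hlow r hr, hpos r hr]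
  have hF : Continuous (fun x => ∫ u in (0:ℝ)..x, g u) :=
    intervalIntegral.continuous_primitive hii 0
  refine ⟨fun r => (∫ u in (1:ℝ)..2, g (r * u)) + r, ⟨?_, ?_, ?_, ?_⟩, ?_⟩
  · refine ContinuousOn.add ?_ continuousOn_id
    intro r hr
    rcases eq_or_lt_of_le (show (0:ℝ) ≤ r from hr) with h0 | h0
    · subst h0
      rw [Metric.continuousWithinAt_iff]
      intro ε hε
      obtain ⟨δ, hδ, hgd⟩ := hlim (ε / 2) (by linarith)
      refine ⟨δ / 2, by linarith, ?_⟩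
      intro x hx hxd
      have hx0 : (0:ℝ) ≤ x := hx
      rw [Real.dist_eq, sub_zero, abs_of_nonneg hx0] at hxd
      have h1 := hlow x hx0
      have h2 := hup x hx0
      have h3 : g (2 * x) ≤ g δ := hg (by linarith)
      have h4 := hpos x hx0
      simp only [zero_mul, g0, intervalIntegral.integral_zero, Real.dist_eq, sub_zero]
      rw [abs_of_nonneg (by linarith)]
      linarith
    · apply ContinuousAt.continuousWithinAt
      have hc : ContinuousAt (fun x : ℝ => x⁻¹ *
          ((∫ u in (0:ℝ)..(x * 2), g u) - ∫ u in (0:ℝ)..x, g u)) r := by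
        refine ContinuousAt.mul (continuousAt_inv₀ h0.ne') ?_
        exact ((hF.comp (continuous_id.mul continuous_const)).sub hF).continuousAt
      refine hc.congr ?_
      filter_upwards [lt_mem_nhds h0] with x hx
      rw [intervalIntegral.integral_comp_mul_left _ hx.ne', mul_one,
        intervalIntegral.integral_interval_sub_left (hii _ _) (hii _ _), smul_eq_mul]
  · intro r hr s hs hrs
    have hr0 : (0:ℝ) ≤ r := hr
    have hs0 : (0:ℝ) ≤ s := hs
    have h := intervalIntegral.integral_mono_on (μ := MeasureTheory.volume) (a := 1) (b := 2)
      (f := fun u => g (r * u)) (g := fun u => g (s * u)) (by norm_num)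
      (hmono r hr0).intervalIntegrable (hmono s hs0).intervalIntegrable
      (fun u hu => hg (by nlinarith [hu.1]))
    simp only at h ⊢
    linarith
  · simp [g0]
  · refine tendsto_atTop_mono' atTop ?_ tendsto_id
    filter_upwards [eventually_ge_atTop (0:ℝ)] with r hr
    exact hle r hr
  · intro r hr
    exact ⟨by linarith [hlow r hr], hle r hr⟩

lemma exists_kInfty_ge_seq (h : ℕ → ℝ) :
    ∃ a : ℝ → ℝ, IsKInfty a ∧ (∀ r ≥ (0:ℝ), 0 ≤ a r) ∧ ∀ s ≥ (1:ℝ), h ⌈s⌉₊ ≤ a s := by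
  have hH : Monotone (fun k : ℕ => ∑ i ∈ Finset.range (k + 1), |h i|) := by
    intro k l hkl
    exact Finset.sum_le_sum_of_subset_of_nonneg
      (Finset.range_mono (by omega)) (fun _ _ _ => abs_nonneg _)
  obtain ⟨a, ha, hga⟩ := exists_kInfty_ge
    (fun s => if s < 1 then 0 else ∑ i ∈ Finset.range (⌈s⌉₊ + 1), |h i|)
    (by
      intro s t hst
      by_cases h1 : t < 1
      · have : s < 1 := by linarith
        simp [h1, this]
      · by_cases h2 : s < 1
        · simp only [h1, h2, if_true, if_false]
          exact Finset.sum_nonneg (fun _ _ => abs_nonneg _)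
        · simp only [h1, h2, if_false]
          exact hH (Nat.ceil_mono hst))
    (by simp) (fun ε hε => ⟨1 / 2, by norm_num, by norm_num; exact hε.le⟩)
  refine ⟨a, ha, fun r hr => hr.trans (hga r hr).2, ?_⟩
  intro s hs
  have h1 := (hga s (by linarith)).1
  simp only [not_lt.mpr hs, if_false] at h1
  refine le_trans (le_abs_self _) (le_trans ?_ h1)
  exact Finset.single_le_sum (f := fun i => |h i|) (fun _ _ => abs_nonneg _)
    (Finset.mem_range.mpr (Nat.lt_succ_self _))

/-- Lemma 2.13: if `Ψ : [0,∞)×ℝᵐ → ℝⁿ` is continuous, then there exist `a₁, a₂ ∈ K∞`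
and `β ∈ K⁺` such that `|Ψ(t,x) − Ψ(t,y)| ≤ a₁(β(t)·|x−y|) + a₂(|y|)·|x−y|`
for all `t ≥ 0` and `x, y ∈ ℝᵐ`. -/
theorem continuous_map_growth_estimate (m n : ℕ)
    (Ψ : ℝ → EuclideanSpace ℝ (Fin m) → EuclideanSpace ℝ (Fin n))
    (hΨ : ContinuousOn (fun q : ℝ × EuclideanSpace ℝ (Fin m) => Ψ q.1 q.2)
      (Set.Ici 0 ×ˢ (Set.univ : Set (EuclideanSpace ℝ (Fin m))))) :
    ∃ a₁ a₂ β : ℝ → ℝ, IsKInfty a₁ ∧ IsKInfty a₂ ∧ IsKPlus β ∧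
      ∀ t ≥ (0:ℝ), ∀ x y : EuclideanSpace ℝ (Fin m),
        ‖Ψ t x - Ψ t y‖ ≤ a₁ (β t * ‖x - y‖) + a₂ ‖y‖ * ‖x - y‖ := by
  have hcpt : ∀ A B : ℝ, IsCompact (Set.Icc 0 A ×ˢ
      Metric.closedBall (0 : EuclideanSpace ℝ (Fin m)) B) :=
    fun A B => isCompact_Icc.prod (isCompact_closedBall _ _)
  have hcont : ∀ A B : ℝ, ContinuousOn (fun q : ℝ × EuclideanSpace ℝ (Fin m) => Ψ q.1 q.2)
      (Set.Icc 0 A ×ˢ Metric.closedBall (0 : EuclideanSpace ℝ (Fin m)) B) :=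
    fun A B => hΨ.mono (Set.prod_mono (fun t ht => ht.1) (Set.subset_univ _))
  have hM : ∀ k : ℕ, ∃ M : ℝ, 0 ≤ M ∧ ∀ (t : ℝ) x y, 0 ≤ t → t ≤ k → ‖y‖ ≤ k → ‖x - y‖ ≤ k →
      ‖Ψ t x - Ψ t y‖ ≤ M := by
    intro k
    obtain ⟨C, hC⟩ := (hcpt k (2 * k)).exists_bound_of_continuousOn (hcont k (2 * k))
    refine ⟨|2 * C|, abs_nonneg _, ?_⟩
    intro t x y ht htk hy hxy
    have hx : ‖x‖ ≤ 2 * k := by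
      have := norm_add_le (x - y) y
      rw [sub_add_cancel] at this
      linarith
    have hk : (0:ℝ) ≤ k := Nat.cast_nonneg k
    have h1 := hC (t, x) ⟨⟨ht, htk⟩, by simpa using hx⟩
    have h2 := hC (t, y) ⟨⟨ht, htk⟩, by simpa using (by linarith : ‖y‖ ≤ 2 * k)⟩
    simp only at h1 h2
    have h3 := norm_sub_le (Ψ t x) (Ψ t y)
    have h4 := le_abs_self (2 * C)
    linarith
  choose M hM0 hM using hM
  have hd : ∀ k : ℕ, ∃ δ : ℝ, 0 < δ ∧ ∀ (t : ℝ) x y, 0 ≤ t → t ≤ k → ‖y‖ ≤ k → ‖x - y‖ ≤ δ →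
      ‖Ψ t x - Ψ t y‖ ≤ 1 / ((k:ℝ) + 1) := by
    intro k
    have huc := (hcpt k (k + 1)).uniformContinuousOn_of_continuous (hcont k (k + 1))
    rw [Metric.uniformContinuousOn_iff] at huc
    obtain ⟨δ, hδ, h⟩ := huc (1 / ((k:ℝ) + 1)) (by positivity)
    refine ⟨min (δ / 2) 1, by positivity, ?_⟩
    intro t x y ht htk hy hxy
    have hxy1 : ‖x - y‖ ≤ 1 := hxy.trans (min_le_right _ _)
    have hxy2 : ‖x - y‖ ≤ δ / 2 := hxy.trans (min_le_left _ _)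
    have hx : ‖x‖ ≤ k + 1 := by
      have := norm_add_le (x - y) y
      rw [sub_add_cancel] at this
      linarith
    have h1 := h (t, x) ⟨⟨ht, htk⟩, by simpa using hx⟩ (t, y)
      ⟨⟨ht, htk⟩, by simpa using (by linarith : ‖y‖ ≤ k + 1)⟩ (by
        rw [Prod.dist_eq]
        simp only [dist_self, dist_eq_norm]
        rw [max_lt_iff]
        constructor <;> linarith)
    rw [dist_eq_norm] at h1
    exact h1.le
  choose δ hδ0 hδ using hd
  -- the scale
  let σ : ℝ → EuclideanSpace ℝ (Fin m) → ℝ := fun t y => max (max t 1) ‖y‖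
  have hσ1 : ∀ t y, 1 ≤ σ t y := fun t y => le_max_of_le_left (le_max_right _ _)
  have hσt : ∀ t y, t ≤ σ t y := fun t y => le_max_of_le_left (le_max_left _ _)
  have hσy : ∀ t y, ‖y‖ ≤ σ t y := fun t y => le_max_right _ _
  let S : ℝ → Set ℝ := fun r => {v | v = 0 ∨ ∃ t x y, 0 ≤ t ∧ ‖x - y‖ ≤ r ∧
    (‖x - y‖ ≤ δ ⌈σ t y⌉₊ ∨ σ t y ≤ ‖x - y‖) ∧ v = ‖Ψ t x - Ψ t y‖}
  have hS0 : ∀ r, (0:ℝ) ∈ S r := fun r => Or.inl rfl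
  have hSmono : ∀ r s, r ≤ s → S r ⊆ S s := by
    rintro r s hrs v (hv | ⟨t, x, y, ht, hxy, hc, hv⟩)
    · exact Or.inl hv
    · exact Or.inr ⟨t, x, y, ht, hxy.trans hrs, hc, hv⟩
  have hSb : ∀ r, BddAbove (S r) := by
    intro r
    refine ⟨max 1 (M ⌈r⌉₊), ?_⟩
    rintro v (hv | ⟨t, x, y, ht, hxy, hc | hc, hv⟩)
    · rw [hv]; exact le_max_of_le_left zero_le_one
    · rw [hv]
      refine le_max_of_le_left (le_trans (hδ ⌈σ t y⌉₊ t x y ht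
        ((hσt t y).trans (Nat.le_ceil _)) ((hσy t y).trans (Nat.le_ceil _)) hc) ?_)
      rw [div_le_one (by positivity)]
      have : (0:ℝ) ≤ (⌈σ t y⌉₊ : ℝ) := Nat.cast_nonneg _
      linarith
    · rw [hv]
      have hr := Nat.le_ceil r
      have h1 := hσt t y
      have h2 := hσy t y
      exact le_max_of_le_right (hM _ t x y ht (by linarith) (by linarith) (by linarith))
  obtain ⟨a₁, ha₁, hga⟩ := exists_kInfty_ge (fun r => sSup (S r))
    (fun r s hrs => csSup_le_csSup (hSb s) ⟨0, hS0 r⟩ (hSmono r s hrs))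
    (by
      refine le_antisymm (csSup_le ⟨0, hS0 0⟩ ?_) (le_csSup (hSb 0) (hS0 0))
      rintro v (hv | ⟨t, x, y, ht, hxy, hc, hv⟩)
      · exact hv.le
      · have : x = y := sub_eq_zero.mp (norm_le_zero_iff.mp hxy)
        rw [hv, this, sub_self, norm_zero])
    (by
      intro ε hε
      obtain ⟨k, hk⟩ := exists_nat_one_div_lt hε
      refine ⟨min (δ k) (1 / 2), lt_min (hδ0 k) (by norm_num), csSup_le ⟨0, hS0 _⟩ ?_⟩
      rintro v (hv | ⟨t, x, y, ht, hxy, hc | hc, hv⟩)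
      · rw [hv]; exact hε.le
      · rw [hv]
        by_cases hsk : σ t y ≤ k
        · exact (hδ k t x y ht ((hσt t y).trans hsk) ((hσy t y).trans hsk)
            (hxy.trans (min_le_left _ _))).trans hk.le
        · have hk2 : (k:ℝ) ≤ ⌈σ t y⌉₊ := (not_le.mp hsk).le.trans (Nat.le_ceil _)
          refine le_trans (hδ ⌈σ t y⌉₊ t x y ht
            ((hσt t y).trans (Nat.le_ceil _)) ((hσy t y).trans (Nat.le_ceil _)) hc)
            (le_trans ?_ hk.le)
          exact one_div_le_one_div_of_le (by positivity) (by linarith)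
      · have h1 := hσ1 t y
        have h2 := hxy.trans (min_le_right _ _)
        linarith)
  obtain ⟨a₂, ha₂, ha₂0, hga₂⟩ := exists_kInfty_ge_seq (fun k => M k / δ k)
  have ha₁mono : ∀ r s : ℝ, 0 ≤ r → r ≤ s → a₁ r ≤ a₁ s :=
    fun r s hr hrs => ha₁.2.1.monotoneOn hr (hr.trans hrs) hrs
  have hb1 := ha₂0 1 zero_le_one
  refine ⟨a₁, a₂, fun t => 1 + a₂ 1 + a₂ t, ha₁, ha₂, ⟨?_, ?_⟩, ?_⟩
  · exact continuousOn_const.add ha₂.1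
  · intro t ht
    have := ha₂0 t ht
    simp only
    linarith
  · intro t ht x y
    have hbt := ha₂0 t ht
    have hby := ha₂0 ‖y‖ (norm_nonneg y)
    have hr := norm_nonneg (x - y)
    have hprod : 0 ≤ a₂ ‖y‖ * ‖x - y‖ := mul_nonneg hby hr
    have hbr : ‖x - y‖ ≤ (1 + a₂ 1 + a₂ t) * ‖x - y‖ := by nlinarith
    by_cases hc : ‖x - y‖ ≤ δ ⌈σ t y⌉₊ ∨ σ t y ≤ ‖x - y‖
    · have h1 : ‖Ψ t x - Ψ t y‖ ≤ sSup (S ‖x - y‖) :=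
        le_csSup (hSb _) (Or.inr ⟨t, x, y, ht, le_rfl, hc, rfl⟩)
      have h2 := (hga _ hr).1
      have h3 := ha₁mono _ _ hr hbr
      simp only at h2 ⊢
      linarith
    · rw [not_or, not_le, not_le] at hc
      obtain ⟨hc1, hc2⟩ := hc
      have hce := Nat.le_ceil (σ t y)
      have h1 := hM ⌈σ t y⌉₊ t x y ht ((hσt t y).trans hce) ((hσy t y).trans hce)
        (hc2.le.trans hce)
      have h2 : M ⌈σ t y⌉₊ ≤ M ⌈σ t y⌉₊ / δ ⌈σ t y⌉₊ * ‖x - y‖ := by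
        rw [div_mul_eq_mul_div, le_div_iff₀ (hδ0 _)]
        exact mul_le_mul_of_nonneg_left hc1.le (hM0 _)
      have h3 : M ⌈σ t y⌉₊ / δ ⌈σ t y⌉₊ ≤ a₂ (σ t y) := hga₂ _ (hσ1 t y)
      have h4 := mul_le_mul_of_nonneg_right h3 hr
      have h5 := (hga ((1 + a₂ 1 + a₂ t) * ‖x - y‖) (hr.trans hbr)).2
      simp only
      rcases max_choice (max t 1) ‖y‖ with hm | hm
      · have h6 : a₂ (σ t y) ≤ 1 + a₂ 1 + a₂ t := by
          change a₂ (max (max t 1) ‖y‖) ≤ _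
          rw [hm]
          rcases max_choice t 1 with hm2 | hm2 <;> rw [hm2] <;> linarith
        have h7 := mul_le_mul_of_nonneg_right h6 hr
        linarith
      · have h6 : σ t y = ‖y‖ := hm
        rw [h6] at h4 h2 h1
        linarith
end
end

section
/- For every function φ of class K⁺ there exists a function φ̃ of class K* such that φ(t) ≤ φ̃(t) for all t ≥ 0. -/
open Set Filter

noncomputable section

def auxP (a : ℕ → ℝ) (N : ℕ) (t : ℝ) : ℝ :=
  a 0 - ∑ n ∈ Finset.range N, (a n - a (n + 1)) * Real.smoothTransition (t - n)

def auxR (a : ℕ → ℝ) (t : ℝ) : ℝ := auxP a (⌊t⌋₊ + 1) t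

lemma auxP_succ (a : ℕ → ℝ) (N : ℕ) (t : ℝ) :
    auxP a (N + 1) t = auxP a N t - (a N - a (N + 1)) * Real.smoothTransition (t - N) := by
  simp only [auxP, Finset.sum_range_succ]; ring

lemma auxP_eq (a : ℕ → ℝ) {M N : ℕ} (h : M ≤ N) {t : ℝ} (ht : t ≤ M) :
    auxP a N t = auxP a M t := by
  induction N, h using Nat.le_induction with
  | base => rfl
  | succ k hk ih =>
    have : (M : ℝ) ≤ k := by exact_mod_cast hk
    rw [auxP_succ, ih, Real.smoothTransition.zero_of_nonpos (by linarith)]; ring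

lemma auxR_eq (a : ℕ → ℝ) {N : ℕ} {t : ℝ} (ht : t ≤ N) : auxR a t = auxP a N t := by
  have h1 : t ≤ ((⌊t⌋₊ + 1 : ℕ) : ℝ) := by
    push_cast; exact (Nat.lt_floor_add_one t).le
  rcases le_total N (⌊t⌋₊ + 1) with h | h
  · exact auxP_eq a h ht
  · exact (auxP_eq a h h1).symm

lemma auxP_of_ge (a : ℕ → ℝ) (N : ℕ) {t : ℝ} (ht : (N : ℝ) ≤ t) : auxP a N t = a N := by
  induction N with
  | zero => simp [auxP]
  | succ k ih =>
    push_cast at ht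
    rw [auxP_succ, ih (by linarith), Real.smoothTransition.one_of_one_le (by linarith)]; ring

lemma auxR_floor (a : ℕ → ℝ) {t : ℝ} (ht : 0 ≤ t) :
    auxR a t = a ⌊t⌋₊ - (a ⌊t⌋₊ - a (⌊t⌋₊ + 1)) * Real.smoothTransition (t - ⌊t⌋₊) := by
  rw [auxR, auxP_succ, auxP_of_ge a _ (Nat.floor_le ht)]

lemma auxP_contDiff (a : ℕ → ℝ) (N : ℕ) : ContDiff ℝ (⊤ : ℕ∞) (auxP a N) := by
  unfold auxP
  refine contDiff_const.sub (ContDiff.sum fun n _ => contDiff_const.mul ?_)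
  exact Real.smoothTransition.contDiff.comp (contDiff_id.sub contDiff_const)

lemma auxR_eventually (a : ℕ → ℝ) {N : ℕ} {t : ℝ} (ht : t < N) :
    auxR a =ᶠ[nhds t] auxP a N := by
  filter_upwards [Iio_mem_nhds ht] with s hs using auxR_eq a (le_of_lt hs)

lemma auxR_contDiff (a : ℕ → ℝ) : ContDiff ℝ (⊤ : ℕ∞) (auxR a) := by
  rw [contDiff_iff_contDiffAt]
  intro t
  obtain ⟨N, hN⟩ := exists_nat_gt t
  exact (auxP_contDiff a N).contDiffAt.congr_of_eventuallyEq (auxR_eventually a hN)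

lemma auxR_antitone (a : ℕ → ℝ) (ha : Antitone a) : Antitone (auxR a) := by
  intro s t hst
  obtain ⟨N, hN⟩ := exists_nat_gt t
  rw [auxR_eq a hN.le, auxR_eq a (hst.trans hN.le)]
  unfold auxP
  gcongr with n _
  · exact sub_nonneg.2 (ha (Nat.le_succ n))
  · exact Real.smoothTransition.monotone (by linarith)

lemma deriv_st_ge {x : ℝ} (hx : 1 ≤ x) : deriv Real.smoothTransition x = 0 := by
  refine IsLocalMax.deriv_eq_zero (Eventually.of_forall fun y => ?_)
  rw [Real.smoothTransition.one_of_one_le hx]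
  exact Real.smoothTransition.le_one y

lemma deriv_st_le {x : ℝ} (hx : x ≤ 0) : deriv Real.smoothTransition x = 0 := by
  refine IsLocalMin.deriv_eq_zero (Eventually.of_forall fun y => ?_)
  rw [Real.smoothTransition.zero_of_nonpos hx]
  exact Real.smoothTransition.nonneg y

lemma deriv_st_bdd : ∃ K, ∀ x, |deriv Real.smoothTransition x| ≤ K := by
  have hc : Continuous (deriv Real.smoothTransition) :=
    (Real.smoothTransition.contDiff (n := 1)).continuous_deriv le_rfl
  obtain ⟨K, hK⟩ := (isCompact_Icc (a := (0:ℝ)) (b := 1)).exists_bound_of_continuousOn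
    hc.continuousOn
  have hK0 : 0 ≤ K := (norm_nonneg _).trans (hK 0 (by simp))
  refine ⟨K, fun x => ?_⟩
  rcases le_total x 0 with h | h
  · simpa [deriv_st_le h] using hK0
  rcases le_total x 1 with h' | h'
  · exact hK x ⟨h, h'⟩
  · simpa [deriv_st_ge h'] using hK0

lemma auxR_deriv (a : ℕ → ℝ) {t : ℝ} (ht : 0 ≤ t) :
    deriv (auxR a) t =
      - ((a ⌊t⌋₊ - a (⌊t⌋₊ + 1)) * deriv Real.smoothTransition (t - ⌊t⌋₊)) := by
  have h1 : t < ((⌊t⌋₊ + 1 : ℕ) : ℝ) := by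
    push_cast; exact Nat.lt_floor_add_one t
  rw [(auxR_eventually a h1).deriv_eq]
  have hd : ∀ n : ℕ, HasDerivAt (fun t : ℝ => (a n - a (n + 1)) * Real.smoothTransition (t - n))
      ((a n - a (n + 1)) * deriv Real.smoothTransition (t - n)) t := by
    intro n
    have : DifferentiableAt ℝ Real.smoothTransition (t - n) :=
      (Real.smoothTransition.contDiff (n := 1)).differentiable (by simp) _
    exact (this.hasDerivAt.comp_sub_const t n).const_mul _
  have h2 : HasDerivAt (auxP a (⌊t⌋₊ + 1)) (- ∑ n ∈ Finset.range (⌊t⌋₊ + 1),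
      (a n - a (n + 1)) * deriv Real.smoothTransition (t - n)) t := by
    unfold auxP
    exact (HasDerivAt.fun_sum fun n _ => hd n).const_sub _
  rw [h2.deriv, Finset.sum_range_succ, Finset.sum_eq_zero, zero_add]
  intro n hn
  have hn' : ((n + 1 : ℕ) : ℝ) ≤ ⌊t⌋₊ := by exact_mod_cast Finset.mem_range.1 hn
  have := Nat.floor_le ht
  push_cast at hn'
  rw [deriv_st_ge (by linarith), mul_zero]

lemma auxR_pos (a : ℕ → ℝ) (ha : Antitone a) (hp : ∀ n, 0 < a n) (t : ℝ) : 0 < auxR a t := by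
  refine lt_of_lt_of_le ?_ (auxR_antitone a ha (le_max_left t 0))
  rw [auxR_floor a (le_max_right t 0)]
  set M := ⌊max t 0⌋₊
  have h1 := Real.smoothTransition.le_one (max t 0 - M)
  nlinarith [hp (M + 1), ha (Nat.le_succ M)]

lemma auxR_le (a : ℕ → ℝ) (ha : Antitone a) {t : ℝ} (ht : 0 ≤ t) : auxR a t ≤ a ⌊t⌋₊ := by
  rw [auxR_floor a ht]
  have := mul_nonneg (sub_nonneg.2 (ha (Nat.le_succ ⌊t⌋₊)))
    (Real.smoothTransition.nonneg (t - ⌊t⌋₊))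
  simp only [Nat.succ_eq_add_one] at this
  linarith

lemma exists_seq (φ : ℝ → ℝ) (hφ : ContinuousOn φ (Set.Ici 0)) :
    ∃ A : ℕ → ℝ, Monotone A ∧ (∀ n : ℕ, (n : ℝ) + 1 ≤ A n) ∧ ∀ t, 0 ≤ t → φ t ≤ A ⌊t⌋₊ := by
  have hb : ∀ n : ℕ, ∃ C, ∀ x ∈ Icc (n : ℝ) (n + 1), ‖φ x‖ ≤ C := fun n =>
    isCompact_Icc.exists_bound_of_continuousOn
      (hφ.mono fun x hx => le_trans (Nat.cast_nonneg n) hx.1)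
  choose b hb using hb
  refine ⟨fun n => n + 1 + ∑ k ∈ Finset.range (n + 1), |b k|, ?_, ?_, ?_⟩
  · refine monotone_nat_of_le_succ fun n => ?_
    rw [Finset.sum_range_succ _ (n + 1)]
    push_cast
    linarith [abs_nonneg (b (n + 1))]
  · intro n
    have : 0 ≤ ∑ k ∈ Finset.range (n + 1), |b k| := Finset.sum_nonneg fun _ _ => abs_nonneg _
    simpa using this
  · intro t ht
    have h1 := hb ⌊t⌋₊ t ⟨Nat.floor_le ht, (Nat.lt_floor_add_one t).le⟩
    have h2 : 0 ≤ ∑ k ∈ Finset.range ⌊t⌋₊, |b k| := Finset.sum_nonneg fun _ _ => abs_nonneg _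
    have h3 : (0:ℝ) ≤ ⌊t⌋₊ := Nat.cast_nonneg _
    simp only [Finset.sum_range_succ]
    have h4 := le_abs_self (φ t)
    have h5 := le_abs_self (b ⌊t⌋₊)
    rw [Real.norm_eq_abs] at h1
    linarith

/-- For every function `φ` of class `K⁺` there exists a function `φ̃` of class `K*`
such that `φ(t) ≤ φ̃(t)` for all `t ≥ 0`. -/
theorem kplus_le_kstar (φ : ℝ → ℝ) (hφ : IsKPlus φ) :
    ∃ ψ : ℝ → ℝ, IsKStar ψ ∧ ∀ t ≥ (0:ℝ), φ t ≤ ψ t := by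
  obtain ⟨A, hA, hA1, hφA⟩ := exists_seq φ hφ.1
  have hApos : ∀ n, 0 < A n := fun n => by
    have := hA1 n
    have h : (0:ℝ) ≤ n := Nat.cast_nonneg n
    linarith
  set a : ℕ → ℝ := fun n => (A n)⁻¹ with hadef
  have ha : Antitone a := fun m n h => inv_anti₀ (hApos m) (hA h)
  have hp : ∀ n, 0 < a n := fun n => inv_pos.2 (hApos n)
  have hr := auxR_pos a ha hp
  have hq : ContDiff ℝ (⊤ : ℕ∞) (fun t => (auxR a t)⁻¹) :=
    (auxR_contDiff a).inv fun t => (hr t).ne'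
  have hge : ∀ t, 0 ≤ t → A ⌊t⌋₊ ≤ (auxR a t)⁻¹ := fun t ht => by
    rw [le_inv_comm₀ (hApos _) (hr t)]
    exact auxR_le a ha ht
  refine ⟨fun t => (auxR a t)⁻¹, ⟨hq.contDiffOn, ?_, ?_, ?_⟩, fun t ht => (hφA t ht).trans (hge t ht)⟩
  · intro s _ t _ hst
    exact inv_anti₀ (hr t) (auxR_antitone a ha hst)
  · refine le_trans ?_ (hge 0 le_rfl)
    simpa using hA1 0
  · obtain ⟨K, hK⟩ := deriv_st_bdd
    have hlim : Tendsto (fun t : ℝ => (A ⌊t⌋₊)⁻¹ * K) atTop (nhds 0) := by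
      have hAt : Tendsto A atTop atTop :=
        tendsto_atTop_mono (fun n => (by linarith [hA1 n] : (n : ℝ) ≤ A n))
          tendsto_natCast_atTop_atTop
      have := (hAt.comp (tendsto_nat_floor_atTop (α := ℝ))).inv_tendsto_atTop.mul_const K
      simpa using this
    refine squeeze_zero_norm' ?_ hlim
    filter_upwards [eventually_ge_atTop 0] with t ht
    have hdr : DifferentiableAt ℝ (auxR a) t := (auxR_contDiff a).differentiable (by simp) t
    have hd : HasDerivAt (fun t => (auxR a t)⁻¹) (-deriv (auxR a) t / (auxR a t) ^ 2) t :=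
      hdr.hasDerivAt.fun_inv (hr t).ne'
    rw [hd.hasDerivWithinAt.derivWithin (uniqueDiffOn_Ici 0 t ht)]
    have h0 := (hr t).ne'
    have : -deriv (auxR a) t / (auxR a t) ^ 2 / ((auxR a t)⁻¹) ^ 2 = -deriv (auxR a) t := by
      field_simp
    rw [this, auxR_deriv a ht, neg_neg, norm_mul, Real.norm_eq_abs, Real.norm_eq_abs]
    have h1 := ha (Nat.le_succ ⌊t⌋₊)
    simp only [Nat.succ_eq_add_one] at h1
    refine mul_le_mul ?_ (hK _) (abs_nonneg _) (hp _).le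
    rw [abs_of_nonneg (by linarith)]
    show a ⌊t⌋₊ - a (⌊t⌋₊ + 1) ≤ a ⌊t⌋₊
    linarith [hp (⌊t⌋₊ + 1)]
end
end

section
/- Let q be a function of class K* and let α ≥ 0 and γ > 0 be constants. Then the function t ↦ q(t)^α · exp(−γ·∫₀ᵗ q(s)ds) is bounded on [0,∞). -/
open Set Filter

noncomputable section

/-- If `q` is of class `K*`, `α ≥ 0` and `γ > 0`, then the function
`t ↦ q(t)^α · exp(−γ·∫₀ᵗ q(s) ds)` is bounded on `[0,∞)`. -/
theorem kstar_pow_exp_bounded (q : ℝ → ℝ) (hq : IsKStar q) (α γ : ℝ)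
    (hα : 0 ≤ α) (hγ : 0 < γ) :
    ∃ K : ℝ, ∀ t ≥ (0:ℝ),
      q t ^ α * Real.exp (-γ * ∫ s in (0:ℝ)..t, q s) ≤ K := by
  obtain ⟨hc, hm, h1, hl⟩ := hq
  have hcont : ContinuousOn q (Set.Ici 0) := hc.continuousOn
  have hq1 : ∀ t, 0 ≤ t → 1 ≤ q t := fun t ht =>
    h1.trans (hm (Set.mem_Ici.2 le_rfl) (Set.mem_Ici.2 ht) ht)
  have hint : ∀ t, 0 ≤ t → 0 ≤ ∫ s in (0:ℝ)..t, q s := fun t ht =>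
    intervalIntegral.integral_nonneg ht (fun s hs => by linarith [hq1 s hs.1])
  have hl' := hl.const_mul α
  rw [mul_zero] at hl'
  obtain ⟨T₀, hT₀⟩ := Filter.eventually_atTop.1 (hl'.eventually (gt_mem_nhds hγ))
  obtain ⟨T, hT, hT1⟩ : ∃ T, T₀ ≤ T ∧ 1 ≤ T := ⟨max T₀ 1, le_max_left _ _, le_max_right _ _⟩
  have hder : ∀ t, T ≤ t → HasDerivAt
      (fun t => α * Real.log (q t) - γ * ∫ s in (0:ℝ)..t, q s)
      (α * (derivWithin q (Set.Ici 0) t / q t) - γ * q t) t := by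
    intro t ht
    have ht0 : 0 < t := by linarith
    have hn : Set.Ici (0:ℝ) ∈ nhds t := Ici_mem_nhds ht0
    have hd : HasDerivAt q (derivWithin q (Set.Ici 0) t) t :=
      ((hc.differentiableOn (by simp)) t ht0.le).hasDerivWithinAt.hasDerivAt hn
    have hI : HasDerivAt (fun u => ∫ s in (0:ℝ)..u, q s) (q t) t := by
      apply intervalIntegral.integral_hasDerivAt_right
      · apply ContinuousOn.intervalIntegrable
        apply hcont.mono
        rw [Set.uIcc_of_le ht0.le]
        exact fun x hx => hx.1
      · exact ⟨Set.Ici 0, hn, hcont.aestronglyMeasurable measurableSet_Ici⟩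
      · exact hd.continuousAt
    have hne : q t ≠ 0 := by linarith [hq1 t ht0.le]
    exact ((hd.log hne).const_mul α).sub (hI.const_mul γ)
  have hanti : AntitoneOn (fun t => α * Real.log (q t) - γ * ∫ s in (0:ℝ)..t, q s)
      (Set.Ici T) := by
    apply antitoneOn_of_deriv_nonpos (convex_Ici T)
    · exact fun t ht => (hder t ht).continuousAt.continuousWithinAt
    · intro t ht
      exact (hder t (interior_subset ht)).differentiableAt.differentiableWithinAt
    · intro t ht
      have ht' : T ≤ t := interior_subset ht
      rw [(hder t ht').deriv]
      have h2 := hT₀ t (hT.trans ht')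
      have hp : 0 < q t := by linarith [hq1 t (by linarith)]
      have h3 : α * (derivWithin q (Set.Ici 0) t / q t) - γ * q t
          = q t * (α * (derivWithin q (Set.Ici 0) t / q t ^ 2) - γ) := by
        field_simp
      rw [h3]
      exact mul_nonpos_of_nonneg_of_nonpos hp.le (by linarith)
  have heq : ∀ t, 0 ≤ t → q t ^ α * Real.exp (-γ * ∫ s in (0:ℝ)..t, q s)
      = Real.exp (α * Real.log (q t) - γ * ∫ s in (0:ℝ)..t, q s) := by
    intro t ht
    rw [Real.rpow_def_of_pos (by linarith [hq1 t ht]), ← Real.exp_add]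
    congr 1
    ring
  have hT0 : 0 ≤ T := by linarith
  refine ⟨Real.exp (α * Real.log (q T)), fun t ht => ?_⟩
  rw [heq t ht, Real.exp_le_exp]
  rcases le_total T t with h | h
  · have h4 := hanti (Set.mem_Ici.2 le_rfl) (Set.mem_Ici.2 h) h
    simp only at h4
    have := mul_nonneg hγ.le (hint T hT0)
    linarith
  · have h5 := Real.log_le_log (by linarith [hq1 t ht]) (hm (Set.mem_Ici.2 ht) (Set.mem_Ici.2 hT0) h)
    have h6 := mul_le_mul_of_nonneg_left h5 hα
    have := mul_nonneg hγ.le (hint t ht)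
    linarith
end
end

section
/- Let q be a function of class K* and let b ≥ 0 and c > 0 be constants. Then the function g(t) := ∫₀ᵗ (q(t)/q(τ))^b · exp(−c·∫_τ^t q(s)ds) · (q̇(τ)/q(τ)) dτ is bounded on [0,∞): there exists G > 0 with g(t) ≤ G for all t ≥ 0. -/
open Set Filter

noncomputable section

/-- If `q` is of class `K*` and `b ≥ 0`, `c > 0`, then
`g(t) := ∫₀ᵗ (q(t)/q(τ))^b · exp(−c·∫_τ^t q(s) ds) · (q̇(τ)/q(τ)) dτ`
is bounded on `[0,∞)`. -/
theorem kstar_integral_bounded (q : ℝ → ℝ) (hq : IsKStar q) (b c : ℝ)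
    (hb : 0 ≤ b) (hc : 0 < c) :
    ∃ G > (0:ℝ), ∀ t ≥ (0:ℝ),
      (∫ τ in (0:ℝ)..t, (q t / q τ) ^ b * Real.exp (-c * ∫ s in τ..t, q s) *
        (derivWithin q (Set.Ici 0) τ / q τ)) ≤ G := by
  obtain ⟨hsm, hmono, h0, hlim⟩ := hq
  have hq1 : ∀ t, 0 ≤ t → 1 ≤ q t := fun t ht =>
    h0.trans (hmono (by simp) (by simpa using ht) ht)
  set d : ℝ → ℝ := derivWithin q (Set.Ici 0) with hd
  have hdc : ContinuousOn d (Set.Ici 0) :=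
    hsm.continuousOn_derivWithin (uniqueDiffOn_Ici 0) (by exact_mod_cast le_top)
  have hqc : ContinuousOn q (Set.Ici 0) := hsm.continuousOn
  have hqd : ∀ x, 0 < x → HasDerivAt q (d x) x := by
    intro x hx
    have h1 : DifferentiableWithinAt ℝ q (Set.Ici 0) x :=
      (hsm.differentiableOn (by simp)) x (by simpa using hx.le)
    exact h1.hasDerivWithinAt.hasDerivAt (Ici_mem_nhds hx)
  -- continuous extension and primitive
  set p : ℝ → ℝ := fun s => q (max s 0) with hp
  have hpc : Continuous p := by
    apply hqc.comp_continuous (by fun_prop)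
    intro x; simp
  have hpq : ∀ s, 0 ≤ s → p s = q s := fun s hs => by simp [hp, hs]
  set Q : ℝ → ℝ := fun t => ∫ s in (0:ℝ)..t, p s with hQ
  have hQd : ∀ x, HasDerivAt Q (p x) x := fun x => hpc.integral_hasStrictDerivAt 0 x |>.hasDerivAt
  have hQi : ∀ τ t, 0 ≤ τ → τ ≤ t → ∫ s in τ..t, q s = Q t - Q τ := by
    intro τ t h1 h2
    rw [hQ]
    simp only
    rw [intervalIntegral.integral_interval_sub_left (hpc.intervalIntegrable _ _)
      (hpc.intervalIntegrable _ _)]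
    apply intervalIntegral.integral_congr
    intro s hs
    rw [uIcc_of_le h2] at hs
    exact (hpq s (h1.trans hs.1)).symm
  have hQm : ∀ τ t, 0 ≤ τ → τ ≤ t → 0 ≤ Q t - Q τ := by
    intro τ t h1 h2
    rw [← hQi τ t h1 h2]
    apply intervalIntegral.integral_nonneg h2
    intro u hu
    linarith [hq1 u (h1.trans hu.1)]
  set ε : ℝ := c / (2 * (b + 1)) with hε
  have hεp : 0 < ε := by positivity
  have hbε : b * ε ≤ c / 2 := by
    have : (b + 1) * ε = c / 2 := by rw [hε]; field_simp
    linarith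
  obtain ⟨T, hT0, hT⟩ : ∃ T, 0 ≤ T ∧ ∀ t, T ≤ t → d t / (q t) ^ 2 ≤ ε := by
    obtain ⟨T, hT⟩ := (hlim.eventually (gt_mem_nhds hεp)).exists_forall_of_atTop
    exact ⟨max T 0, le_max_right _ _, fun t ht => (hT t ((le_max_left _ _).trans ht)).le⟩
  obtain ⟨M, hM0, hM⟩ : ∃ M, 0 < M ∧ ∀ t, 0 ≤ t → d t / (q t) ^ 2 ≤ M := by
    have hcont : ContinuousOn (fun t => d t / (q t) ^ 2) (Icc 0 T) := by
      apply ContinuousOn.div (hdc.mono Icc_subset_Ici_self)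
        ((hqc.mono Icc_subset_Ici_self).pow 2)
      intro x hx
      have := hq1 x hx.1
      exact pow_ne_zero 2 (by linarith)
    obtain ⟨K, hK⟩ := isCompact_Icc.bddAbove_image hcont
    refine ⟨max K ε, lt_max_of_lt_right hεp, fun t ht => ?_⟩
    rcases le_total t T with h | h
    · exact (hK ⟨t, ⟨ht, h⟩, rfl⟩).trans (le_max_left _ _)
    · exact (hT t h).trans (le_max_right _ _)
  have hanti : AntitoneOn (fun t => Real.log (q t) - ε * Q t) (Ici T) := by
    apply antitoneOn_of_hasDerivWithinAt_nonpos (convex_Ici T)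
      (f' := fun t => d t / q t - ε * p t)
    · apply ContinuousOn.sub
      · apply ContinuousOn.log (hqc.mono (Ici_subset_Ici.2 hT0))
        intro x hx
        have := hq1 x (hT0.trans hx)
        positivity
      · exact fun x _ => ((hQd x).continuousAt.continuousWithinAt).const_mul ε
    · intro x hx
      rw [interior_Ici] at hx
      have hx0 : 0 < x := hT0.trans_lt hx
      have := hq1 x hx0.le
      exact (((hqd x hx0).log (by positivity)).sub ((hQd x).const_mul ε)).hasDerivWithinAt
    · intro x hx
      rw [interior_Ici] at hx
      have hx0 : 0 < x := hT0.trans_lt hx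
      have h1 := hq1 x hx0.le
      have h2 := hT x (le_of_lt hx)
      have h3 : 0 < q x := by linarith
      rw [hpq x hx0.le, sub_nonpos, div_le_iff₀ h3]
      rw [div_le_iff₀ (by positivity)] at h2
      nlinarith
  set L : ℝ := Real.log (q T) - Real.log (q 0) with hL
  have hlm : ∀ s t, 0 ≤ s → s ≤ t → Real.log (q s) ≤ Real.log (q t) := by
    intro s t hs hst
    have := hq1 s hs
    exact Real.log_le_log (by linarith) (hmono hs (hs.trans hst) hst)
  have hlog : ∀ τ t, 0 ≤ τ → τ ≤ t →
      Real.log (q t) - Real.log (q τ) ≤ ε * (Q t - Q τ) + L := by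
    intro τ t h1 h2
    have a0 := hlm 0 T le_rfl hT0
    rcases le_total T τ with h | h
    · have := hanti h (h.trans h2) h2
      simp only at this
      linarith
    · have a1 := hlm 0 τ le_rfl h1
      rcases le_total T t with h' | h'
      · have := hanti (le_refl T) h' h'
        simp only at this
        have := mul_nonneg hεp.le (hQm τ T h1 h)
        linarith
      · have := mul_nonneg hεp.le (hQm τ t h1 h2)
        have := hlm t T (h1.trans h2) h'
        linarith
  set C : ℝ := Real.exp (b * L) with hC
  have hCp : 0 < C := Real.exp_pos _
  refine ⟨C * M * (2 / c), by positivity, fun t ht => ?_⟩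
  have hFTC : ∫ τ in (0:ℝ)..t, C * M * (p τ * Real.exp (-(c/2) * (Q t - Q τ)))
      = C * M * (2 / c) * (1 - Real.exp (-(c/2) * (Q t - Q 0))) := by
    have hQc : Continuous Q := continuous_iff_continuousAt.2 fun x => (hQd x).continuousAt
    rw [intervalIntegral.integral_eq_sub_of_hasDerivAt
      (f := fun τ => C * M * (2 / c) * Real.exp (-(c/2) * (Q t - Q τ)))]
    · simp; ring
    · intro x _
      have := ((((hQd x).const_sub (Q t)).const_mul (-(c/2))).exp).const_mul (C * M * (2 / c))
      refine this.congr_deriv ?_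
      have hcc : 2 / c * (c / 2) = 1 := by field_simp
      linear_combination (C * M * p x * Real.exp (-(c/2) * (Q t - Q x))) * hcc
    · apply Continuous.intervalIntegrable
      fun_prop
  have hle : C * M * (2 / c) * (1 - Real.exp (-(c/2) * (Q t - Q 0))) ≤ C * M * (2 / c) := by
    have := Real.exp_pos (-(c/2) * (Q t - Q 0))
    have h2 : 0 < C * M * (2 / c) := by positivity
    nlinarith
  by_cases hint : IntervalIntegrable (fun τ => (q t / q τ) ^ b *
      Real.exp (-c * ∫ s in τ..t, q s) * (d τ / q τ)) MeasureTheory.volume 0 t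
  swap
  · rw [intervalIntegral.integral_undef hint]; positivity
  refine le_trans ?_ (hFTC.le.trans hle)
  apply intervalIntegral.integral_mono_on ht hint
  · apply Continuous.intervalIntegrable
    have hQc : Continuous Q := continuous_iff_continuousAt.2 fun x => (hQd x).continuousAt
    fun_prop
  intro τ hτ
  have g1 : 0 < q t := by linarith [hq1 t ht]
  have g2 : 0 < q τ := by linarith [hq1 τ hτ.1]
  have hD := hQm τ t hτ.1 hτ.2
  rw [hQi τ t hτ.1 hτ.2, hpq τ hτ.1]
  have e1 : (q t / q τ) ^ b * Real.exp (-c * (Q t - Q τ)) ≤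
      C * Real.exp (-(c/2) * (Q t - Q τ)) := by
    rw [Real.rpow_def_of_pos (by positivity), Real.log_div g1.ne' g2.ne', hC,
      ← Real.exp_add, ← Real.exp_add]
    apply Real.exp_le_exp.2
    have k1 := mul_le_mul_of_nonneg_left (hlog τ t hτ.1 hτ.2) hb
    have k2 := mul_le_mul_of_nonneg_right hbε hD
    linarith
  have e2 : d τ / q τ ≤ M * q τ := by
    have := hM τ hτ.1
    rw [div_le_iff₀ (by positivity)] at this
    rw [div_le_iff₀ g2]
    linarith
  calc _ ≤ (q t / q τ) ^ b * Real.exp (-c * (Q t - Q τ)) * (M * q τ) := by gcongr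
    _ ≤ C * Real.exp (-(c/2) * (Q t - Q τ)) * (M * q τ) := by gcongr
    _ = _ := by ring
end
end

section
/- Consider the planar system ẋ₁ = x₁ + x₂³, ẋ₂ = −x₁x₂² + d(t)x₂ with output y = x₁, where d: [0,∞)→[−1,1] is measurable, coupled with the estimator ż₁ = y(t) + z₂ − 12R·exp(10t)·(z₁ − y(t)), ż₂ = −72R²·exp(20t)·(z₁ − y(t)), and reconstruction x̄ = Ψ(t,y,z₂) with Ψ(t,y,z) := (y, sgn(z)·|z|^{1/3}). Then there exist a constant R > 0, a function ρ of class K⁺ and a constant M > 0 such that for every t₀ ≥ 0, every initial condition (x(t₀),z(t₀)) ∈ ℝ²×ℝ² and every measurable d with values in [−1,1], the solution of the coupled system satisfies |x(t) − Ψ(t,y(t),z₂(t))| ≤ exp(−(t−t₀)) · 2·(ρ(t₀)·|z(t₀) − (x₁(t₀), x₂(t₀)³)| + M·(|x(t₀)| + |x(t₀)|³ + |x(t₀)|⁵))^{1/3} for all t ≥ t₀; in particular the coupled system is an estimator for the original system that guarantees exponential convergence of the state estimate. -/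
open Set Filter MeasureTheory

noncomputable section

/-- A (locally absolutely continuous) solution of the planar system
`ẋ₁ = x₁ + x₂³`, `ẋ₂ = −x₁x₂² + d(t)x₂` (output `y = x₁`) coupled with the estimator
`ż₁ = y + z₂ − 12R·e^{10t}(z₁ − y)`, `ż₂ = −72R²·e^{20t}(z₁ − y)`,
encoded via the equivalent integral equations. -/
def EstSol (R : ℝ) (d : ℝ → ℝ) (t₀ : ℝ) (x₁ x₂ z₁ z₂ : ℝ → ℝ) : Prop :=
  ContinuousOn x₁ (Set.Ici t₀) ∧ ContinuousOn x₂ (Set.Ici t₀) ∧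
  ContinuousOn z₁ (Set.Ici t₀) ∧ ContinuousOn z₂ (Set.Ici t₀) ∧
  (∀ t ∈ Set.Ici t₀, x₁ t = x₁ t₀ + ∫ s in t₀..t, (x₁ s + (x₂ s) ^ 3)) ∧
  (∀ t ∈ Set.Ici t₀, x₂ t = x₂ t₀ + ∫ s in t₀..t, (-(x₁ s) * (x₂ s) ^ 2 + d s * x₂ s)) ∧
  (∀ t ∈ Set.Ici t₀, z₁ t = z₁ t₀ + ∫ s in t₀..t,
    (x₁ s + z₂ s - 12 * R * Real.exp (10 * s) * (z₁ s - x₁ s))) ∧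
  (∀ t ∈ Set.Ici t₀, z₂ t = z₂ t₀ + ∫ s in t₀..t,
    (-(72 * R ^ 2 * Real.exp (20 * s) * (z₁ s - x₁ s))))


/-! ### Absolutely continuous functions with a prescribed a.e. derivative -/

/-- `f` is absolutely continuous on `[a,b]` with a.e. derivative `g`. -/
def ACD (f g : ℝ → ℝ) (a b : ℝ) : Prop :=
  AbsolutelyContinuousOnInterval f a b ∧ ∀ᵐ t, t ∈ Ioo a b → HasDerivAt f (g t) t

theorem acd_of_integral {f g : ℝ → ℝ} {a b : ℝ} (hab : a ≤ b)
    (hg : IntervalIntegrable g volume a b)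
    (hf : ∀ t ∈ Icc a b, f t = f a + ∫ s in a..t, g s) : ACD f g a b := by
  have h1 := hg.absolutelyContinuousOnInterval_intervalIntegral (c := a) (by simp)
  constructor
  · rw [absolutelyContinuousOnInterval_iff] at h1 ⊢
    intro ε hε
    obtain ⟨δ, hδ, h⟩ := h1 ε hε
    refine ⟨δ, hδ, fun E hE hs => ?_⟩
    have := h E hE hs
    convert this using 1
    refine Finset.sum_congr rfl fun i hi => ?_
    have h2 := hE.1 i hi
    rw [uIcc_of_le hab] at h2
    rw [hf _ h2.1, hf _ h2.2, dist_add_left]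
  · filter_upwards [hg.ae_hasDerivAt_integral] with t ht hmem
    rw [uIcc_of_le hab] at ht
    have h2 := (ht (Ioo_subset_Icc_self hmem) a (by simp [hab])).const_add (f a)
    refine h2.congr_of_eventuallyEq ?_
    filter_upwards [Ioo_mem_nhds hmem.1 hmem.2] with s hs
    exact hf s (Ioo_subset_Icc_self hs)

theorem acd_of_deriv {f g : ℝ → ℝ} (a b : ℝ) (hf : ContDiff ℝ 1 f)
    (h : ∀ t, HasDerivAt f (g t) t) : ACD f g a b :=
  ⟨hf.contDiffOn.absolutelyContinuousOnInterval, by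
    filter_upwards with t _ using h t⟩

theorem ACD.mul {f g f' g' : ℝ → ℝ} {a b : ℝ} (hf : ACD f f' a b) (hg : ACD g g' a b) :
    ACD (fun t => f t * g t) (fun t => f' t * g t + f t * g' t) a b :=
  ⟨hf.1.fun_mul hg.1, by
    filter_upwards [hf.2, hg.2] with t h1 h2 ht using (h1 ht).mul (h2 ht)⟩

theorem ACD.add {f g f' g' : ℝ → ℝ} {a b : ℝ} (hf : ACD f f' a b) (hg : ACD g g' a b) :
    ACD (fun t => f t + g t) (fun t => f' t + g' t) a b :=
  ⟨hf.1.fun_add hg.1, by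
    filter_upwards [hf.2, hg.2] with t h1 h2 ht using (h1 ht).add (h2 ht)⟩

theorem ACD.sub {f g f' g' : ℝ → ℝ} {a b : ℝ} (hf : ACD f f' a b) (hg : ACD g g' a b) :
    ACD (fun t => f t - g t) (fun t => f' t - g' t) a b :=
  ⟨hf.1.fun_sub hg.1, by
    filter_upwards [hf.2, hg.2] with t h1 h2 ht using (h1 ht).sub (h2 ht)⟩

/-- Composition with `exp`. -/
theorem ACD.exp {f f' : ℝ → ℝ} {a b : ℝ} (hf : ACD f f' a b) :
    ACD (fun t => Real.exp (f t)) (fun t => Real.exp (f t) * f' t) a b := by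
  refine ⟨?_, by filter_upwards [hf.2] with t h1 ht using (h1 ht).exp⟩
  obtain ⟨C, hC⟩ := hf.1.exists_bound
  have hK : ∃ K, LipschitzOnWith K Real.exp (Icc (-C) C) :=
    (Real.contDiff_exp (n := 1)).contDiffOn.exists_lipschitzOnWith (by simp) (convex_Icc _ _)
      isCompact_Icc
  obtain ⟨K, hK⟩ := hK
  have h1 := hf.1
  rw [absolutelyContinuousOnInterval_iff] at h1 ⊢
  intro ε hε
  obtain ⟨δ, hδ, h⟩ := h1 (ε / (K + 1)) (by positivity)
  refine ⟨δ, hδ, fun E hE hs => ?_⟩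
  have h3 := h E hE hs
  calc _ ≤ ∑ i ∈ Finset.range E.1, (K + 1 : ℝ) * dist (f (E.2 i).1) (f (E.2 i).2) := by
        refine Finset.sum_le_sum fun i hi => ?_
        have h2 := hE.1 i hi
        have := hK.dist_le_mul (f (E.2 i).1) (abs_le.1 (hC _ h2.1)) (f (E.2 i).2)
          (abs_le.1 (hC _ h2.2))
        refine this.trans ?_
        gcongr
        linarith
    _ = (K + 1 : ℝ) * ∑ i ∈ Finset.range E.1, dist (f (E.2 i).1) (f (E.2 i).2) := by
        rw [Finset.mul_sum]
    _ < (K + 1 : ℝ) * (ε / (K + 1)) := by gcongr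
    _ = ε := by field_simp

theorem ACD.eq_integral {f g : ℝ → ℝ} {a b : ℝ} (hab : a ≤ b) (hf : ACD f g a b) :
    f b = f a + ∫ s in a..b, g s := by
  have h := hf.1.integral_deriv_eq_sub
  have : ∫ s in a..b, g s = ∫ s in a..b, deriv f s := by
    apply intervalIntegral.integral_congr_ae
    have hb : ∀ᵐ x : ℝ, x ≠ b := by simp [ae_iff, measure_singleton]
    filter_upwards [hf.2, hb] with t ht hne hm
    rw [uIoc_of_le hab] at hm
    exact ((ht ⟨hm.1, lt_of_le_of_ne hm.2 hne⟩).deriv).symm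
  rw [this, h]; ring

theorem ACD.le {f g : ℝ → ℝ} {a b : ℝ} (hab : a ≤ b) (hf : ACD f g a b)
    (hg : ∀ t ∈ Ioo a b, g t ≤ 0) : f b ≤ f a := by
  rw [hf.eq_integral hab]
  have : ∫ s in a..b, g s ≤ 0 := by
    rw [intervalIntegral.integral_of_le hab, integral_Ioc_eq_integral_Ioo]
    exact setIntegral_nonpos measurableSet_Ioo hg
  linarith

theorem ACD.congr {f g g' : ℝ → ℝ} {a b : ℝ} (hf : ACD f g a b)
    (h : ∀ t ∈ Ioo a b, g t = g' t) : ACD f g' a b :=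
  ⟨hf.1, by filter_upwards [hf.2] with t h1 ht using h t ht ▸ h1 ht⟩

/-! ### Global existence for globally Lipschitz fields -/

/-- Radial retraction on the ball of radius `N`. -/
def ret {E : Type*} [NormedAddCommGroup E] [NormedSpace ℝ E] (N : ℝ) (u : E) : E :=
  (N / max N ‖u‖) • u

section
variable {E : Type*} [NormedAddCommGroup E] [NormedSpace ℝ E]

theorem ret_norm_le {N : ℝ} (hN : 0 < N) (u : E) : ‖ret N u‖ ≤ N := by
  have hm : 0 < max N ‖u‖ := lt_max_of_lt_left hN
  rw [ret, norm_smul, Real.norm_of_nonneg (by positivity), div_mul_eq_mul_div, div_le_iff₀ hm]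
  gcongr
  exact le_max_right _ _

theorem ret_norm_le_norm {N : ℝ} (hN : 0 < N) (u : E) : ‖ret N u‖ ≤ ‖u‖ := by
  have hm : 0 < max N ‖u‖ := lt_max_of_lt_left hN
  rw [ret, norm_smul, Real.norm_of_nonneg (by positivity)]
  exact mul_le_of_le_one_left (norm_nonneg _) ((div_le_one hm).2 (le_max_left _ _))

theorem ret_eq {N : ℝ} (hN : 0 < N) {u : E} (h : ‖u‖ ≤ N) : ret N u = u := by
  rw [ret, max_eq_left h, div_self hN.ne', one_smul]

theorem ret_lipschitz {N : ℝ} (hN : 0 < N) : LipschitzWith 2 (ret N : E → E) := by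
  refine LipschitzWith.of_dist_le_mul fun u v => ?_
  rw [dist_eq_norm, dist_eq_norm]
  have ha : 0 < max N ‖u‖ := lt_max_of_lt_left hN
  have hb : 0 < max N ‖v‖ := lt_max_of_lt_left hN
  have hab : |max N ‖v‖ - max N ‖u‖| ≤ ‖u - v‖ := by
    rw [max_comm N, max_comm N]
    refine (abs_max_sub_max_le_abs _ _ _).trans ?_
    rw [abs_sub_comm]
    exact abs_norm_sub_norm_le u v
  have haN : N ≤ max N ‖u‖ := le_max_left _ _
  have hbv : ‖v‖ ≤ max N ‖v‖ := le_max_right _ _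
  simp only [ret]
  set a := max N ‖u‖
  set b := max N ‖v‖
  have e : (N / a) • u - (N / b) • v = (N / a) • (u - v) + ((N / a) * ((b - a) / b)) • v := by
    have : (N / a) * ((b - a) / b) = N / a - N / b := by field_simp
    rw [this]; module
  have h1 : N / a ≤ 1 := (div_le_one ha).2 haN
  have h0 : 0 ≤ N / a := by positivity
  rw [e]
  refine (norm_add_le _ _).trans ?_
  rw [norm_smul, norm_smul, Real.norm_of_nonneg h0, norm_mul, Real.norm_of_nonneg h0, norm_div,
    Real.norm_of_nonneg hb.le, Real.norm_eq_abs]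
  have h2 : |b - a| / b * ‖v‖ ≤ ‖u - v‖ := by
    rw [div_mul_eq_mul_div, div_le_iff₀ hb]
    exact mul_le_mul hab hbv (norm_nonneg _) (norm_nonneg _)
  have h3 : N / a * ‖u - v‖ ≤ ‖u - v‖ := mul_le_of_le_one_left (norm_nonneg _) h1
  have h4 : N / a * (|b - a| / b * ‖v‖) ≤ |b - a| / b * ‖v‖ :=
    mul_le_of_le_one_left (by positivity) h1
  push_cast
  nlinarith

variable [CompleteSpace E]

theorem exists_sol_Icc (f : ℝ → E → E) (t₀ T : ℝ) (hT : t₀ ≤ T) (u₀ : E) (K : NNReal)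
    (hL : ∀ t ∈ Icc t₀ T, LipschitzWith K (f t))
    (hc : ∀ x, ContinuousOn (fun t => f t x) (Icc t₀ T)) :
    ∃ u : ℝ → E, u t₀ = u₀ ∧
      ∀ t ∈ Icc t₀ T, HasDerivWithinAt u (f t (u t)) (Icc t₀ T) t := by
  obtain ⟨C, hC⟩ := isCompact_Icc.exists_bound_of_continuousOn (hc 0)
  have hC0 : 0 ≤ C := (norm_nonneg _).trans (hC t₀ ⟨le_rfl, hT⟩)
  have hbd : ∀ t ∈ Icc t₀ T, ∀ x, ‖f t x‖ ≤ K * ‖x‖ + C := by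
    intro t ht x
    have h1 := (hL t ht).dist_le_mul x 0
    rw [dist_eq_norm, dist_eq_norm, sub_zero] at h1
    have h2 := norm_le_norm_add_norm_sub' (f t x) (f t 0)
    linarith [hC t ht]
  set N : ℝ := gronwallBound ‖u₀‖ K C (T - t₀) + 1 with hN
  have hg : ∀ s ∈ Icc t₀ T, gronwallBound ‖u₀‖ K C (s - t₀) ≤ N := by
    intro s hs
    have := gronwallBound_mono (norm_nonneg u₀) hC0 K.coe_nonneg (show s - t₀ ≤ T - t₀ by linarith [hs.2])
    have := this
    linarith
  have hN0 : 0 < N := by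
    have := hg t₀ ⟨le_rfl, hT⟩
    have h2 := gronwallBound_mono (norm_nonneg u₀) hC0 K.coe_nonneg (show 0 ≤ T - t₀ by linarith)
    rw [gronwallBound_x0] at h2
    have := norm_nonneg u₀
    linarith
  let L : NNReal := ⟨K * N + C, by positivity⟩
  let a : NNReal := ⟨(K * N + C) * (T - t₀), mul_nonneg (by positivity) (by linarith)⟩
  have hP : IsPicardLindelof (fun t x => f t (ret N x)) (tmin := t₀) (tmax := T)
      ⟨t₀, le_rfl, hT⟩ u₀ a 0 L (K * 2) := by
    refine ⟨fun t ht => ((hL t ht).comp (ret_lipschitz hN0)).lipschitzOnWith,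
      fun x _ => hc (ret N x), fun t ht x _ => ?_, ?_⟩
    · refine (hbd t ht _).trans ?_
      change _ ≤ K * N + C
      gcongr
      exact ret_norm_le hN0 x
    · simp only [sub_self, NNReal.coe_zero, sub_zero]
      rw [max_eq_left (by linarith)]
      exact le_rfl
  obtain ⟨u, hu0, hu⟩ := hP.exists_eq_forall_mem_Icc_hasDerivWithinAt₀
  refine ⟨u, hu0, fun t ht => ?_⟩
  have hb := norm_le_gronwallBound_of_norm_deriv_right_le (f := u)
    (f' := fun t => f t (ret N (u t))) (δ := ‖u₀‖) (K := K) (ε := C) (a := t₀) (b := T)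
    (fun t ht => (hu t ht).continuousWithinAt)
    (fun t ht => (hu t (Ico_subset_Icc_self ht)).mono_of_mem_nhdsWithin
      (Icc_mem_nhdsGE_of_mem ht))
    (by simp only at hu0; rw [hu0])
    (fun t ht => (hbd t (Ico_subset_Icc_self ht) _).trans (by
      gcongr; exact ret_norm_le_norm hN0 _)) t ht
  have := hu t ht
  rwa [ret_eq hN0 (hb.trans (hg t ht))] at this

theorem exists_sol_Ici (f : ℝ → E → E) (t₀ : ℝ) (u₀ : E)
    (hL : ∀ T, ∃ K : NNReal, ∀ t ∈ Icc t₀ T, LipschitzWith K (f t))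
    (hc : ∀ x, ContinuousOn (fun t => f t x) (Ici t₀)) :
    ∃ u : ℝ → E, u t₀ = u₀ ∧ ∀ t ∈ Ici t₀, HasDerivWithinAt u (f t (u t)) (Ici t₀) t := by
  have hex : ∀ n : ℕ, ∃ u : ℝ → E, u t₀ = u₀ ∧
      ∀ t ∈ Icc t₀ (t₀ + n), HasDerivWithinAt u (f t (u t)) (Icc t₀ (t₀ + n)) t := by
    intro n
    obtain ⟨K, hK⟩ := hL (t₀ + n)
    exact exists_sol_Icc f t₀ (t₀ + n) (by simp) u₀ K hK
      (fun x => (hc x).mono Icc_subset_Ici_self)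
  choose v hv0 hv using hex
  have huniq : ∀ m n : ℕ, m ≤ n → EqOn (v m) (v n) (Icc t₀ (t₀ + m)) := by
    intro m n hmn
    have hmn' : (m : ℝ) ≤ n := by exact_mod_cast hmn
    obtain ⟨K, hK⟩ := hL (t₀ + m)
    refine ODE_solution_unique_of_mem_Icc_right (v := f) (s := fun _ => univ) (K := K)
      (fun t ht => (hK t (Ico_subset_Icc_self ht)).lipschitzOnWith)
      (fun t ht => (hv m t ht).continuousWithinAt)
      (fun t ht => (hv m t (Ico_subset_Icc_self ht)).mono_of_mem_nhdsWithin
        (Icc_mem_nhdsGE_of_mem ht))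
      (fun _ _ => trivial)
      (fun t ht => ((hv n t ⟨ht.1, by linarith [ht.2]⟩).continuousWithinAt).mono
        (Icc_subset_Icc_right (by linarith)))
      (fun t ht => (hv n t ⟨ht.1, by linarith [ht.2]⟩).mono_of_mem_nhdsWithin
        (Icc_mem_nhdsGE_of_mem ⟨ht.1, by linarith [ht.2]⟩))
      (fun _ _ => trivial) (by rw [hv0, hv0])
  let u : ℝ → E := fun t => v ⌈t - t₀⌉₊ t
  have hu : ∀ n : ℕ, EqOn u (v n) (Icc t₀ (t₀ + n)) := by
    intro n t ht
    refine huniq _ n (Nat.ceil_le.2 (by linarith [ht.2])) ⟨ht.1, ?_⟩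
    linarith [Nat.le_ceil (t - t₀)]
  refine ⟨u, by simp [u, hv0], fun t ht => ?_⟩
  obtain ⟨n, hn⟩ := exists_nat_gt (t - t₀)
  have htn : t ∈ Icc t₀ (t₀ + n) := ⟨ht, by linarith⟩
  have h1 := (hv n t htn).congr (fun s hs => hu n hs) (hu n htn)
  rw [← hu n htn] at h1
  refine h1.mono_of_mem_nhdsWithin ?_
  rw [← Ici_inter_Iic]
  exact inter_mem self_mem_nhdsWithin (mem_nhdsWithin_of_mem_nhds (Iic_mem_nhds (by linarith)))

end

theorem hdw_fst {u : ℝ → ℝ × ℝ} {u' : ℝ × ℝ} {s : Set ℝ} {t : ℝ}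
    (h : HasDerivWithinAt u u' s t) : HasDerivWithinAt (fun t => (u t).1) u'.1 s t := by
  simpa using h.hasFDerivWithinAt.fst.hasDerivWithinAt

theorem hdw_snd {u : ℝ → ℝ × ℝ} {u' : ℝ × ℝ} {s : Set ℝ} {t : ℝ}
    (h : HasDerivWithinAt u u' s t) : HasDerivWithinAt (fun t => (u t).2) u'.2 s t := by
  simpa using h.hasFDerivWithinAt.snd.hasDerivWithinAt

theorem acd_of_hasDerivWithinAt {v g : ℝ → ℝ} {t₀ : ℝ}
    (hv : ∀ t ∈ Ici t₀, HasDerivWithinAt v (g t) (Ici t₀) t) (hg : ContinuousOn g (Ici t₀))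
    (T : ℝ) (hT : t₀ ≤ T) : ACD v g t₀ T := by
  have hi : ∀ t ∈ Ici t₀, IntervalIntegrable g volume t₀ t := fun t ht =>
    (hg.mono (by rw [uIcc_of_le ht]; exact Icc_subset_Ici_self)).intervalIntegrable
  refine acd_of_integral hT (hi T hT) fun t ht => ?_
  rw [intervalIntegral.integral_eq_sub_of_hasDerivAt_of_le ht.1
    (fun s hs => ((hv s hs.1).continuousWithinAt).mono Icc_subset_Ici_self)
    (fun s hs => (hv s hs.1.le).hasDerivAt (Ici_mem_nhds hs.1)) (hi t ht.1)]
  ring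

/-- Energy estimate. -/
theorem energy {x₁ x₂ g₁ g₂ : ℝ → ℝ} {t₀ T : ℝ} (hT : t₀ ≤ T) (h₁ : ACD x₁ g₁ t₀ T)
    (h₂ : ACD x₂ g₂ t₀ T)
    (h : ∀ t ∈ Ioo t₀ T, x₁ t * g₁ t + x₂ t * g₂ t ≤ x₁ t ^ 2 + x₂ t ^ 2) :
    x₁ T ^ 2 + x₂ T ^ 2 ≤ Real.exp (2 * (T - t₀)) * (x₁ t₀ ^ 2 + x₂ t₀ ^ 2) := by
  have he : ACD (fun t => Real.exp (-2 * (t - t₀))) (fun t => Real.exp (-2 * (t - t₀)) * -2)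
      t₀ T := by
    refine acd_of_deriv _ _ (by fun_prop) fun t => ?_
    have := (((hasDerivAt_id t).sub_const t₀).const_mul (-2)).exp
    simpa using this
  have hV := he.mul ((h₁.mul h₁).add (h₂.mul h₂))
  have := hV.le hT (fun t ht => by
    have h3 := h t ht
    have h4 := Real.exp_pos (-2 * (t - t₀))
    have : Real.exp (-2 * (t - t₀)) * -2 * (x₁ t * x₁ t + x₂ t * x₂ t) +
        Real.exp (-2 * (t - t₀)) * (g₁ t * x₁ t + x₁ t * g₁ t + (g₂ t * x₂ t + x₂ t * g₂ t)) =
        Real.exp (-2 * (t - t₀)) *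
          (2 * (x₁ t * g₁ t + x₂ t * g₂ t - (x₁ t ^ 2 + x₂ t ^ 2))) := by ring
    rw [this]
    exact mul_nonpos_of_nonneg_of_nonpos h4.le (by linarith))
  simp only [sub_self, mul_zero, Real.exp_zero, one_mul] at this
  have h5 : Real.exp (2 * (T - t₀)) * Real.exp (-2 * (T - t₀)) = 1 := by
    rw [← Real.exp_add]; ring_nf; simp
  have h6 := mul_le_mul_of_nonneg_left this (Real.exp_pos (2 * (T - t₀))).le
  rw [← mul_assoc, h5] at h6
  linarith

/-- The planar field after removal of the disturbance. -/
def planarP (p : ℝ × (ℝ × ℝ)) : ℝ × ℝ :=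
  (p.2.1 + p.1 ^ 3 * p.2.2 ^ 3, -p.2.1 * p.1 * p.2.2 ^ 2)

theorem intervalIntegrable_d {d : ℝ → ℝ} (hd : Measurable d) (hb : ∀ t, d t ∈ Icc (-1 : ℝ) 1)
    (a b : ℝ) : IntervalIntegrable d volume a b := by
  have h1 : IntervalIntegrable (fun _ => (1 : ℝ)) volume a b := intervalIntegrable_const
  refine h1.mono_fun hd.aestronglyMeasurable ?_
  filter_upwards with t
  simpa using abs_le.2 (hb t)

theorem exists_planar {d : ℝ → ℝ} (hd : Measurable d) (hb : ∀ t, d t ∈ Icc (-1 : ℝ) 1)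
    (t₀ a₁ a₂ : ℝ) : ∃ x₁ x₂ : ℝ → ℝ, x₁ t₀ = a₁ ∧ x₂ t₀ = a₂ ∧
      ContinuousOn x₁ (Ici t₀) ∧ ContinuousOn x₂ (Ici t₀) ∧
      (∀ t ∈ Ici t₀, x₁ t = x₁ t₀ + ∫ s in t₀..t, (x₁ s + (x₂ s) ^ 3)) ∧
      (∀ t ∈ Ici t₀, x₂ t = x₂ t₀ +
        ∫ s in t₀..t, (-(x₁ s) * (x₂ s) ^ 2 + d s * x₂ s)) := by
  have hdi := intervalIntegrable_d hd hb
  set D : ℝ → ℝ := fun t => ∫ s in t₀..t, d s with hD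
  have hDc : Continuous D := intervalIntegral.continuous_primitive hdi t₀
  have hD0 : D t₀ = 0 := by simp [hD]
  have hDb : ∀ t ∈ Ici t₀, |D t| ≤ t - t₀ := by
    intro t ht
    have := intervalIntegral.norm_integral_le_of_norm_le_const (a := t₀) (b := t) (C := 1)
      (f := d) (fun s _ => abs_le.2 (hb s))
    rw [abs_of_nonneg (by simpa using ht)] at this
    simpa using this
  set r : ℝ := |a₁| + |a₂| + 1 with hr
  have hr0 : 0 < r := by positivity
  set N : ℝ → ℝ := fun t => Real.exp (2 * (t - t₀)) * r with hNdef
  have hN0 : ∀ t, 0 < N t := fun t => by positivity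
  have hNc : Continuous N := by fun_prop
  set f : ℝ → ℝ × ℝ → ℝ × ℝ := fun t u => planarP (Real.exp (D t), ret (N t) u) with hf
  have hPc : ContDiff ℝ 1 planarP := by unfold planarP; fun_prop
  have hL : ∀ T, ∃ K : NNReal, ∀ t ∈ Icc t₀ T, LipschitzWith K (f t) := by
    intro T
    obtain ⟨K, hK⟩ := LocallyLipschitzOn.exists_lipschitzOnWith_of_compact
      ((isCompact_closedBall (0 : ℝ) (Real.exp (T - t₀))).prod
        (isCompact_closedBall (0 : ℝ × ℝ) (N T)))
      (hPc.locallyLipschitz.locallyLipschitzOn)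
    refine ⟨K * 2, fun t ht => LipschitzWith.of_dist_le_mul fun u v => ?_⟩
    have hmem : ∀ u : ℝ × ℝ, (Real.exp (D t), ret (N t) u) ∈
        (Metric.closedBall (0 : ℝ) (Real.exp (T - t₀)) ×ˢ
          Metric.closedBall (0 : ℝ × ℝ) (N T)) := by
      intro u
      refine ⟨?_, ?_⟩
      · rw [mem_closedBall_zero_iff, Real.norm_of_nonneg (Real.exp_pos _).le, Real.exp_le_exp]
        exact (le_abs_self _).trans ((hDb t ht.1).trans (by linarith [ht.2]))
      · rw [mem_closedBall_zero_iff]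
        refine (ret_norm_le (hN0 t) u).trans ?_
        simp only [hNdef]
        gcongr
        exact ht.2
    have h1 := hK.dist_le_mul _ (hmem u) _ (hmem v)
    have h2 := (ret_lipschitz (E := ℝ × ℝ) (hN0 t)).dist_le_mul u v
    have h3 : dist (Real.exp (D t), ret (N t) u) (Real.exp (D t), ret (N t) v) =
        dist (ret (N t) u) (ret (N t) v) := by
      rw [Prod.dist_eq, dist_self]; exact max_eq_right dist_nonneg
    rw [h3] at h1
    refine h1.trans ?_
    push_cast at h2 ⊢
    rw [mul_assoc]
    gcongr
  have hretc : ∀ u : ℝ → ℝ × ℝ, ContinuousOn u (Ici t₀) →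
      ContinuousOn (fun t => f t (u t)) (Ici t₀) := by
    intro u hu
    refine hPc.continuous.comp_continuousOn (ContinuousOn.prodMk (by fun_prop) ?_)
    unfold ret
    refine ContinuousOn.smul (ContinuousOn.div hNc.continuousOn
      (ContinuousOn.sup hNc.continuousOn hu.norm) fun t _ => ?_) hu
    exact (lt_max_of_lt_left (hN0 t)).ne'
  obtain ⟨u, hu0, hu⟩ := exists_sol_Ici f t₀ (a₁, a₂) hL
    (fun x => hretc (fun _ => x) continuousOn_const)
  have huc : ContinuousOn u (Ici t₀) := fun t ht => (hu t ht).continuousWithinAt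
  have hfc := hretc u huc
  set g₁ : ℝ → ℝ := fun t => (f t (u t)).1
  set g₂ : ℝ → ℝ := fun t => (f t (u t)).2
  have h₁ := fun T hT => acd_of_hasDerivWithinAt (v := fun t => (u t).1) (g := g₁)
    (fun t ht => hdw_fst (hu t ht)) hfc.fst T hT
  have h₂ := fun T hT => acd_of_hasDerivWithinAt (v := fun t => (u t).2) (g := g₂)
    (fun t ht => hdw_snd (hu t ht)) hfc.snd T hT
  have hDa : ∀ T, t₀ ≤ T → ACD D d t₀ T := fun T hT =>
    acd_of_integral hT (hdi _ _) (fun t _ => by rw [hD0, zero_add])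
  have hx₂ := fun T hT => (hDa T hT).exp.mul (h₂ T hT)
  -- a priori bound
  have hbound : ∀ t ∈ Ici t₀, ret (N t) (u t) = u t := by
    intro T hT
    have hen := energy hT (h₁ T hT) (hx₂ T hT) (fun t ht => by
      simp only [g₁, g₂, hf, planarP, ret, Prod.smul_fst, Prod.smul_snd, smul_eq_mul]
      set l := N t / max (N t) ‖u t‖ with hl
      have hm : 0 < max (N t) ‖u t‖ := lt_max_of_lt_left (hN0 t)
      have hl1 : l ≤ 1 := (div_le_one hm).2 (le_max_left _ _)
      have hd1 := (hb t).2
      set e := Real.exp (D t)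
      set p := (u t).1
      set q := (u t).2
      have : p * (l * p + e ^ 3 * (l * q) ^ 3) +
          e * q * (e * d t * q + e * (-(l * p) * e * (l * q) ^ 2)) =
          l * p ^ 2 + d t * (e * q) ^ 2 := by ring
      rw [this]
      nlinarith [sq_nonneg p, sq_nonneg (e * q)])
    simp only [hu0, hD0, Real.exp_zero, one_mul] at hen
    have h1 : a₁ ^ 2 + a₂ ^ 2 ≤ r ^ 2 := by
      rw [hr]
      nlinarith [abs_nonneg a₁, abs_nonneg a₂, sq_abs a₁, sq_abs a₂,
        mul_nonneg (abs_nonneg a₁) (abs_nonneg a₂)]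
    have h2 : Real.exp (2 * (T - t₀)) * (a₁ ^ 2 + a₂ ^ 2) ≤ (Real.exp (T - t₀) * r) ^ 2 := by
      have : Real.exp (2 * (T - t₀)) = Real.exp (T - t₀) ^ 2 := by
        rw [← Real.exp_nat_mul]; norm_num
      rw [this, mul_pow]
      gcongr
    have h3 : |(u T).1| ≤ Real.exp (T - t₀) * r :=
      abs_le_of_sq_le_sq (by nlinarith [sq_nonneg (Real.exp (D T) * (u T).2)]) (by positivity)
    have h4 : |Real.exp (D T) * (u T).2| ≤ Real.exp (T - t₀) * r :=
      abs_le_of_sq_le_sq (by nlinarith [sq_nonneg (u T).1]) (by positivity)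
    have hE1 : 1 ≤ Real.exp (T - t₀) := Real.one_le_exp (by simpa using hT)
    have hNe : N T = Real.exp (T - t₀) * (Real.exp (T - t₀) * r) := by
      simp only [hNdef]; rw [← mul_assoc, ← Real.exp_add]; ring_nf
    refine ret_eq (hN0 T) ?_
    rw [Prod.norm_def, hNe]
    refine max_le ?_ ?_
    · refine h3.trans (le_mul_of_one_le_left (by positivity) hE1)
    · have : (u T).2 = Real.exp (-D T) * (Real.exp (D T) * (u T).2) := by
        rw [← mul_assoc, ← Real.exp_add]; simp
      rw [this, norm_mul, Real.norm_of_nonneg (Real.exp_pos _).le]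
      refine mul_le_mul ?_ h4 (norm_nonneg _) (Real.exp_pos _).le
      exact Real.exp_le_exp.2 ((neg_le_abs _).trans (hDb T hT))
  refine ⟨fun t => (u t).1, fun t => Real.exp (D t) * (u t).2, by simp [hu0],
    by simp [hu0, hD0], huc.fst, ?_, fun t ht => ?_, fun t ht => ?_⟩
  · exact (by fun_prop : ContinuousOn (fun t => Real.exp (D t)) (Ici t₀)).mul huc.snd
  · refine ((h₁ t ht).congr (fun s hs => ?_)).eq_integral ht
    simp only [g₁, hf, hbound s hs.1.le, planarP]
    ring
  · refine ((hx₂ t ht).congr (fun s hs => ?_)).eq_integral ht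
    simp only [g₂, hf, hbound s hs.1.le, planarP]
    ring

theorem exists_lin (R t₀ b₁ b₂ : ℝ) {x₁ : ℝ → ℝ} (hx : ContinuousOn x₁ (Ici t₀)) :
    ∃ z₁ z₂ : ℝ → ℝ, z₁ t₀ = b₁ ∧ z₂ t₀ = b₂ ∧
      ContinuousOn z₁ (Ici t₀) ∧ ContinuousOn z₂ (Ici t₀) ∧
      (∀ t ∈ Ici t₀, z₁ t = z₁ t₀ + ∫ s in t₀..t,
        (x₁ s + z₂ s - 12 * R * Real.exp (10 * s) * (z₁ s - x₁ s))) ∧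
      (∀ t ∈ Ici t₀, z₂ t = z₂ t₀ + ∫ s in t₀..t,
        (-(72 * R ^ 2 * Real.exp (20 * s) * (z₁ s - x₁ s)))) := by
  set f : ℝ → ℝ × ℝ → ℝ × ℝ := fun s z =>
    (x₁ s + z.2 - 12 * R * Real.exp (10 * s) * (z.1 - x₁ s),
      -(72 * R ^ 2 * Real.exp (20 * s) * (z.1 - x₁ s))) with hf
  have hc : ∀ u : ℝ → ℝ × ℝ, ContinuousOn u (Ici t₀) →
      ContinuousOn (fun t => f t (u t)) (Ici t₀) := by
    intro u hu
    simp only [hf]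
    fun_prop
  have hL : ∀ T, ∃ K : NNReal, ∀ t ∈ Icc t₀ T, LipschitzWith K (f t) := by
    intro T
    set A : ℝ := |12 * R| * Real.exp (10 * T)
    set B : ℝ := 72 * R ^ 2 * Real.exp (20 * T)
    have hA : 0 ≤ A := by positivity
    have hB : 0 ≤ B := by positivity
    refine ⟨⟨1 + A + B, by positivity⟩, fun t ht => LipschitzWith.of_dist_le_mul fun u v => ?_⟩
    have hA' : |12 * R| * Real.exp (10 * t) ≤ A := by
      simp only [A]; gcongr; exact ht.2
    have hB' : 72 * R ^ 2 * Real.exp (20 * t) ≤ B := by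
      simp only [B]; gcongr; exact ht.2
    change dist (f t u) (f t v) ≤ (1 + A + B) * dist u v
    have h1 : |u.1 - v.1| ≤ dist u v := by
      rw [Prod.dist_eq]; exact le_max_left _ _
    have h2 : |u.2 - v.2| ≤ dist u v := by
      rw [Prod.dist_eq]; exact le_max_right _ _
    have h0 : 0 ≤ dist u v := dist_nonneg
    rw [Prod.dist_eq]
    refine max_le ?_ ?_
    · simp only [hf, Real.dist_eq]
      have e : x₁ t + u.2 - 12 * R * Real.exp (10 * t) * (u.1 - x₁ t) -
          (x₁ t + v.2 - 12 * R * Real.exp (10 * t) * (v.1 - x₁ t)) =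
          (u.2 - v.2) - 12 * R * Real.exp (10 * t) * (u.1 - v.1) := by ring
      rw [e]
      refine (abs_sub _ _).trans ?_
      rw [abs_mul, abs_mul (12 * R), abs_of_pos (Real.exp_pos _)]
      have := mul_le_mul hA' h1 (abs_nonneg _) hA
      nlinarith [mul_nonneg hB h0]
    · simp only [hf, Real.dist_eq]
      have e : -(72 * R ^ 2 * Real.exp (20 * t) * (u.1 - x₁ t)) -
          -(72 * R ^ 2 * Real.exp (20 * t) * (v.1 - x₁ t)) =
          -(72 * R ^ 2 * Real.exp (20 * t) * (u.1 - v.1)) := by ring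
      rw [e, abs_neg, abs_mul, abs_of_nonneg (by positivity)]
      have := mul_le_mul hB' h1 (abs_nonneg _) hB
      nlinarith [mul_nonneg hA h0]
  obtain ⟨u, hu0, hu⟩ := exists_sol_Ici f t₀ (b₁, b₂) hL
    (fun x => hc (fun _ => x) continuousOn_const)
  have huc : ContinuousOn u (Ici t₀) := fun t ht => (hu t ht).continuousWithinAt
  have hfc := hc u huc
  refine ⟨fun t => (u t).1, fun t => (u t).2, by simp [hu0], by simp [hu0], huc.fst, huc.snd,
    fun t ht => ?_, fun t ht => ?_⟩
  · exact (acd_of_hasDerivWithinAt (v := fun t => (u t).1) (g := fun t => (f t (u t)).1)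
      (fun t ht => hdw_fst (hu t ht)) hfc.fst t ht).eq_integral ht
  · exact (acd_of_hasDerivWithinAt (v := fun t => (u t).2) (g := fun t => (f t (u t)).2)
      (fun t ht => hdw_snd (hu t ht)) hfc.snd t ht).eq_integral ht
/-! ### The estimate -/

theorem ineq_main {θ F H V p η g S k : ℝ} (hF : 1 ≤ F) (hH : H ≤ F) (hθ : 4 * F ≤ θ)
    (hg : g ^ 2 ≤ 9 * S ^ 2 * F) (hk : k = 9 / 32 * S ^ 2) (hV : V = p ^ 2 + η ^ 2) :
    6 * V + (2 * p * (6 * θ * η - 6 * θ * p + 10 * p) +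
      2 * η * (-6 * θ * p - 6 * θ * η - 10 * p - g)) ≤ 8 * (k - H * V) := by
  have hθ0 : 0 < θ := by linarith
  have hV0 : 0 ≤ V := by rw [hV]; positivity
  have h1 : -2 * g * η ≤ θ * η ^ 2 + 9 / 4 * S ^ 2 := by
    have h2 : g ^ 2 / θ ≤ 9 / 4 * S ^ 2 := by
      rw [div_le_iff₀ hθ0]
      nlinarith [sq_nonneg S]
    have h3 : -2 * g * η ≤ θ * η ^ 2 + g ^ 2 / θ := by
      have : θ * η ^ 2 + g ^ 2 / θ - -2 * g * η = (θ * η + g) ^ 2 / θ := by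
        field_simp; ring
      have h4 : 0 ≤ (θ * η + g) ^ 2 / θ := by positivity
      linarith
    linarith
  have h5 : 0 ≤ (11 * θ - 36 - 8 * H) * V := mul_nonneg (by linarith) hV0
  have h6 : 0 ≤ θ * p ^ 2 := by positivity
  rw [hV] at h5 ⊢
  rw [hk]
  nlinarith [sq_nonneg (p + η), sq_nonneg η, sq_nonneg p]

theorem cube_root_est {x z B : ℝ} (hB : 0 ≤ B) (h : 4 * |z - x ^ 3| ≤ B ^ 3) :
    |x - Real.sign z * |z| ^ ((1 : ℝ) / 3)| ≤ B := by
  set c := Real.sign z * |z| ^ ((1 : ℝ) / 3) with hc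
  have hc3 : c ^ 3 = z := by
    have h1 : (|z| ^ ((1 : ℝ) / 3)) ^ 3 = |z| := by
      rw [← Real.rpow_natCast, ← Real.rpow_mul (abs_nonneg z)]; norm_num
    rw [hc, mul_pow, h1]
    rcases lt_trichotomy z 0 with hz | hz | hz
    · rw [Real.sign_of_neg hz, abs_of_neg hz]; ring
    · simp [hz]
    · rw [Real.sign_of_pos hz, abs_of_pos hz]; ring
  have h2 : |x - c| ^ 3 ≤ 4 * |z - x ^ 3| := by
    rw [← hc3]
    have e : c ^ 3 - x ^ 3 = -((x - c) * (x ^ 2 + x * c + c ^ 2)) := by ring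
    have e2 : 0 ≤ x ^ 2 + x * c + c ^ 2 := by nlinarith [sq_nonneg (x + c), sq_nonneg (x - c)]
    rw [e, abs_neg, abs_mul, abs_of_nonneg e2]
    have e3 : |x - c| ^ 3 = |x - c| * (x - c) ^ 2 := by rw [← sq_abs (x - c)]; ring
    rw [e3]
    have := abs_nonneg (x - c)
    nlinarith [mul_nonneg this (sq_nonneg (x + c))]
  exact le_of_pow_le_pow_left₀ (by norm_num) hB (h2.trans h)

theorem acd_exp_lin (a b c t₀ : ℝ) :
    ACD (fun t => Real.exp (c * (t - t₀))) (fun t => c * Real.exp (c * (t - t₀))) a b := by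
  refine acd_of_deriv _ _ (by fun_prop) fun t => ?_
  have := (((hasDerivAt_id t).sub_const t₀).const_mul c).exp
  simpa [mul_comm] using this

theorem acd_const (a b c : ℝ) : ACD (fun _ => c) (fun _ => 0) a b :=
  acd_of_deriv _ _ (by fun_prop) fun t => hasDerivAt_const t c

set_option maxHeartbeats 1000000 in
theorem est_decay {d : ℝ → ℝ} (hd : Measurable d) (hb : ∀ t, d t ∈ Icc (-1 : ℝ) 1) {t₀ : ℝ}
    (ht₀ : 0 ≤ t₀) {x₁ x₂ z₁ z₂ : ℝ → ℝ} (hs : EstSol 4 d t₀ x₁ x₂ z₁ z₂) {T : ℝ} (hT : t₀ ≤ T)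
    {r : ℝ} (hr : r = Real.sqrt ((x₁ t₀) ^ 2 + (x₂ t₀) ^ 2)) :
    (z₂ T - x₂ T ^ 3) ^ 2 ≤ 2 * (Real.exp (-6 * (T - t₀)) *
      (3 * (24 * Real.exp (10 * t₀) * (z₁ t₀ - x₁ t₀)) ^ 2 + 2 * (z₂ t₀ - x₂ t₀ ^ 3) ^ 2 +
        9 / 32 * (r ^ 3 + r ^ 5) ^ 2)) := by
  obtain ⟨cx₁, cx₂, cz₁, cz₂, ex₁, ex₂, ez₁, ez₂⟩ := hs
  have hr0 : 0 ≤ r := hr ▸ Real.sqrt_nonneg _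
  have hr2 : r ^ 2 = (x₁ t₀) ^ 2 + (x₂ t₀) ^ 2 := by rw [hr, Real.sq_sqrt (by positivity)]
  have hsub : ∀ t, t₀ ≤ t → uIcc t₀ t ⊆ Ici t₀ := fun t ht => by
    rw [uIcc_of_le ht]; exact Icc_subset_Ici_self
  have ax₁ : ∀ t, t₀ ≤ t → ACD x₁ (fun s => x₁ s + (x₂ s) ^ 3) t₀ t := fun t ht =>
    acd_of_integral ht (ContinuousOn.intervalIntegrable
      ((by fun_prop : ContinuousOn _ (Ici t₀)).mono (hsub t ht))) fun s hs => ex₁ s hs.1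
  have ax₂ : ∀ t, t₀ ≤ t → ACD x₂ (fun s => -(x₁ s) * (x₂ s) ^ 2 + d s * x₂ s) t₀ t :=
    fun t ht => acd_of_integral ht (IntervalIntegrable.add (ContinuousOn.intervalIntegrable
      ((by fun_prop : ContinuousOn (fun s => -(x₁ s) * (x₂ s) ^ 2) (Ici t₀)).mono (hsub t ht)))
      ((intervalIntegrable_d hd hb _ _).mul_continuousOn (cx₂.mono (hsub t ht))))
      fun s hs => ex₂ s hs.1
  have az₁ : ACD z₁ (fun s => x₁ s + z₂ s - 12 * 4 * Real.exp (10 * s) * (z₁ s - x₁ s)) t₀ T :=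
    acd_of_integral hT (ContinuousOn.intervalIntegrable
      ((by fun_prop : ContinuousOn _ (Ici t₀)).mono (hsub T hT))) fun s hs => ez₁ s hs.1
  have az₂ : ACD z₂ (fun s => -(72 * 4 ^ 2 * Real.exp (20 * s) * (z₁ s - x₁ s))) t₀ T :=
    acd_of_integral hT (ContinuousOn.intervalIntegrable
      ((by fun_prop : ContinuousOn _ (Ici t₀)).mono (hsub T hT))) fun s hs => ez₂ s hs.1
  -- growth of the state
  have hgrow : ∀ t, t₀ ≤ t → x₁ t ^ 2 + x₂ t ^ 2 ≤ (Real.exp (t - t₀) * r) ^ 2 := by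
    intro t ht
    have := energy ht (ax₁ t ht) (ax₂ t ht) (fun s _ => by
      have := (hb s).2
      nlinarith [sq_nonneg (x₂ s)])
    have h2 : Real.exp (2 * (t - t₀)) = Real.exp (t - t₀) ^ 2 := by
      rw [← Real.exp_nat_mul]; norm_num
    rwa [← hr2, h2, ← mul_pow] at this
  set S : ℝ := r ^ 3 + r ^ 5 with hS
  have hS0 : 0 ≤ S := by positivity
  set g : ℝ → ℝ := fun t => 3 * x₂ t ^ 2 * (-(x₁ t) * (x₂ t) ^ 2 + d t * x₂ t) with hg
  have hgb : ∀ t, t₀ ≤ t → g t ^ 2 ≤ 9 * S ^ 2 * Real.exp (10 * (t - t₀)) := by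
    intro t ht
    set q := Real.exp (t - t₀) with hq
    have hq1 : 1 ≤ q := Real.one_le_exp (by linarith)
    have hG := hgrow t ht
    have hqr : 0 ≤ q * r := by positivity
    have h1 : |x₁ t| ≤ q * r := abs_le_of_sq_le_sq (by nlinarith [sq_nonneg (x₂ t)]) hqr
    have h2 : |x₂ t| ≤ q * r := abs_le_of_sq_le_sq (by nlinarith [sq_nonneg (x₁ t)]) hqr
    have h3 : |g t| ≤ 3 * (S * q ^ 5) := by
      have e : g t = 3 * (-(x₁ t * x₂ t ^ 4) + d t * x₂ t ^ 3) := by simp only [hg]; ring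
      rw [e, abs_mul, abs_of_pos (by norm_num : (0:ℝ) < 3)]
      gcongr
      refine (abs_add_le _ _).trans ?_
      rw [abs_neg, abs_mul, abs_mul, abs_pow, abs_pow]
      have k1 : |x₁ t| * |x₂ t| ^ 4 ≤ (q * r) * (q * r) ^ 4 := by gcongr
      have k2 : |d t| * |x₂ t| ^ 3 ≤ 1 * (q * r) ^ 3 := by
        gcongr
        exact abs_le.2 (hb t)
      have k3 : r ^ 3 * q ^ 3 ≤ r ^ 3 * q ^ 5 := by gcongr <;> norm_num
      rw [hS]
      nlinarith
    have h4 : Real.exp (10 * (t - t₀)) = q ^ 10 := by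
      rw [hq, ← Real.exp_nat_mul]; norm_num
    rw [h4, ← sq_abs]
    calc |g t| ^ 2 ≤ (3 * (S * q ^ 5)) ^ 2 := by gcongr
      _ = _ := by ring
  -- error variables
  set p : ℝ → ℝ := fun t => (24 * Real.exp (10 * (t - 0))) * (z₁ t - x₁ t) with hp
  set η : ℝ → ℝ := fun t => (z₂ t - x₂ t * (x₂ t * x₂ t)) - p t with hη
  have h20 : ∀ t, Real.exp (20 * t) = Real.exp (10 * t) * Real.exp (10 * t) := fun t => by
    rw [← Real.exp_add]; ring_nf
  have ap : ACD p (fun t => 6 * (4 * Real.exp (10 * t)) * η t -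
      6 * (4 * Real.exp (10 * t)) * p t + 10 * p t) t₀ T := by
    refine (((acd_const t₀ T 24).mul (acd_exp_lin t₀ T 10 0)).mul
      (az₁.sub (ax₁ T hT))).congr fun t _ => ?_
    simp only [hη, hp, sub_zero]
    ring
  have aη : ACD η (fun t => -6 * (4 * Real.exp (10 * t)) * p t -
      6 * (4 * Real.exp (10 * t)) * η t - 10 * p t - g t) t₀ T := by
    have ax := ax₂ T hT
    refine ((az₂.sub (ax.mul (ax.mul ax))).sub ap).congr fun t _ => ?_
    simp only [hη, hp, hg, sub_zero, h20]
    ring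
  set k : ℝ := 9 / 32 * S ^ 2 with hk
  set W : ℝ → ℝ := fun t => Real.exp (6 * (t - t₀)) * (p t * p t + η t * η t) with hW
  have aH := acd_exp_lin t₀ T 6 t₀
  have aY := ((aH.mul ((ap.mul ap).add (aη.mul aη))).sub (acd_const t₀ T k)).mul
    ((acd_const t₀ T (4 / 3)).mul aH).exp
  have hY := aY.le hT (fun t ht => by
    have hF : 1 ≤ Real.exp (10 * (t - t₀)) := Real.one_le_exp (by linarith [ht.1])
    have hH : Real.exp (6 * (t - t₀)) ≤ Real.exp (10 * (t - t₀)) :=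
      Real.exp_le_exp.2 (by linarith [ht.1])
    have hθ : 4 * Real.exp (10 * (t - t₀)) ≤ 4 * Real.exp (10 * t) := by
      gcongr; linarith
    have hm := ineq_main (p := p t) (η := η t) hF hH hθ (hgb t ht.1.le) hk rfl
    have hHp := Real.exp_pos (6 * (t - t₀))
    set H := Real.exp (6 * (t - t₀))
    have hX := Real.exp_pos (4 / 3 * H)
    set X := Real.exp (4 / 3 * H)
    set θ := 4 * Real.exp (10 * t)
    have e := mul_nonneg (mul_nonneg hHp.le hX.le) (sub_nonneg.2 hm)
    refine le_of_eq_of_le ?_ (neg_nonpos.2 e)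
    clear_value p η g X H θ
    clear * -
    ring)
  simp only [sub_self, mul_zero, Real.exp_zero, one_mul, mul_one] at hY
  have hWk : W T ≤ (p t₀ * p t₀ + η t₀ * η t₀) + k := by
    by_contra hcon
    push Not at hcon
    have hk0 : 0 ≤ k := by positivity
    have hV0 : 0 ≤ p t₀ * p t₀ + η t₀ * η t₀ := by
      nlinarith [mul_self_nonneg (p t₀), mul_self_nonneg (η t₀)]
    have h1 : Real.exp (4 / 3) ≤ Real.exp (4 / 3 * Real.exp (6 * (T - t₀))) := by
      apply Real.exp_le_exp.2
      have : 1 ≤ Real.exp (6 * (T - t₀)) := Real.one_le_exp (by linarith)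
      linarith
    have h2 := mul_le_mul_of_nonneg_left h1 (show 0 ≤ W T - k by linarith)
    have h3 := Real.exp_pos (4 / 3 : ℝ)
    have h4 : (p t₀ * p t₀ + η t₀ * η t₀ - k) * Real.exp (4 / 3) < (W T - k) * Real.exp (4 / 3) :=
      mul_lt_mul_of_pos_right (by linarith) h3
    simp only [hW] at h2 h4
    linarith
  have hV : p T * p T + η T * η T ≤ Real.exp (-6 * (T - t₀)) *
      ((p t₀ * p t₀ + η t₀ * η t₀) + k) := by
    have e : Real.exp (-6 * (T - t₀)) * W T = p T * p T + η T * η T := by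
      simp only [hW]
      rw [← mul_assoc, ← Real.exp_add]; ring_nf; simp
    rw [← e]
    gcongr
  have hfin : (z₂ T - x₂ T ^ 3) ^ 2 ≤ 2 * (p T * p T + η T * η T) := by
    have : z₂ T - x₂ T ^ 3 = η T + p T := by simp only [hη]; ring
    rw [this]
    nlinarith [sq_nonneg (η T - p T)]
  refine hfin.trans ?_
  have h0 : p t₀ * p t₀ + η t₀ * η t₀ ≤ 3 * (24 * Real.exp (10 * t₀) * (z₁ t₀ - x₁ t₀)) ^ 2 +
      2 * (z₂ t₀ - x₂ t₀ ^ 3) ^ 2 := by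
    have e1 : 24 * Real.exp (10 * t₀) * (z₁ t₀ - x₁ t₀) = p t₀ := by simp [hp]
    have e2 : z₂ t₀ - x₂ t₀ ^ 3 = η t₀ + p t₀ := by simp only [hη]; ring
    rw [e1, e2]
    nlinarith [sq_nonneg (η t₀ + p t₀ + p t₀)]
  refine mul_le_mul_of_nonneg_left (hV.trans ?_) (by norm_num)
  gcongr

/-- Example 3.2: there exist `R > 0`, `ρ ∈ K⁺` and `M > 0` such that for every
measurable `d : [0,∞) → [−1,1]`, every `t₀ ≥ 0` and every initial condition,
solutions of the coupled system exist globally forward, and along every solution the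
reconstruction `x̄ = Ψ(t,y,z₂)` with `Ψ(t,y,z) = (y, sgn(z)|z|^{1/3})` satisfies
`|x(t) − Ψ(t,y(t),z₂(t))| ≤ e^{−(t−t₀)}·2·(ρ(t₀)|z(t₀) − (x₁(t₀),x₂(t₀)³)| +
M(|x₀| + |x₀|³ + |x₀|⁵))^{1/3}` for all `t ≥ t₀`. -/
theorem planar_estimator_exp_convergence :
    ∃ R > (0:ℝ), ∃ ρ : ℝ → ℝ, IsKPlus ρ ∧ ∃ M > (0:ℝ),
      ∀ d : ℝ → ℝ, Measurable d → (∀ t, d t ∈ Set.Icc (-1:ℝ) 1) →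
      ∀ t₀ ≥ (0:ℝ),
        (∀ a₁ a₂ b₁ b₂ : ℝ, ∃ x₁ x₂ z₁ z₂ : ℝ → ℝ,
          x₁ t₀ = a₁ ∧ x₂ t₀ = a₂ ∧ z₁ t₀ = b₁ ∧ z₂ t₀ = b₂ ∧
          EstSol R d t₀ x₁ x₂ z₁ z₂) ∧
        (∀ x₁ x₂ z₁ z₂ : ℝ → ℝ, EstSol R d t₀ x₁ x₂ z₁ z₂ →
          ∀ t ≥ t₀,
            Real.sqrt ((x₁ t - x₁ t) ^ 2 +
                (x₂ t - Real.sign (z₂ t) * |z₂ t| ^ ((1:ℝ)/3)) ^ 2) ≤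
              Real.exp (-(t - t₀)) * 2 *
                (ρ t₀ * Real.sqrt ((z₁ t₀ - x₁ t₀) ^ 2 + (z₂ t₀ - (x₂ t₀) ^ 3) ^ 2) +
                  M * (Real.sqrt ((x₁ t₀) ^ 2 + (x₂ t₀) ^ 2) +
                    Real.sqrt ((x₁ t₀) ^ 2 + (x₂ t₀) ^ 2) ^ 3 +
                    Real.sqrt ((x₁ t₀) ^ 2 + (x₂ t₀) ^ 2) ^ 5)) ^ ((1:ℝ)/3)) := by
  
  refine ⟨4, by norm_num, fun t => 42 * Real.exp (10 * t), ⟨by fun_prop, fun t _ => by positivity⟩,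
    1, one_pos, fun d hd hb t₀ ht₀ => ⟨fun a₁ a₂ b₁ b₂ => ?_, fun x₁ x₂ z₁ z₂ hs t ht => ?_⟩⟩
  · obtain ⟨x₁, x₂, i₁, i₂, c₁, c₂, e₁, e₂⟩ := exists_planar hd hb t₀ a₁ a₂
    obtain ⟨z₁, z₂, j₁, j₂, c₃, c₄, e₃, e₄⟩ := exists_lin 4 t₀ b₁ b₂ c₁
    exact ⟨x₁, x₂, z₁, z₂, i₁, i₂, j₁, j₂, c₁, c₂, c₃, c₄, e₁, e₂, e₃, e₄⟩
  · have hmain := est_decay hd hb ht₀ hs ht rfl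
    set r := Real.sqrt ((x₁ t₀) ^ 2 + (x₂ t₀) ^ 2) with hr
    have hr0 : 0 ≤ r := Real.sqrt_nonneg _
    set w := Real.sqrt ((z₁ t₀ - x₁ t₀) ^ 2 + (z₂ t₀ - (x₂ t₀) ^ 3) ^ 2) with hw
    have hw0 : 0 ≤ w := Real.sqrt_nonneg _
    have hw2 : w ^ 2 = (z₁ t₀ - x₁ t₀) ^ 2 + (z₂ t₀ - (x₂ t₀) ^ 3) ^ 2 := by
      rw [hw, Real.sq_sqrt (by positivity)]
    set F := Real.exp (10 * t₀) with hF
    have hF1 : 1 ≤ F := Real.one_le_exp (by linarith)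
    set Q : ℝ := 42 * F * w + 1 * (r + r ^ 3 + r ^ 5) with hQ
    have hQ0 : 0 ≤ Q := by positivity
    rw [sub_self, zero_pow two_ne_zero, zero_add, Real.sqrt_sq_eq_abs]
    apply cube_root_est (by positivity)
    have h1 : 3 * (24 * F * (z₁ t₀ - x₁ t₀)) ^ 2 + 2 * (z₂ t₀ - x₂ t₀ ^ 3) ^ 2 +
        9 / 32 * (r ^ 3 + r ^ 5) ^ 2 ≤ Q ^ 2 := by
      have k1 : 3 * (24 * F * (z₁ t₀ - x₁ t₀)) ^ 2 + 2 * (z₂ t₀ - x₂ t₀ ^ 3) ^ 2 ≤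
          (42 * F * w) ^ 2 := by
        have : (42 * F * w) ^ 2 = 1764 * F ^ 2 * ((z₁ t₀ - x₁ t₀) ^ 2 +
          (z₂ t₀ - (x₂ t₀) ^ 3) ^ 2) := by rw [← hw2]; ring
        rw [this]
        have hF2 : 1 ≤ F ^ 2 := one_le_pow₀ hF1
        nlinarith [mul_nonneg (sub_nonneg.2 hF2) (sq_nonneg (z₂ t₀ - (x₂ t₀) ^ 3)),
          mul_nonneg (sq_nonneg F) (sq_nonneg (z₁ t₀ - x₁ t₀)),
          sq_nonneg (z₂ t₀ - (x₂ t₀) ^ 3)]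
      have k2 : (r ^ 3 + r ^ 5) ^ 2 ≤ (1 * (r + r ^ 3 + r ^ 5)) ^ 2 := by
        gcongr; linarith
      have k3 : 0 ≤ (42 * F * w) * (1 * (r + r ^ 3 + r ^ 5)) := by positivity
      rw [hQ]
      nlinarith [sq_nonneg (r ^ 3 + r ^ 5)]
    have he : Real.exp (-6 * (t - t₀)) = (Real.exp (-(t - t₀)) ^ 3) ^ 2 := by
      rw [← pow_mul, ← Real.exp_nat_mul]; push_cast; ring_nf
    have h2 : |z₂ t - x₂ t ^ 3| ≤ 2 * (Real.exp (-(t - t₀)) ^ 3 * Q) := by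
      refine abs_le_of_sq_le_sq (hmain.trans ?_) (by positivity)
      rw [he]
      have := mul_le_mul_of_nonneg_left h1 (sq_nonneg (Real.exp (-(t - t₀)) ^ 3))
      nlinarith [mul_nonneg (sq_nonneg (Real.exp (-(t - t₀)) ^ 3)) (sq_nonneg Q)]
    have hQ3 : (Q ^ ((1 : ℝ) / 3)) ^ 3 = Q := by
      rw [← Real.rpow_natCast, ← Real.rpow_mul hQ0]; norm_num
    rw [mul_pow, mul_pow, hQ3]
    linarith
end
end
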